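/- arXiv:1708.08820 — 4 statements merged into one kernel-verified Lean document; each statement's English description precedes it below -/
import Mathlib

section
/- Suppose the real random variable Y satisfies E[exp(b |Y|^a)] < ∞ for some b > 0 and some a > 1, and the entire function z ↦ E[exp(z Y)] is nonzero at every z ∈ ℂ with Re z ≠ 0 (only pure imaginary zeros). Then Y − E[Y] is of Lee–Yang type; in particular Y − E[Y] and −(Y − E[Y]) have the same distribution, and E[exp(b′ (Y − E[Y])²)] < ∞ for some b′ > 0. -/
open MeasureTheory

/-- A real random variable `X` (on a probability space `(Ω, P)`) is of Lee–Yang type if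
(1) `X` and `-X` have the same distribution, (2) `E[exp(b X²)] < ∞` for some `b > 0`, and
(3) the moment generating function `z ↦ E[exp(z X)]` is nonzero whenever `Re z ≠ 0`. -/
def IsLeeYangRV {Ω : Type*} [MeasurableSpace Ω] (P : Measure Ω) (X : Ω → ℝ) : Prop :=
  P.map (fun ω => -(X ω)) = P.map X ∧
  (∃ b : ℝ, 0 < b ∧ Integrable (fun ω => Real.exp (b * (X ω) ^ 2)) P) ∧
  (∀ z : ℂ, z.re ≠ 0 → (∫ ω, Complex.exp (z * (X ω : ℂ)) ∂P) ≠ 0)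

section EntireFunctions

open Filter Topology Complex ComplexConjugate

/-- The logarithm of the modulus of the Weierstrass elementary factor of genus `p` at `-w`. -/
noncomputable def logRem (p : ℕ) (w : ℂ) : ℝ :=
  Real.log ‖1 + w‖ - (logTaylor (p + 1) w).re

lemma logRem_succ (p : ℕ) (w : ℂ) :
    logRem (p + 1) w = logRem p w + (-1) ^ (p + 1) * (w ^ (p + 1)).re / (p + 1) := by
  have h : (((-1 : ℂ) ^ (p + 2) * w ^ (p + 1) / ((p + 1 : ℕ) : ℂ))).re
      = (-1) ^ (p + 2) * (w ^ (p + 1)).re / (p + 1) := by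
    have : ((-1 : ℂ) ^ (p + 2) * w ^ (p + 1) / ((p + 1 : ℕ) : ℂ))
        = (((-1) ^ (p + 2) / (p + 1) : ℝ) : ℂ) * w ^ (p + 1) := by
      push_cast; ring
    rw [this, re_ofReal_mul]; ring
  unfold logRem
  rw [logTaylor_succ (p + 1), Pi.add_apply, add_re, h]
  ring

lemma logRem_zero_right (p : ℕ) : logRem p 0 = 0 := by
  simp [logRem, logTaylor_at_zero]

lemma one_add_mem_slitPlane {w : ℂ} (hw : w = 0 ∨ w ∈ slitPlane) : 1 + w ∈ slitPlane := by
  rcases hw with rfl | hw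
  · simp
  · rw [mem_slitPlane_iff] at hw ⊢
    rcases hw with h | h
    · left; simp; linarith
    · right; simpa using h

lemma hasDerivAt_logRem (p : ℕ) {e : ℂ} {t : ℝ} (h : 1 + t * e ∈ slitPlane) :
    HasDerivAt (fun s : ℝ => logRem p (s * e)) ((e * (-(t * e)) ^ p * (1 + t * e)⁻¹).re) t := by
  have h1 := hasDerivAt_log_sub_logTaylor p h
  have h2 : HasDerivAt (fun s : ℂ => s * e) e (t : ℂ) := by
    simpa using (hasDerivAt_id (t : ℂ)).mul_const e
  have h3 := (h1.comp (t : ℂ) h2).real_of_complex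
  refine (h3.congr_deriv (by congr 1; ring)).congr_of_eventuallyEq
    (Eventually.of_forall fun s => ?_)
  simp [logRem, Complex.log_re]

lemma nonneg_of_hasDerivAt_nonneg {F F' : ℝ → ℝ} (h0 : F 0 = 0)
    (hd : ∀ t, 0 ≤ t → HasDerivAt F (F' t) t) (hF' : ∀ t, 0 ≤ t → 0 ≤ F' t) {t : ℝ} (ht : 0 ≤ t) :
    0 ≤ F t := by
  have : MonotoneOn F (Set.Ici 0) := by
    refine monotoneOn_of_hasDerivWithinAt_nonneg (f' := F') (convex_Ici 0)
      (fun x hx => (hd x hx).continuousAt.continuousWithinAt) (fun x hx => ?_) (fun x hx => ?_)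
    · exact (hd x (interior_subset hx)).hasDerivWithinAt
    · exact hF' x (interior_subset hx)
  simpa [h0] using this (Set.mem_Ici.2 le_rfl) (Set.mem_Ici.2 ht) ht

lemma hasDerivAt_logRem_ofReal (p : ℕ) {t : ℝ} (ht : 0 ≤ t) :
    HasDerivAt (fun s : ℝ => logRem p (s : ℂ)) ((-1) ^ p * (t ^ p / (1 + t))) t := by
  have h : 1 + (t : ℂ) * 1 ∈ slitPlane := by
    left; simp; linarith
  have := hasDerivAt_logRem p h
  simp only [mul_one, one_mul] at this
  refine this.congr_deriv ?_
  have : (-(t : ℂ)) ^ p * (1 + (t : ℂ))⁻¹ = (((-1) ^ p * (t ^ p / (1 + t)) : ℝ) : ℂ) := by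
    rw [neg_pow]; push_cast; ring
  rw [this, ofReal_re]

lemma logRem_ofReal_sign (p : ℕ) {t : ℝ} (ht : 0 ≤ t) : 0 ≤ (-1) ^ p * logRem p (t : ℂ) := by
  refine nonneg_of_hasDerivAt_nonneg (F := fun t : ℝ => (-1) ^ p * logRem p (t : ℂ))
    (F' := fun t => t ^ p / (1 + t)) (by simp [logRem_zero_right]) (fun t ht => ?_)
    (fun t ht => by positivity) ht
  refine ((hasDerivAt_logRem_ofReal p ht).const_mul ((-1) ^ p)).congr_deriv ?_
  rw [← mul_assoc, ← mul_pow]; simp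

lemma logRem_ofReal_nonneg {p : ℕ} (hp : Even p) {t : ℝ} (ht : 0 ≤ t) :
    0 ≤ logRem p (t : ℂ) := by
  simpa [hp.neg_one_pow] using logRem_ofReal_sign p ht

lemma logRem_ofReal_nonpos {p : ℕ} (hp : Odd p) {t : ℝ} (ht : 0 ≤ t) :
    logRem p (t : ℂ) ≤ 0 := by
  have := logRem_ofReal_sign p ht
  rw [hp.neg_one_pow] at this; linarith

lemma logRem_mul_le {p : ℕ} (hp : Even p) {l t : ℝ} (hl : 0 ≤ l) (hl1 : l ≤ 1) (ht : 0 ≤ t) :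
    logRem p ((l * t : ℝ) : ℂ) ≤ l ^ p * logRem p (t : ℂ) := by
  rw [← sub_nonneg]
  refine nonneg_of_hasDerivAt_nonneg
    (F := fun t : ℝ => l ^ p * logRem p (t : ℂ) - logRem p ((l * t : ℝ) : ℂ))
    (F' := fun t => l ^ p * (t ^ p / (1 + t)) - ((l * t) ^ p / (1 + l * t)) * l)
    (by simp [logRem_zero_right]) (fun t ht => ?_) (fun t ht => ?_) ht
  · have h1 := (hasDerivAt_logRem_ofReal p ht).const_mul (l ^ p)
    have h2 := (hasDerivAt_logRem_ofReal p (mul_nonneg hl ht)).comp t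
      ((hasDerivAt_id t).const_mul l)
    refine (h1.sub h2).congr_deriv ?_
    simp [hp.neg_one_pow]
  · have : l ^ p * (t ^ p / (1 + t)) - ((l * t) ^ p / (1 + l * t)) * l
        = l ^ p * t ^ p * ((1 - l) / ((1 + t) * (1 + l * t))) := by
      have : 1 + t ≠ 0 := by positivity
      have : 1 + l * t ≠ 0 := by positivity
      rw [mul_pow]; field_simp; ring
    rw [this]
    have : 0 ≤ 1 - l := by linarith
    positivity

lemma logRem_ray_ge {p : ℕ} (hp : Even p) {e : ℂ} (he : ‖e‖ = 1) (hs : e ∈ slitPlane) {c : ℝ}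
    (hc : 0 ≤ c) (h1 : (e ^ p).re = c) (h2 : (e ^ (p + 1)).re = c) {t : ℝ} (ht : 0 ≤ t) :
    c * logRem p (t : ℂ) ≤ logRem p (t * e) := by
  rw [← sub_nonneg]
  have hsl : ∀ t : ℝ, 0 ≤ t → 1 + t * e ∈ slitPlane := fun t ht => by
    apply one_add_mem_slitPlane
    rcases ht.eq_or_lt with rfl | ht
    · simp
    · right
      rw [mem_slitPlane_iff] at hs ⊢
      simp only [re_ofReal_mul, im_ofReal_mul]
      rcases hs with h | h
      · left; positivity
      · right; positivity
  refine nonneg_of_hasDerivAt_nonneg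
    (F := fun t : ℝ => logRem p (t * e) - c * logRem p (t : ℂ))
    (F' := fun t => (e * (-(t * e)) ^ p * (1 + t * e)⁻¹).re - c * (t ^ p / (1 + t)))
    (by simp [logRem_zero_right]) (fun t ht => ?_) (fun t ht => ?_) ht
  · have h3 := (hasDerivAt_logRem_ofReal p ht).const_mul c
    refine ((hasDerivAt_logRem p (hsl t ht)).sub h3).congr_deriv ?_
    simp [hp.neg_one_pow]
  · have hn : 0 < normSq (1 + t * e) := normSq_pos.2 (slitPlane_ne_zero (hsl t ht))
    have hee : e * (starRingEnd ℂ) e = 1 := by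
      rw [mul_conj, normSq_eq_norm_sq, he]; simp
    have key : e * (-(t * e)) ^ p * (1 + t * e)⁻¹
        = ((t ^ p / normSq (1 + t * e) : ℝ) : ℂ) * (e ^ (p + 1) + t * e ^ p) := by
      rw [hp.neg_pow, inv_def]
      simp only [map_add, map_one, map_mul, conj_ofReal]
      push_cast
      have : e ^ (p + 1) + t * e ^ p = e * e ^ p * (1 + t * (starRingEnd ℂ) e) := by
        linear_combination (-(t : ℂ) * e ^ p) * hee
      rw [this]; ring
    rw [key, re_ofReal_mul, add_re, re_ofReal_mul, h1, h2]
    have hle : normSq (1 + t * e) ≤ (1 + t) ^ 2 := by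
      rw [normSq_eq_norm_sq]
      have : ‖1 + t * e‖ ≤ 1 + t := by
        refine (norm_add_le _ _).trans ?_
        simp [he, abs_of_nonneg ht]
      gcongr
    have : c * (t ^ p / (1 + t)) = t ^ p / (1 + t) ^ 2 * (c + t * c) := by
      have : 1 + t ≠ 0 := by positivity
      field_simp
    rw [this, sub_nonneg]
    gcongr

lemma logRem_ofReal_div_pow_tendsto (p : ℕ) :
    Tendsto (fun r : ℝ => logRem p (r : ℂ) / r ^ (p + 1)) atTop (𝓝 0) := by
  induction p with
  | zero =>
    have h := (Real.isLittleO_log_id_atTop.tendsto_div_nhds_zero).comp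
      (tendsto_atTop_add_const_left atTop (1 : ℝ) tendsto_id)
    have h2 : Tendsto (fun r : ℝ => (1 + r) / r) atTop (𝓝 1) := by
      have : Tendsto (fun r : ℝ => r⁻¹ + 1) atTop (𝓝 (0 + 1)) := tendsto_inv_atTop_zero.add_const 1
      rw [zero_add] at this
      refine this.congr' ?_
      filter_upwards [eventually_gt_atTop 0] with r hr
      field_simp
    have h3 := h.mul h2
    rw [zero_mul] at h3
    refine h3.congr' ?_
    filter_upwards [eventually_gt_atTop 0] with r hr
    have : ‖1 + (r : ℂ)‖ = 1 + r := by
      rw [← ofReal_one, ← ofReal_add, norm_real, Real.norm_of_nonneg (by positivity)]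
    simp only [logRem, this, zero_add, logTaylor_succ, logTaylor_zero]
    simp
    field_simp
  | succ p ih =>
    have h := (ih.mul tendsto_inv_atTop_zero).add
      (tendsto_inv_atTop_zero.const_mul ((-1 : ℝ) ^ (p + 1) / (p + 1)))
    simp only [mul_zero, add_zero] at h
    refine h.congr' ?_
    filter_upwards [eventually_gt_atTop 0] with r hr
    rw [logRem_succ, ← ofReal_pow, ofReal_re]
    field_simp
    ring

lemma logRem_ofReal_div_pow_tendsto_succ (p : ℕ) :
    Tendsto (fun r : ℝ => logRem (p + 1) (r : ℂ) / r ^ (p + 1)) atTop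
      (𝓝 ((-1) ^ (p + 1) / (p + 1))) := by
  have h := (logRem_ofReal_div_pow_tendsto p).add_const ((-1 : ℝ) ^ (p + 1) / (p + 1))
  rw [zero_add] at h
  refine h.congr' ?_
  filter_upwards [eventually_gt_atTop 0] with r hr
  rw [logRem_succ, ← ofReal_pow, ofReal_re]
  field_simp

/-- Sum of the logarithmic moduli of the elementary factors of genus `p` over a multiset. -/
noncomputable def remSum (s : Multiset ℝ) (p : ℕ) (w : ℂ) : ℝ :=
  (s.map fun β : ℝ => logRem p (w / (β : ℂ))).sum

/-- Power sums of the inverses of the elements of a multiset. -/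
noncomputable def invPowSum (s : Multiset ℝ) (p : ℕ) : ℝ :=
  (s.map fun β => (β ^ p)⁻¹).sum

lemma remSum_cons (b : ℝ) (s : Multiset ℝ) (p : ℕ) (w : ℂ) :
    remSum (b ::ₘ s) p w = logRem p (w / b) + remSum s p w := by simp [remSum]

lemma remSum_add (s t : Multiset ℝ) (p : ℕ) (w : ℂ) :
    remSum (s + t) p w = remSum s p w + remSum t p w := by simp [remSum]

lemma remSum_succ (s : Multiset ℝ) (p : ℕ) (w : ℂ) :
    remSum s (p + 1) w
      = remSum s p w + (-1) ^ (p + 1) * invPowSum s (p + 1) / (p + 1) * (w ^ (p + 1)).re := by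
  induction s using Multiset.induction_on with
  | empty => simp [remSum, invPowSum]
  | cons b s ih =>
    have h : ((w / (b : ℂ)) ^ (p + 1)).re = (b ^ (p + 1))⁻¹ * (w ^ (p + 1)).re := by
      rw [← re_ofReal_mul]; congr 1; push_cast; rw [div_pow]; ring
    rw [remSum_cons, remSum_cons, ih, logRem_succ, h]
    simp only [invPowSum, Multiset.map_cons, Multiset.sum_cons]
    ring

lemma remSum_nonneg {s : Multiset ℝ} (hs : ∀ β ∈ s, 0 < β) {p : ℕ} (hp : Even p) {r : ℝ}
    (hr : 0 ≤ r) : 0 ≤ remSum s p (r : ℂ) := by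
  refine Multiset.sum_nonneg fun x hx => ?_
  obtain ⟨β, hβ, rfl⟩ := Multiset.mem_map.1 hx
  have := hs β hβ
  rw [← ofReal_div]
  exact logRem_ofReal_nonneg hp (by positivity)

lemma remSum_nonpos {s : Multiset ℝ} (hs : ∀ β ∈ s, 0 < β) {p : ℕ} (hp : Odd p) {r : ℝ}
    (hr : 0 ≤ r) : remSum s p (r : ℂ) ≤ 0 := by
  induction s using Multiset.induction_on with
  | empty => simp [remSum]
  | cons b s ih =>
    have hb := hs b (Multiset.mem_cons_self b s)
    rw [remSum_cons, ← ofReal_div]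
    exact add_nonpos (logRem_ofReal_nonpos hp (by positivity))
      (ih fun β hβ => hs β (Multiset.mem_cons_of_mem hβ))

lemma remSum_le_of_le {s t : Multiset ℝ} (hst : s ≤ t) (ht : ∀ β ∈ t, 0 < β) {p : ℕ}
    (hp : Even p) {r : ℝ} (hr : 0 ≤ r) : remSum s p (r : ℂ) ≤ remSum t p (r : ℂ) := by
  obtain ⟨u, rfl⟩ := Multiset.le_iff_exists_add.1 hst
  rw [remSum_add]
  exact le_add_of_nonneg_right
    (remSum_nonneg (fun β hβ => ht β (Multiset.mem_add.2 (Or.inr hβ))) hp hr)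

lemma remSum_ge_of_le {s t : Multiset ℝ} (hst : s ≤ t) (ht : ∀ β ∈ t, 0 < β) {p : ℕ}
    (hp : Odd p) {r : ℝ} (hr : 0 ≤ r) : remSum t p (r : ℂ) ≤ remSum s p (r : ℂ) := by
  obtain ⟨u, rfl⟩ := Multiset.le_iff_exists_add.1 hst
  rw [remSum_add]
  exact add_le_of_nonpos_right
    (remSum_nonpos (fun β hβ => ht β (Multiset.mem_add.2 (Or.inr hβ))) hp hr)

lemma remSum_mul_le {s : Multiset ℝ} (hs : ∀ β ∈ s, 0 < β) {p : ℕ} (hp : Even p) {l r : ℝ}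
    (hl : 0 ≤ l) (hl1 : l ≤ 1) (hr : 0 ≤ r) :
    remSum s p ((l * r : ℝ) : ℂ) ≤ l ^ p * remSum s p (r : ℂ) := by
  rw [remSum, remSum, ← Multiset.sum_map_mul_left]
  refine Multiset.sum_map_le_sum_map _ _ fun β hβ => ?_
  have := hs β hβ
  rw [← ofReal_div, ← ofReal_div, mul_div_assoc]
  exact logRem_mul_le hp hl hl1 (by positivity)

lemma remSum_ray_ge {s : Multiset ℝ} (hs : ∀ β ∈ s, 0 < β) {p : ℕ} (hp : Even p) {e : ℂ}
    (he : ‖e‖ = 1) (hsl : e ∈ slitPlane) {c : ℝ} (hc : 0 ≤ c) (h1 : (e ^ p).re = c)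
    (h2 : (e ^ (p + 1)).re = c) {r : ℝ} (hr : 0 ≤ r) :
    c * remSum s p (r : ℂ) ≤ remSum s p (r * e) := by
  rw [remSum, remSum, ← Multiset.sum_map_mul_left]
  refine Multiset.sum_map_le_sum_map _ _ fun β hβ => ?_
  have := hs β hβ
  rw [mul_div_right_comm, ← ofReal_div]
  exact logRem_ray_ge hp he hsl hc h1 h2 (by positivity)

lemma remSum_div_pow_tendsto {s : Multiset ℝ} (hs : ∀ β ∈ s, 0 < β) (p : ℕ) :
    Tendsto (fun r : ℝ => remSum s (p + 1) (r : ℂ) / r ^ (p + 1)) atTop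
      (𝓝 ((-1) ^ (p + 1) * invPowSum s (p + 1) / (p + 1))) := by
  induction s using Multiset.induction_on with
  | empty => simp [remSum, invPowSum]
  | cons b s ih =>
    have hb := hs b (Multiset.mem_cons_self b s)
    have h1 := ih fun β hβ => hs β (Multiset.mem_cons_of_mem hβ)
    have h2 := ((logRem_ofReal_div_pow_tendsto_succ p).comp
      (tendsto_id.atTop_div_const hb)).mul_const ((b ^ (p + 1))⁻¹)
    have h3 := h2.add h1
    have : (-1) ^ (p + 1) * invPowSum (b ::ₘ s) (p + 1) / (p + 1)
        = (-1 : ℝ) ^ (p + 1) / (p + 1) * (b ^ (p + 1))⁻¹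
          + (-1) ^ (p + 1) * invPowSum s (p + 1) / (p + 1) := by
      simp only [invPowSum, Multiset.map_cons, Multiset.sum_cons]
      ring
    rw [this]
    refine h3.congr' ?_
    filter_upwards [eventually_gt_atTop 0] with r hr
    rw [remSum_cons, ← ofReal_div]
    simp only [Function.comp, id]
    rw [div_pow]
    field_simp

lemma abs_sum_mul_re_pow_le (α : ℕ → ℝ) (n : ℕ) {r : ℝ} (hr : 1 ≤ r) {w : ℂ} (hw : ‖w‖ ≤ r) :
    |∑ k ∈ Finset.range (n + 1), α k * (w ^ k).re|
      ≤ (∑ k ∈ Finset.range (n + 1), |α k|) * r ^ n := by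
  rw [Finset.sum_mul]
  refine (Finset.abs_sum_le_sum_abs _ _).trans (Finset.sum_le_sum fun k hk => ?_)
  rw [abs_mul]
  have h1 : |(w ^ k).re| ≤ r ^ n := by
    refine (abs_re_le_norm _).trans ?_
    rw [norm_pow]
    exact (pow_le_pow_left₀ (norm_nonneg _) hw k).trans
      (pow_le_pow_right₀ hr (Nat.lt_succ_iff.1 (Finset.mem_range.1 hk)))
  gcongr

lemma ofReal_pow_re (r : ℝ) (k : ℕ) : ((r : ℂ) ^ k).re = r ^ k := by
  rw [← ofReal_pow, ofReal_re]

lemma ofReal_mem_slitPlane' {r : ℝ} (hr : 0 < r) : (r : ℂ) ∈ slitPlane :=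
  ofReal_mem_slitPlane.2 hr

lemma exists_ray (p : ℕ) (hp : 2 ≤ p) : ∃ θ : ℝ, 0 < θ ∧ θ < Real.pi / 2 ∧
    exp (2 * θ * I) ∈ slitPlane ∧ ‖exp (2 * θ * I)‖ = 1 ∧
    (exp (2 * θ * I) ^ p).re = Real.cos θ ∧ (exp (2 * θ * I) ^ (p + 1)).re = Real.cos θ := by
  have hpi := Real.pi_pos
  have hp' : (2 : ℝ) ≤ p := by exact_mod_cast hp
  have hne : (2 * p + 1 : ℝ) ≠ 0 := by positivity
  set θ : ℝ := 2 * Real.pi / (2 * p + 1) with hθ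
  have h0 : 0 < θ := by positivity
  have hlt : θ < Real.pi / 2 := by
    rw [hθ, div_lt_div_iff₀ (by positivity) (by norm_num)]
    nlinarith
  have hexp : exp (2 * θ * I) = exp ((2 * θ : ℝ) * I) := by push_cast; ring_nf
  have hre : ∀ n : ℕ, (exp (2 * θ * I) ^ n).re = Real.cos (n * (2 * θ)) := by
    intro n
    rw [hexp, ← exp_nat_mul, ← exp_ofReal_mul_I_re]
    congr 2; push_cast; ring
  refine ⟨θ, h0, hlt, ?_, ?_, ?_, ?_⟩
  · rw [mem_slitPlane_iff]
    right
    rw [hexp, exp_ofReal_mul_I_im]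
    exact (Real.sin_pos_of_pos_of_lt_pi (by linarith) (by linarith)).ne'
  · rw [hexp, norm_exp_ofReal_mul_I]
  · rw [hre, show (p : ℝ) * (2 * θ) = 2 * Real.pi - θ by rw [hθ]; field_simp; ring,
      Real.cos_two_pi_sub]
  · rw [hre, show ((p + 1 : ℕ) : ℝ) * (2 * θ) = θ + 2 * Real.pi by
      rw [hθ]; push_cast; field_simp; ring, Real.cos_add_two_pi]

section Genus

variable {U : ℂ → ℝ} {s : ℕ → Multiset ℝ} {α e : ℕ → ℝ} {q : ℕ}

lemma excess_le_of_ridge (hpos : ∀ N, ∀ β ∈ s N, 0 < β)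
    (hridge : ∀ r θ : ℝ, 0 < r → 0 < θ → θ < Real.pi / 2 →
      U (r * exp (2 * θ * I)) ≤ U ((Real.cos θ ^ 2 * r : ℝ)))
    (hq : Even q) (he : ∀ N, 0 ≤ e N)
    (hrep : ∀ w ∈ slitPlane, Tendsto (fun N => ∑ k ∈ Finset.range (q + 2), α k * (w ^ k).re
      + (α (q + 2) * (w ^ (q + 2)).re + e N * (w ^ (q + 3)).re + remSum (s N) (q + 2) w)) atTop
      (𝓝 (U w))) :
    ∃ C, ∀ r : ℝ, 1 ≤ r →
      U r - ∑ k ∈ Finset.range (q + 2), α k * ((r : ℂ) ^ k).re ≤ C * r ^ (q + 1) := by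
  obtain ⟨θ, h0, hlt, hsl, hn, hc1, hc2⟩ := exists_ray (q + 2) (by omega)
  set u := exp (2 * θ * I) with hu
  set c := Real.cos θ with hc
  have hcpos : 0 < c := Real.cos_pos_of_mem_Ioo ⟨by linarith, hlt⟩
  have hclt : c < 1 := by
    rw [hc, ← Real.cos_zero]
    exact Real.cos_lt_cos_of_nonneg_of_le_pi_div_two le_rfl hlt.le h0
  have hp : Even (q + 2) := hq.add (by decide)
  set S : ℝ := ∑ k ∈ Finset.range (q + 2), |α k|
  have hl0 : 0 < c ^ 2 := by positivity
  have hl1 : c ^ 2 ≤ 1 := by nlinarith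
  have hgap : 0 < c - (c ^ 2) ^ (q + 2) := by
    have : (c ^ 2) ^ (q + 2) < c := by
      rw [← pow_mul]
      calc c ^ (2 * (q + 2)) < c ^ 1 := pow_lt_pow_right_of_lt_one₀ hcpos hclt (by omega)
        _ = c := pow_one c
    linarith
  refine ⟨2 * S / (c - (c ^ 2) ^ (q + 2)), fun r hr => ?_⟩
  have hr0 : 0 < r := by linarith
  set D : ℂ → ℝ := fun w => U w - ∑ k ∈ Finset.range (q + 2), α k * (w ^ k).re with hD
  have hlim : ∀ w ∈ slitPlane, Tendsto (fun N => α (q + 2) * (w ^ (q + 2)).re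
      + e N * (w ^ (q + 3)).re + remSum (s N) (q + 2) w) atTop (𝓝 (D w)) := by
    intro w hw
    have := (hrep w hw).sub_const (∑ k ∈ Finset.range (q + 2), α k * (w ^ k).re)
    refine this.congr fun N => ?_
    ring
  have hru : (r : ℂ) * u ∈ slitPlane := by
    rw [mem_slitPlane_iff] at hsl ⊢
    simp only [re_ofReal_mul, im_ofReal_mul]
    rcases hsl with h | h
    · left; positivity
    · right; positivity
  have hre : ∀ k, (((r : ℂ) * u) ^ k).re = r ^ k * (u ^ k).re := fun k => by
    rw [mul_pow, ← ofReal_pow, re_ofReal_mul]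
  have hA : c * D r ≤ D (r * u) := by
    refine le_of_tendsto_of_tendsto' ((hlim r (ofReal_mem_slitPlane' hr0)).const_mul c)
      (hlim _ hru) fun N => ?_
    rw [hre, hre, hc1, hc2, ofReal_pow_re, ofReal_pow_re]
    have := remSum_ray_ge (hpos N) hp hn hsl hcpos.le hc1 hc2 hr0.le
    linarith
  have hB : D ((c ^ 2 * r : ℝ) : ℂ) ≤ (c ^ 2) ^ (q + 2) * D r := by
    refine le_of_tendsto_of_tendsto' (hlim _ (ofReal_mem_slitPlane' (by positivity)))
      ((hlim r (ofReal_mem_slitPlane' hr0)).const_mul _) fun N => ?_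
    rw [ofReal_pow_re, ofReal_pow_re, ofReal_pow_re, ofReal_pow_re]
    have h1 := remSum_mul_le (hpos N) hp hl0.le hl1 hr0.le
    have h2 : e N * (c ^ 2 * r) ^ (q + 3) ≤ (c ^ 2) ^ (q + 2) * (e N * r ^ (q + 3)) := by
      have : e N * (c ^ 2 * r) ^ (q + 3)
          = c ^ 2 * ((c ^ 2) ^ (q + 2) * (e N * r ^ (q + 3))) := by ring
      rw [this]
      have := he N
      exact mul_le_of_le_one_left (by positivity) hl1
    have h3 : α (q + 2) * (c ^ 2 * r) ^ (q + 2) =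
        (c ^ 2) ^ (q + 2) * (α (q + 2) * r ^ (q + 2)) := by
      ring
    linarith
  have hR := hridge r θ hr0 h0 hlt
  have hQ1 := abs_sum_mul_re_pow_le α (q + 1) hr (w := r * u)
    (by rw [norm_mul, hn, norm_real, Real.norm_of_nonneg hr0.le, mul_one])
  have hQ2 := abs_sum_mul_re_pow_le α (q + 1) hr (w := ((c ^ 2 * r : ℝ) : ℂ))
    (by rw [norm_real, Real.norm_of_nonneg (by positivity)]; nlinarith)
  have e1 : U (r * u) = D (r * u) + ∑ k ∈ Finset.range (q + 2), α k * (((r : ℂ) * u) ^ k).re := by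
    simp [hD]
  have e2 : U ((c ^ 2 * r : ℝ) : ℂ) = D ((c ^ 2 * r : ℝ) : ℂ)
      + ∑ k ∈ Finset.range (q + 2), α k * ((((c ^ 2 * r : ℝ) : ℂ)) ^ k).re := by
    simp [hD]
  rw [e1, e2] at hR
  have hfin : (c - (c ^ 2) ^ (q + 2)) * D r ≤ 2 * S * r ^ (q + 1) := by
    have := (abs_le.1 hQ1).1
    have := (abs_le.1 hQ2).2
    linarith
  show D r ≤ _
  rw [div_mul_eq_mul_div, le_div_iff₀ hgap]
  linarith

lemma tendsto_lower_genus (hs : Monotone s) (hpos : ∀ N, ∀ β ∈ s N, 0 < β)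
    (hU : ∀ r : ℝ, 0 < r → 0 ≤ U r)
    (hridge : ∀ r θ : ℝ, 0 < r → 0 < θ → θ < Real.pi / 2 →
      U (r * exp (2 * θ * I)) ≤ U ((Real.cos θ ^ 2 * r : ℝ)))
    (hq : Even q) (he : ∀ N, 0 ≤ e N)
    (hrep : ∀ w ∈ slitPlane, Tendsto (fun N => ∑ k ∈ Finset.range (q + 2), α k * (w ^ k).re
      + (α (q + 2) * (w ^ (q + 2)).re + e N * (w ^ (q + 3)).re + remSum (s N) (q + 2) w)) atTop
      (𝓝 (U w))) :
    ∀ w ∈ slitPlane, Tendsto (fun N => ∑ k ∈ Finset.range (q + 2), α k * (w ^ k).re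
      + remSum (s N) (q + 1) w) atTop (𝓝 (U w)) := by
  obtain ⟨C₁, hC₁⟩ := excess_le_of_ridge hpos hridge hq he hrep
  have hp : Even (q + 2) := hq.add (by decide)
  have hp1 : Odd (q + 1) := hq.add_one
  set S : ℝ := ∑ k ∈ Finset.range (q + 2), |α k| with hS
  have hS0 : 0 ≤ S := Finset.sum_nonneg fun _ _ => abs_nonneg _
  set D : ℂ → ℝ := fun w => U w - ∑ k ∈ Finset.range (q + 2), α k * (w ^ k).re with hD
  have hlim : ∀ w ∈ slitPlane, Tendsto (fun N => α (q + 2) * (w ^ (q + 2)).re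
      + e N * (w ^ (q + 3)).re + remSum (s N) (q + 2) w) atTop (𝓝 (D w)) := by
    intro w hw
    have := (hrep w hw).sub_const (∑ k ∈ Finset.range (q + 2), α k * (w ^ k).re)
    refine this.congr fun N => ?_
    ring
  have hlimr : ∀ r : ℝ, 1 ≤ r → Tendsto (fun N => α (q + 2) * r ^ (q + 2)
      + e N * r ^ (q + 3) + remSum (s N) (q + 2) r) atTop (𝓝 (D r)) := by
    intro r hr
    simpa only [ofReal_pow_re] using hlim r (ofReal_mem_slitPlane' (by linarith))
  have hlow : ∀ r : ℝ, 1 ≤ r → -(S * r ^ (q + 1)) ≤ D r := by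
    intro r hr
    have h1 := hU r (by linarith)
    have h2 := (abs_le.1 (abs_sum_mul_re_pow_le α (q + 1) hr (w := r)
      (by rw [norm_real, Real.norm_of_nonneg (by linarith)]))).2
    simp only [hD]
    linarith
  -- the coefficient of degree `q + 3` vanishes in the limit
  have he0 : Tendsto e atTop (𝓝 0) := by
    rw [Metric.tendsto_atTop]
    intro ε hε
    set K := |C₁| + |α (q + 2)| + 1 with hK
    obtain ⟨r, hr1, hrK⟩ : ∃ r : ℝ, 1 ≤ r ∧ K < ε * r :=
      ⟨max 1 (K / ε + 1), le_max_left _ _, by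
        calc K < ε * (K / ε + 1) := by field_simp; linarith
          _ ≤ _ := by gcongr; exact le_max_right _ _⟩
    have hr0 : 0 < r := by linarith
    have hev := (hlimr r hr1).eventually (gt_mem_nhds (lt_add_one (D r)))
    obtain ⟨N₀, hN₀⟩ := eventually_atTop.1 hev
    refine ⟨N₀, fun N hN => ?_⟩
    rw [Real.dist_eq, sub_zero, abs_of_nonneg (he N)]
    have h1 := hN₀ N hN
    have h2 := remSum_nonneg (hpos N) hp hr0.le
    have h3 := hC₁ r hr1
    have h4 : C₁ * r ^ (q + 1) ≤ |C₁| * r ^ (q + 2) := by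
      have : r ^ (q + 1) ≤ r ^ (q + 2) := pow_le_pow_right₀ hr1 (by omega)
      have := le_abs_self C₁
      gcongr
    have h5 : -α (q + 2) * r ^ (q + 2) ≤ |α (q + 2)| * r ^ (q + 2) := by
      have := neg_le_abs (α (q + 2))
      gcongr
    have h6 : 1 ≤ r ^ (q + 2) := one_le_pow₀ hr1
    have h7 : e N * r ^ (q + 3) < ε * r ^ (q + 3) := by
      have : K * r ^ (q + 2) < ε * r * r ^ (q + 2) := by gcongr
      have e3 : ε * r ^ (q + 3) = ε * r * r ^ (q + 2) := by ring
      simp only [hD] at h1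
      rw [e3]
      simp only [hK] at this
      linarith
    exact lt_of_mul_lt_mul_right h7 (by positivity)
  set c : ℕ → ℝ := fun N => α (q + 2) + invPowSum (s N) (q + 2) / (q + 2) with hc
  have hsucc : ∀ N w, α (q + 2) * (w ^ (q + 2)).re + e N * (w ^ (q + 3)).re
      + remSum (s N) (q + 2) w
      = c N * (w ^ (q + 2)).re + e N * (w ^ (q + 3)).re + remSum (s N) (q + 1) w := by
    intro N w
    rw [remSum_succ, show q + 1 + 1 = q + 2 from rfl, hp.neg_one_pow]
    simp only [hc]
    push_cast
    ring
  have hc_nonpos : ∀ N, c N ≤ 0 := by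
    intro N₀
    have h1 : Tendsto (fun r : ℝ => α (q + 2) + remSum (s N₀) (q + 2) r / r ^ (q + 2)) atTop
        (𝓝 (c N₀)) := by
      have := (remSum_div_pow_tendsto (hpos N₀) (q + 1)).const_add (α (q + 2))
      rw [show q + 1 + 1 = q + 2 from rfl, hp.neg_one_pow] at this
      convert this using 2
      simp only [hc]; push_cast; ring
    have h2 : Tendsto (fun r : ℝ => C₁ * r⁻¹) atTop (𝓝 0) := by
      simpa using tendsto_inv_atTop_zero.const_mul C₁
    refine le_of_tendsto_of_tendsto h1 h2 ?_
    filter_upwards [eventually_ge_atTop 1] with r hr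
    have hr0 : 0 < r := by linarith
    have h3 : α (q + 2) * r ^ (q + 2) + remSum (s N₀) (q + 2) r ≤ D r := by
      refine ge_of_tendsto (hlimr r hr) ?_
      filter_upwards [eventually_ge_atTop N₀] with N hN
      have := remSum_le_of_le (hs hN) (hpos N) hp hr0.le
      have : 0 ≤ e N * r ^ (q + 3) := mul_nonneg (he N) (by positivity)
      linarith
    have h4 := h3.trans (hC₁ r hr)
    have : C₁ * r⁻¹ = C₁ * r ^ (q + 1) / r ^ (q + 2) := by
      rw [pow_succ r (q + 1)]; field_simp
    rw [this, le_div_iff₀ (by positivity), add_mul, div_mul_cancel₀ _ (by positivity)]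
    exact h4
  have hc0 : Tendsto c atTop (𝓝 0) := by
    rw [Metric.tendsto_atTop]
    intro ε hε
    obtain ⟨r, hr1, hrK⟩ : ∃ r : ℝ, 1 ≤ r ∧ S + 1 < ε * r :=
      ⟨max 1 ((S + 1) / ε + 1), le_max_left _ _, by
        calc S + 1 < ε * ((S + 1) / ε + 1) := by field_simp; linarith
          _ ≤ _ := by gcongr; exact le_max_right _ _⟩
    have hr0 : 0 < r := by linarith
    have hev : ∀ᶠ N in atTop, D r - 1 / 2 < α (q + 2) * r ^ (q + 2)
      + e N * r ^ (q + 3) + remSum (s N) (q + 2) r :=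
      (hlimr r hr1).eventually (lt_mem_nhds (by linarith))
    have hev2 : ∀ᶠ N in atTop, e N * r ^ (q + 3) < 1 / 2 := by
      have : Tendsto (fun N => e N * r ^ (q + 3)) atTop (𝓝 0) := by
        simpa using he0.mul_const (r ^ (q + 3))
      exact this.eventually (gt_mem_nhds (by norm_num))
    obtain ⟨N₀, hN₀⟩ := eventually_atTop.1 (hev.and hev2)
    refine ⟨N₀, fun N hN => ?_⟩
    rw [Real.dist_eq, sub_zero, abs_of_nonpos (hc_nonpos N)]
    obtain ⟨h1, h2⟩ := hN₀ N hN
    have h3 := hsucc N r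
    simp only [ofReal_pow_re] at h3
    rw [h3] at h1
    have h4 := remSum_nonpos (hpos N) hp1 hr0.le
    have h5 := hlow r hr1
    have h6 : 1 ≤ r ^ (q + 1) := one_le_pow₀ hr1
    have h7 : -c N * r ^ (q + 2) < ε * r ^ (q + 2) := by
      have : (S + 1) * r ^ (q + 1) < ε * r * r ^ (q + 1) := by gcongr
      have e3 : ε * r ^ (q + 2) = ε * r * r ^ (q + 1) := by ring
      rw [e3]
      linarith
    exact lt_of_mul_lt_mul_right h7 (by positivity)
  intro w hw
  have h1 := ((hrep w hw).sub (hc0.mul_const (w ^ (q + 2)).re)).sub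
    (he0.mul_const (w ^ (q + 3)).re)
  simp only [zero_mul, sub_zero] at h1
  refine h1.congr fun N => ?_
  rw [hsucc]
  ring

lemma exists_excess_lower_genus (hs : Monotone s) (hpos : ∀ N, ∀ β ∈ s N, 0 < β)
    (hU : ∀ r : ℝ, 0 < r → 0 ≤ U r) (hq : Even q)
    (hrep : ∀ w ∈ slitPlane, Tendsto (fun N => ∑ k ∈ Finset.range (q + 2), α k * (w ^ k).re
      + remSum (s N) (q + 1) w) atTop (𝓝 (U w))) :
    ∃ e : ℕ → ℝ, (∀ N, 0 ≤ e N) ∧ ∀ w ∈ slitPlane,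
      Tendsto (fun N => ∑ k ∈ Finset.range q, α k * (w ^ k).re
        + (α q * (w ^ q).re + e N * (w ^ (q + 1)).re + remSum (s N) q w)) atTop (𝓝 (U w)) := by
  have hp1 : Odd (q + 1) := hq.add_one
  refine ⟨fun N => α (q + 1) - invPowSum (s N) (q + 1) / (q + 1), fun N₀ => ?_, fun w hw => ?_⟩
  · have h1 : Tendsto (fun r : ℝ => (∑ k ∈ Finset.range (q + 1), |α k|) * r⁻¹ + α (q + 1)
        + remSum (s N₀) (q + 1) r / r ^ (q + 1)) atTop
        (𝓝 (α (q + 1) - invPowSum (s N₀) (q + 1) / (q + 1))) := by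
      have := ((tendsto_inv_atTop_zero.const_mul (∑ k ∈ Finset.range (q + 1), |α k|)).add_const
        (α (q + 1))).add (remSum_div_pow_tendsto (hpos N₀) q)
      rw [hp1.neg_one_pow] at this
      convert this using 2
      ring
    refine ge_of_tendsto h1 ?_
    filter_upwards [eventually_ge_atTop 1] with r hr
    have hr0 : 0 < r := by linarith
    have h3 : 0 ≤ ∑ k ∈ Finset.range (q + 2), α k * ((r : ℂ) ^ k).re
        + remSum (s N₀) (q + 1) r := by
      refine (hU r hr0).trans (le_of_tendsto (hrep r (ofReal_mem_slitPlane' hr0)) ?_)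
      filter_upwards [eventually_ge_atTop N₀] with N hN
      have := remSum_ge_of_le (hs hN) (hpos N) hp1 hr0.le
      linarith
    have h4 := (abs_le.1 (abs_sum_mul_re_pow_le α q hr (w := r)
      (by rw [norm_real, Real.norm_of_nonneg hr0.le]))).2
    rw [Finset.sum_range_succ, ofReal_pow_re] at h3
    have h5 : (∑ k ∈ Finset.range (q + 1), |α k|) * r⁻¹ + α (q + 1)
        + remSum (s N₀) (q + 1) r / r ^ (q + 1)
        = ((∑ k ∈ Finset.range (q + 1), |α k|) * r ^ q + α (q + 1) * r ^ (q + 1)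
          + remSum (s N₀) (q + 1) r) / r ^ (q + 1) := by
      rw [pow_succ r q]; field_simp
    rw [h5]
    exact div_nonneg (by linarith) (by positivity)
  · refine (hrep w hw).congr fun N => ?_
    rw [remSum_succ, Finset.sum_range_succ, Finset.sum_range_succ, hp1.neg_one_pow]
    ring

lemma linear_bound_of_ridge (hs : Monotone s) (hpos : ∀ N, ∀ β ∈ s N, 0 < β)
    (hU : ∀ r : ℝ, 0 < r → 0 ≤ U r)
    (hridge : ∀ r θ : ℝ, 0 < r → 0 < θ → θ < Real.pi / 2 →
      U (r * exp (2 * θ * I)) ≤ U ((Real.cos θ ^ 2 * r : ℝ)))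
    (hq : Even q) (he : ∀ N, 0 ≤ e N)
    (hrep : ∀ w ∈ slitPlane, Tendsto (fun N => ∑ k ∈ Finset.range (q + 2), α k * (w ^ k).re
      + (α (q + 2) * (w ^ (q + 2)).re + e N * (w ^ (q + 3)).re + remSum (s N) (q + 2) w)) atTop
      (𝓝 (U w))) :
    ∀ r : ℝ, 0 < r → U r ≤ α 0 + α 1 * r := by
  obtain ⟨m, rfl⟩ := hq
  induction m generalizing e with
  | zero =>
    intro r hr
    have := tendsto_lower_genus hs hpos hU hridge (by simp) he hrep r (ofReal_mem_slitPlane' hr)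
    refine le_of_tendsto' this fun N => ?_
    have := remSum_nonpos (hpos N) (p := 1) (by decide) hr.le
    simp [Finset.sum_range_succ]
    linarith
  | succ m ih =>
    have h1 := tendsto_lower_genus hs hpos hU hridge ⟨m + 1, rfl⟩ he hrep
    obtain ⟨e', he', h2⟩ := exists_excess_lower_genus hs hpos hU ⟨m + 1, rfl⟩ h1
    refine ih he' ?_
    have h3 : m + 1 + (m + 1) = m + m + 2 := by ring
    rw [h3] at h2
    exact h2

end Genus

lemma exists_log_of_ne_zero_on_ball {k : ℂ → ℂ} {R : ℝ} (hR : 0 < R)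
    (hk : DifferentiableOn ℂ k (Metric.ball 0 R)) (h0 : k 0 = 1)
    (hne : ∀ z ∈ Metric.ball (0 : ℂ) R, k z ≠ 0) :
    ∃ g : ℂ → ℂ, DifferentiableOn ℂ g (Metric.ball 0 R) ∧ g 0 = 0 ∧
      ∀ z ∈ Metric.ball (0 : ℂ) R, exp (g z) = k z := by
  have hmem : (0 : ℂ) ∈ Metric.ball (0 : ℂ) R := Metric.mem_ball_self hR
  have hd : DifferentiableOn ℂ (fun z => deriv k z / k z) (Metric.ball 0 R) :=
    (hk.deriv Metric.isOpen_ball).div hk hne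
  obtain ⟨g, hg0, hg⟩ := hd.isExactOn_ball.with_val_at 0 0
  have hgd : DifferentiableOn ℂ g (Metric.ball 0 R) := fun z hz =>
    (hg z hz).differentiableAt.differentiableWithinAt
  refine ⟨g, hgd, hg0, fun z hz => ?_⟩
  have hder : ∀ x ∈ Metric.ball (0 : ℂ) R,
      HasDerivAt (fun z => k z * exp (-g z)) 0 x := by
    intro x hx
    have hkx := (hk.differentiableAt (Metric.isOpen_ball.mem_nhds hx)).hasDerivAt
    refine (hkx.mul (hg x hx).neg.cexp).congr_deriv ?_
    have := hne x hx
    field_simp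
    ring
  have := Metric.isOpen_ball.is_const_of_deriv_eq_zero
    (convex_ball (0 : ℂ) R).isPreconnected
    (fun x hx => (hder x hx).differentiableAt.differentiableWithinAt)
    (fun x hx => (hder x hx).deriv) hz hmem
  simp only [hg0, h0, neg_zero, exp_zero, mul_one] at this
  rw [exp_neg] at this
  field_simp at this
  exact this.symm

lemma norm_sub_polynomial_le {g : ℂ → ℂ} {R K : ℝ} (hR : 0 < R)
    (hg : DifferentiableOn ℂ g (Metric.ball 0 R)) (hK : ∀ z ∈ Metric.ball (0 : ℂ) R, ‖g z‖ ≤ K)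
    {n : ℕ} {c : ℕ → ℂ}
    (hO : (fun z => g z - ∑ j ∈ Finset.range n, c j * z ^ j) =O[𝓝[≠] 0] fun z => z ^ n)
    {z : ℂ} (hz : z ∈ Metric.ball (0 : ℂ) R) :
    ‖g z - ∑ j ∈ Finset.range n, c j * z ^ j‖ ≤ (2 / R) ^ n * K * ‖z‖ ^ n := by
  have hmem : (0 : ℂ) ∈ Metric.ball (0 : ℂ) R := Metric.mem_ball_self hR
  induction n generalizing g K c with
  | zero => simpa using hK z hz
  | succ n ih =>
    have hcont : Tendsto (fun z => g z - ∑ j ∈ Finset.range (n + 1), c j * z ^ j) (𝓝[≠] 0)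
        (𝓝 (g 0 - ∑ j ∈ Finset.range (n + 1), c j * (0 : ℂ) ^ j)) := by
      have h1 : ContinuousAt g 0 :=
        (hg.differentiableAt (Metric.isOpen_ball.mem_nhds hmem)).continuousAt
      have h2 : ContinuousAt (fun z : ℂ => ∑ j ∈ Finset.range (n + 1), c j * z ^ j) 0 := by
        fun_prop
      exact (h1.sub h2).tendsto.mono_left nhdsWithin_le_nhds
    have hzero : Tendsto (fun z => g z - ∑ j ∈ Finset.range (n + 1), c j * z ^ j) (𝓝[≠] 0)
        (𝓝 0) := by
      refine hO.trans_tendsto (tendsto_nhdsWithin_of_tendsto_nhds ?_)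
      have : ContinuousAt (fun z : ℂ => z ^ (n + 1)) 0 := by fun_prop
      simpa using this.tendsto
    have hc0 : g 0 = c 0 := by
      have := tendsto_nhds_unique hcont hzero
      rw [Finset.sum_range_succ'] at this
      simpa [sub_eq_zero] using this
    have hmul : ∀ z, g z - ∑ j ∈ Finset.range (n + 1), c j * z ^ j
        = z * (dslope g 0 z - ∑ j ∈ Finset.range n, c (j + 1) * z ^ j) := by
      intro z
      have h1 := sub_smul_dslope g 0 z
      rw [sub_zero, smul_eq_mul] at h1
      rw [Finset.sum_range_succ', mul_sub, h1, Finset.mul_sum, hc0, pow_zero, mul_one]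
      have : ∑ j ∈ Finset.range n, c (j + 1) * z ^ (j + 1)
          = ∑ j ∈ Finset.range n, z * (c (j + 1) * z ^ j) :=
        Finset.sum_congr rfl fun j _ => by ring
      rw [this]
      ring
    have hO' : (fun z => dslope g 0 z - ∑ j ∈ Finset.range n, c (j + 1) * z ^ j)
        =O[𝓝[≠] 0] fun z => z ^ n := by
      simp_rw [hmul] at hO
      obtain ⟨C, hC⟩ := hO.bound
      refine Asymptotics.IsBigO.of_bound C ?_
      filter_upwards [hC, self_mem_nhdsWithin] with z hz hz0
      have hz0 : 0 < ‖z‖ := norm_pos_iff.2 hz0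
      rw [norm_mul, pow_succ, norm_mul] at hz
      refine le_of_mul_le_mul_left ?_ hz0
      linarith
    have hd : DifferentiableOn ℂ (dslope g 0) (Metric.ball 0 R) :=
      (differentiableOn_dslope (Metric.isOpen_ball.mem_nhds hmem)).2 hg
    have hmaps : Set.MapsTo g (Metric.ball 0 R) (Metric.closedBall (g 0) (2 * K)) := by
      intro x hx
      rw [mem_closedBall_iff_norm]
      linarith [norm_sub_le (g x) (g 0), hK x hx, hK 0 hmem]
    have h3 := ih hd (fun x hx => norm_dslope_le_div_of_mapsTo_ball hg hmaps hx) hO'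
    rw [hmul, norm_mul]
    calc ‖z‖ * _ ≤ ‖z‖ * ((2 / R) ^ n * (2 * K / R) * ‖z‖ ^ n) := by gcongr
      _ = _ := by ring

lemma exists_polynomial_isBigO {L : ℂ → ℂ} (hL : AnalyticAt ℂ L 0) (n : ℕ) :
    ∃ c : ℕ → ℂ, (fun z => L z - ∑ j ∈ Finset.range n, c j * z ^ j) =O[𝓝 0] fun z => z ^ n := by
  obtain ⟨p, hp⟩ := hL
  refine ⟨p.coeff, ?_⟩
  have h := hp.isBigO_sub_partialSum_pow n
  simp only [zero_add] at h
  have e : ∀ y : ℂ, p.partialSum n y = ∑ j ∈ Finset.range n, p.coeff j * y ^ j := fun y => by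
    simp only [FormalMultilinearSeries.partialSum, FormalMultilinearSeries.apply_eq_pow_smul_coeff,
      smul_eq_mul, mul_comm]
  simp_rw [e] at h
  refine h.trans ?_
  exact Asymptotics.IsBigO.of_norm_right (by simpa using Asymptotics.isBigO_refl _ _)

/-- Entire functions, normalised at the origin and real on the real axis, all of whose zeros are
purely imaginary. -/
structure HasImagZeros (f : ℂ → ℂ) : Prop where
  differentiable : Differentiable ℂ f
  apply_zero : f 0 = 1
  apply_conj : ∀ z, f (conj z) = conj (f z)
  ne_zero : ∀ z : ℂ, z.re ≠ 0 → f z ≠ 0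

/-- The even polynomial with value `1` at `0` and zeros `± i √β`, for `β` in the multiset. -/
noncomputable def zeroProd (s : Multiset ℝ) (z : ℂ) : ℂ :=
  (s.map fun β : ℝ => 1 + z ^ 2 / (β : ℂ)).prod

lemma zeroProd_cons (β : ℝ) (s : Multiset ℝ) (z : ℂ) :
    zeroProd (β ::ₘ s) z = (1 + z ^ 2 / (β : ℂ)) * zeroProd s z := by simp [zeroProd]

lemma zeroProd_add (s t : Multiset ℝ) (z : ℂ) :
    zeroProd (s + t) z = zeroProd s z * zeroProd t z := by simp [zeroProd]

lemma HasImagZeros.exists_eq_mul {f : ℂ → ℂ} (hf : HasImagZeros f) {z₀ : ℂ} (h₀ : f z₀ = 0) :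
    0 < ‖z₀‖ ∧ ∃ k, HasImagZeros k ∧ ∀ z, f z = (1 + z ^ 2 / ((‖z₀‖ ^ 2 : ℝ) : ℂ)) * k z := by
  have hne : z₀ ≠ 0 := by
    rintro rfl
    exact one_ne_zero (hf.apply_zero.symm.trans h₀)
  have hpos : 0 < ‖z₀‖ := norm_pos_iff.2 hne
  have hre : z₀.re = 0 := by
    by_contra h
    exact hf.ne_zero _ h h₀
  have hconj : conj z₀ = -z₀ := by
    apply Complex.ext <;> simp [hre]
  have hsq : ((‖z₀‖ ^ 2 : ℝ) : ℂ) = -z₀ ^ 2 := by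
    rw [← normSq_eq_norm_sq, ← mul_conj, hconj]; ring
  have h₁ : f (-z₀) = 0 := by rw [← hconj, hf.apply_conj, h₀, map_zero]
  have hf1 : Differentiable ℂ (dslope f z₀) := by
    rw [← differentiableOn_univ, differentiableOn_dslope Filter.univ_mem, differentiableOn_univ]
    exact hf.differentiable
  have hf2 : Differentiable ℂ (dslope (dslope f z₀) (-z₀)) := by
    rw [← differentiableOn_univ, differentiableOn_dslope Filter.univ_mem, differentiableOn_univ]
    exact hf1
  have e1 : ∀ z, (z - z₀) * dslope f z₀ z = f z := fun z => by
    simpa using sub_smul_dslope_of_zero h₀ z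
  have h₂ : dslope f z₀ (-z₀) = 0 := by
    have := e1 (-z₀)
    rw [h₁, mul_eq_zero] at this
    refine this.resolve_left fun h => hne ?_
    linear_combination (-1 / 2 : ℂ) * h
  have e2 : ∀ z, (z + z₀) * dslope (dslope f z₀) (-z₀) z = dslope f z₀ z := fun z => by
    simpa using sub_smul_dslope_of_zero h₂ z
  set k : ℂ → ℂ := fun z => -z₀ ^ 2 * dslope (dslope f z₀) (-z₀) z with hk
  have hkd : Differentiable ℂ k := hf2.const_mul _
  have hfk : ∀ z, f z = (1 + z ^ 2 / ((‖z₀‖ ^ 2 : ℝ) : ℂ)) * k z := by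
    intro z
    rw [← e1 z, ← e2 z, hsq]
    simp only [hk]
    field_simp
    ring
  refine ⟨hpos, k, ⟨hkd, ?_, ?_, fun z hz h => hf.ne_zero z hz (by rw [hfk, h, mul_zero])⟩, hfk⟩
  · have := hfk 0
    rw [hf.apply_zero] at this
    simpa using this.symm
  · have hdense : Dense ({z₀, -z₀}ᶜ : Set ℂ) := (Set.toFinite _).countable.dense_compl ℝ
    refine congr_fun (Continuous.ext_on hdense
      (hkd.continuous.comp continuous_conj) (continuous_conj.comp hkd.continuous) fun z hz => ?_)
    have hz' : 1 + z ^ 2 / ((‖z₀‖ ^ 2 : ℝ) : ℂ) ≠ 0 := by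
      intro h
      rw [hsq] at h
      have : (z - z₀) * (z + z₀) = 0 := by
        field_simp at h
        linear_combination -h
      simp only [Set.mem_compl_iff, Set.mem_insert_iff, Set.mem_singleton_iff, not_or] at hz
      rcases mul_eq_zero.1 this with h | h
      · exact hz.1 (sub_eq_zero.1 h)
      · exact hz.2 (eq_neg_of_add_eq_zero_left h)
    have h3 := hf.apply_conj z
    rw [hfk, hfk z, map_mul] at h3
    have h4 : conj (1 + z ^ 2 / ((‖z₀‖ ^ 2 : ℝ) : ℂ)) = 1 + conj z ^ 2 / ((‖z₀‖ ^ 2 : ℝ) : ℂ) := by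
      rw [map_add, map_div₀, map_pow, map_one, conj_ofReal]
    rw [h4] at h3
    refine mul_left_cancel₀ ?_ h3
    rw [← h4]
    exact (map_ne_zero _).2 hz'

lemma pow_card_le_norm_zeroProd {s : Multiset ℝ} {ρ c : ℝ} (hs : ∀ β ∈ s, 0 < β ∧ β ≤ ρ)
    (hc : 0 ≤ c) {z : ℂ} (hz : (c + 1) * ρ ≤ ‖z‖ ^ 2) : c ^ s.card ≤ ‖zeroProd s z‖ := by
  induction s using Multiset.induction_on with
  | empty => simp [zeroProd]
  | cons β s ih =>
    obtain ⟨h0, hρ⟩ := hs β (Multiset.mem_cons_self β s)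
    have h1 := ih fun β hβ => hs β (Multiset.mem_cons_of_mem hβ)
    rw [zeroProd_cons, norm_mul, Multiset.card_cons, pow_succ']
    have h2 : c ≤ ‖1 + z ^ 2 / (β : ℂ)‖ := by
      have h3 : c + 1 ≤ ‖z ^ 2 / (β : ℂ)‖ := by
        rw [norm_div, norm_pow, norm_real, Real.norm_of_nonneg h0.le, le_div_iff₀ h0]
        exact (by gcongr : (c + 1) * β ≤ (c + 1) * ρ).trans hz
      have h4 := norm_sub_le (1 + z ^ 2 / (β : ℂ)) 1
      rw [add_sub_cancel_left, norm_one] at h4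
      linarith
    gcongr

lemma norm_le_of_eq_zeroProd_mul {f k : ℂ → ℂ} (hk : Differentiable ℂ k) {s : Multiset ℝ}
    {ρ c r M : ℝ} (hs : ∀ β ∈ s, 0 < β ∧ β ≤ ρ) (hc : 0 < c) (hr : 0 < r)
    (hρ : (c + 1) * ρ ≤ r ^ 2) (hfk : ∀ z, f z = zeroProd s z * k z)
    (hM : ∀ z, ‖z‖ = r → ‖f z‖ ≤ M) {z : ℂ} (hz : ‖z‖ ≤ r) : ‖k z‖ ≤ M / c ^ s.card := by
  refine norm_le_of_forall_mem_frontier_norm_le (U := Metric.ball 0 r) Metric.isBounded_ball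
    hk.diffContOnCl (fun w hw => ?_) ?_
  · rw [frontier_ball _ hr.ne', mem_sphere_zero_iff_norm] at hw
    have h1 := hM w hw
    have h2 := pow_card_le_norm_zeroProd hs hc.le (z := w) (by rw [hw]; exact hρ)
    rw [hfk, norm_mul] at h1
    rw [le_div_iff₀ (by positivity), mul_comm]
    exact (by gcongr : _ ≤ _).trans h1
  · rw [closure_ball _ hr.ne']
    simpa using hz

lemma HasImagZeros.exists_zeroProd_or_card {f : ℂ → ℂ} (hf : HasImagZeros f) (R : ℝ) (n : ℕ) :
    ∃ (s : Multiset ℝ) (k : ℂ → ℂ), HasImagZeros k ∧ (∀ β ∈ s, 0 < β ∧ β ≤ R ^ 2) ∧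
      (∀ z, f z = zeroProd s z * k z) ∧ ((∀ z : ℂ, ‖z‖ ≤ R → k z ≠ 0) ∨ s.card = n) := by
  induction n with
  | zero => exact ⟨0, f, hf, by simp, by simp [zeroProd], Or.inr rfl⟩
  | succ n ih =>
    obtain ⟨s, k, hk, hs, hfk, h⟩ := ih
    by_cases h0 : ∀ z : ℂ, ‖z‖ ≤ R → k z ≠ 0
    · exact ⟨s, k, hk, hs, hfk, Or.inl h0⟩
    · push Not at h0
      obtain ⟨z₀, hz₀, hkz⟩ := h0
      have hcard := h.resolve_left fun h => h z₀ hz₀ hkz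
      obtain ⟨hpos, k', hk', hkk'⟩ := hk.exists_eq_mul hkz
      refine ⟨‖z₀‖ ^ 2 ::ₘ s, k', hk', ?_, fun z => ?_, Or.inr (by simp [hcard])⟩
      · intro β hβ
        rcases Multiset.mem_cons.1 hβ with rfl | hβ
        · exact ⟨by positivity, by gcongr⟩
        · exact hs β hβ
      · rw [hfk, hkk', zeroProd_cons]; ring

lemma HasImagZeros.exists_zeroProd {f : ℂ → ℂ} (hf : HasImagZeros f) {R : ℝ} (hR : 0 < R) :
    ∃ (s : Multiset ℝ) (k : ℂ → ℂ), HasImagZeros k ∧ (∀ β ∈ s, 0 < β ∧ β ≤ R ^ 2) ∧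
      (∀ z, f z = zeroProd s z * k z) ∧ ∀ z : ℂ, ‖z‖ ≤ R → k z ≠ 0 := by
  obtain ⟨M, hM⟩ := (isCompact_sphere (0 : ℂ) (3 * R)).exists_bound_of_continuousOn
    hf.differentiable.continuous.continuousOn
  obtain ⟨n, hn⟩ := pow_unbounded_of_one_lt M (by norm_num : (1 : ℝ) < 8)
  obtain ⟨s, k, hk, hs, hfk, h⟩ := hf.exists_zeroProd_or_card R n
  refine ⟨s, k, hk, hs, hfk, h.resolve_right fun hcard => ?_⟩
  have := norm_le_of_eq_zeroProd_mul hk.differentiable hs (c := 8) (r := 3 * R) (by norm_num)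
    (by positivity) (by nlinarith) hfk (fun z hz => hM z (by simpa using hz)) (z := 0)
    (by simpa using hR.le)
  rw [hk.apply_zero, norm_one, hcard, le_div_iff₀ (by positivity)] at this
  linarith

lemma HasImagZeros.exists_exhaustion {f : ℂ → ℂ} (hf : HasImagZeros f) :
    ∃ (s : ℕ → Multiset ℝ) (k : ℕ → ℂ → ℂ), Monotone s ∧ (∀ N, ∀ β ∈ s N, 0 < β) ∧
      (∀ N, HasImagZeros (k N)) ∧ (∀ N z, f z = zeroProd (s N) z * k N z) ∧
      (∀ (N : ℕ) (z : ℂ), ‖z‖ ≤ N → k N z ≠ 0) ∧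
      ∀ (N : ℕ) (M : ℝ), 1 ≤ N → (∀ z : ℂ, ‖z‖ = 2 * N → ‖f z‖ ≤ M) →
        ∀ z : ℂ, ‖z‖ ≤ 2 * N → ‖k N z‖ ≤ M := by
  let P : ℕ → Multiset ℝ × (ℂ → ℂ) → Prop := fun N p => HasImagZeros p.2 ∧
    (∀ β ∈ p.1, 0 < β ∧ β ≤ (N : ℝ) ^ 2) ∧ (∀ z, f z = zeroProd p.1 z * p.2 z) ∧
    ∀ z : ℂ, ‖z‖ ≤ N → p.2 z ≠ 0
  have h0 : P 0 (0, f) := by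
    refine ⟨hf, by simp, by simp [zeroProd], fun z hz => ?_⟩
    have : z = 0 := by simpa using hz
    simp [this, hf.apply_zero]
  have hstep : ∀ N p, P N p → ∃ p', P (N + 1) p' ∧ p.1 ≤ p'.1 := by
    rintro N ⟨s, k⟩ ⟨hk, hs, hfk, -⟩
    obtain ⟨t, k', hk', ht, hkk', hne⟩ := hk.exists_zeroProd (R := ((N + 1 : ℕ) : ℝ))
      (by positivity)
    refine ⟨(s + t, k'), ⟨hk', fun β hβ => ?_, fun z => ?_, hne⟩, Multiset.le_add_right s t⟩
    · rcases Multiset.mem_add.1 hβ with h | h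
      · refine ⟨(hs β h).1, (hs β h).2.trans ?_⟩
        push_cast
        gcongr
        linarith
      · exact ht β h
    · rw [hfk, zeroProd_add, mul_assoc]
      congr 1
      exact hkk' z
  choose! F hF using hstep
  let G : ℕ → Multiset ℝ × (ℂ → ℂ) := fun N => Nat.rec (0, f) (fun N p => F N p) N
  have hG : ∀ N, P N (G N) := fun N => by
    induction N with
    | zero => exact h0
    | succ N ih => exact (hF N (G N) ih).1
  refine ⟨fun N => (G N).1, fun N => (G N).2,
    monotone_nat_of_le_succ fun N => (hF N (G N) (hG N)).2,
    fun N β hβ => ((hG N).2.1 β hβ).1, fun N => (hG N).1, fun N => (hG N).2.2.1,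
    fun N => (hG N).2.2.2, fun N M hN hM z hz => ?_⟩
  have hN' : (1 : ℝ) ≤ N := by exact_mod_cast hN
  simpa using norm_le_of_eq_zeroProd_mul (hG N).1.differentiable (hG N).2.1 one_pos
    (by positivity : (0 : ℝ) < 2 * N) (by nlinarith) (hG N).2.2.1 hM hz

/-- Sum of the Taylor polynomials, in the variable `z ^ 2`, of the logarithms of the factors of
`zeroProd`. -/
noncomputable def logTaylorSum (s : Multiset ℝ) (p : ℕ) (z : ℂ) : ℂ :=
  (s.map fun β : ℝ => logTaylor (p + 1) (z ^ 2 / (β : ℂ))).sum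

lemma logTaylorSum_cons (β : ℝ) (s : Multiset ℝ) (p : ℕ) (z : ℂ) :
    logTaylorSum (β ::ₘ s) p z = logTaylor (p + 1) (z ^ 2 / (β : ℂ)) + logTaylorSum s p z := by
  simp [logTaylorSum]

lemma exists_coeff_logTaylor (β : ℝ) {p n : ℕ} (h : 2 * p ≤ n) : ∃ d : ℕ → ℂ, ∀ z : ℂ,
    logTaylor p (z ^ 2 / (β : ℂ)) = ∑ j ∈ Finset.range n, d j * z ^ j := by
  induction p with
  | zero => exact ⟨0, by simp [logTaylor_zero]⟩
  | succ p ih =>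
    obtain ⟨d, hd⟩ := ih (by omega)
    refine ⟨d + Pi.single (2 * p) ((-1) ^ (p + 1) / p / (β : ℂ) ^ p), fun z => ?_⟩
    have : ∑ j ∈ Finset.range n,
        (Pi.single (2 * p) ((-1) ^ (p + 1) / p / (β : ℂ) ^ p) : ℕ → ℂ) j * z ^ j
        = (-1) ^ (p + 1) / p / (β : ℂ) ^ p * z ^ (2 * p) := by
      rw [Finset.sum_eq_single_of_mem (2 * p) (Finset.mem_range.2 (by omega))
        (fun j _ hj => by simp [hj])]
      simp
    simp only [Pi.add_apply, add_mul, Finset.sum_add_distrib]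
    rw [this, ← hd, logTaylor_succ]
    simp only [Pi.add_apply]
    rw [div_pow, ← pow_mul]
    ring

lemma exists_coeff_logTaylorSum (s : Multiset ℝ) (p : ℕ) : ∃ d : ℕ → ℂ, ∀ z : ℂ,
    logTaylorSum s p z = ∑ j ∈ Finset.range (2 * p + 2), d j * z ^ j := by
  induction s using Multiset.induction_on with
  | empty => exact ⟨0, by simp [logTaylorSum]⟩
  | cons β s ih =>
    obtain ⟨d, hd⟩ := ih
    obtain ⟨d', hd'⟩ := exists_coeff_logTaylor β (p := p + 1) (n := 2 * p + 2) (by omega)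
    refine ⟨d' + d, fun z => ?_⟩
    rw [logTaylorSum_cons, hd, hd']
    simp only [Pi.add_apply, add_mul, Finset.sum_add_distrib]

lemma log_norm_zeroProd {s : Multiset ℝ} (p : ℕ) {z : ℂ} (hz : zeroProd s z ≠ 0) :
    Real.log ‖zeroProd s z‖ = remSum s p (z ^ 2) + (logTaylorSum s p z).re := by
  induction s using Multiset.induction_on with
  | empty => simp [zeroProd, remSum, logTaylorSum]
  | cons β s ih =>
    rw [zeroProd_cons] at hz ⊢
    rw [norm_mul, Real.log_mul (norm_ne_zero_iff.2 (left_ne_zero_of_mul hz))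
      (norm_ne_zero_iff.2 (right_ne_zero_of_mul hz)), ih (right_ne_zero_of_mul hz),
      remSum_cons, logTaylorSum_cons, add_re, logRem]
    ring

/-- A logarithm of `zeroProd s` near the origin. -/
noncomputable def logZeroProd (s : Multiset ℝ) (z : ℂ) : ℂ :=
  (s.map fun β : ℝ => log (1 + z ^ 2 / (β : ℂ))).sum

lemma logZeroProd_cons (β : ℝ) (s : Multiset ℝ) (z : ℂ) :
    logZeroProd (β ::ₘ s) z = log (1 + z ^ 2 / (β : ℂ)) + logZeroProd s z := by
  simp [logZeroProd]

lemma tendsto_sq_div_zero (β : ℝ) : Tendsto (fun z : ℂ => z ^ 2 / (β : ℂ)) (𝓝 0) (𝓝 0) := by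
  have : Continuous fun z : ℂ => z ^ 2 / (β : ℂ) := by fun_prop
  simpa using this.tendsto 0

lemma continuousAt_logZeroProd (s : Multiset ℝ) : ContinuousAt (logZeroProd s) 0 := by
  induction s using Multiset.induction_on with
  | empty =>
    have h : logZeroProd 0 = fun _ => 0 := funext fun z => by simp [logZeroProd]
    rw [h]
    exact continuousAt_const
  | cons β s ih =>
    have h : logZeroProd (β ::ₘ s) = fun z => log (1 + z ^ 2 / (β : ℂ)) + logZeroProd s z :=
      funext fun z => logZeroProd_cons β s z
    rw [h]
    refine ContinuousAt.add (ContinuousAt.clog ?_ (by simp)) ih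
    fun_prop

lemma exp_logZeroProd (s : Multiset ℝ) :
    ∀ᶠ z in 𝓝 (0 : ℂ), exp (logZeroProd s z) = zeroProd s z := by
  induction s using Multiset.induction_on with
  | empty => simp [logZeroProd, zeroProd]
  | cons β s ih =>
    have h : ∀ᶠ z : ℂ in 𝓝 0, 1 + z ^ 2 / (β : ℂ) ≠ 0 := by
      have := (tendsto_sq_div_zero β).const_add 1
      rw [add_zero] at this
      exact this.eventually_ne one_ne_zero
    filter_upwards [ih, h] with z h1 h2
    rw [logZeroProd_cons, zeroProd_cons, exp_add, h1, exp_log h2]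

lemma logZeroProd_sub_isBigO (s : Multiset ℝ) (p : ℕ) :
    (fun z => logZeroProd s z - logTaylorSum s p z) =O[𝓝 0] fun z => z ^ (2 * p + 2) := by
  induction s using Multiset.induction_on with
  | empty => simpa [logZeroProd, logTaylorSum] using Asymptotics.isBigO_zero _ _
  | cons β s ih =>
    have h1 := (log_sub_logTaylor_isBigO p).comp_tendsto (tendsto_sq_div_zero β)
    have h2 : (fun z : ℂ => (z ^ 2 / (β : ℂ)) ^ (p + 1)) =O[𝓝 0] fun z => z ^ (2 * p + 2) := by
      have : (fun z : ℂ => (z ^ 2 / (β : ℂ)) ^ (p + 1))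
          = fun z => ((β : ℂ) ^ (p + 1))⁻¹ * z ^ (2 * p + 2) := by
        funext z
        rw [div_pow, ← pow_mul, div_eq_inv_mul, mul_add_one]
      rw [this]
      exact (Asymptotics.isBigO_refl _ _).const_mul_left _
    refine ((h1.trans h2).add ih).congr_left fun z => ?_
    simp only [Function.comp, logZeroProd_cons, logTaylorSum_cons]
    ring

lemma norm_tail_le {f k g : ℂ → ℂ} {s : Multiset ℝ} {c : ℕ → ℂ} {R A : ℝ} {p : ℕ}
    (hfk : ∀ z, f z = zeroProd s z * k z)
    (hc : (fun z => log (f z) - ∑ j ∈ Finset.range (2 * p + 2), c j * z ^ j)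
      =O[𝓝 0] fun z => z ^ (2 * p + 2)) (hR : 0 < R) (hA : 0 < A)
    (hg : DifferentiableOn ℂ g (Metric.ball 0 R)) (hg0 : g 0 = 0)
    (hgk : ∀ z ∈ Metric.ball (0 : ℂ) R, exp (g z) = k z)
    (hre : ∀ z ∈ Metric.ball (0 : ℂ) R, (g z).re ≤ A) {z : ℂ} (hz : ‖z‖ < R / 2) :
    ‖g z - (∑ j ∈ Finset.range (2 * p + 2), c j * z ^ j - logTaylorSum s p z)‖
      ≤ (4 / R) ^ (2 * p + 2) * (2 * A) * ‖z‖ ^ (2 * p + 2) := by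
  have hsub : Metric.ball (0 : ℂ) (R / 2) ⊆ Metric.ball 0 R :=
    Metric.ball_subset_ball (by linarith)
  have hbd : ∀ w ∈ Metric.ball (0 : ℂ) (R / 2), ‖g w‖ ≤ 2 * A := by
    intro w hw
    refine (borelCaratheodory_zero hA hg hre hR (hsub hw) hg0).trans ?_
    have hw' : ‖w‖ < R / 2 := by simpa using hw
    rw [div_le_iff₀ (by linarith)]
    nlinarith
  obtain ⟨d, hd⟩ := exists_coeff_logTaylorSum s p
  have hgc : ContinuousAt g 0 :=
    (hg.differentiableAt (Metric.isOpen_ball.mem_nhds (Metric.mem_ball_self hR))).continuousAt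
  have hev : ∀ᶠ z in 𝓝 (0 : ℂ), log (f z) = g z + logZeroProd s z := by
    have h1 : ContinuousAt (fun z => (g z + logZeroProd s z).im) 0 :=
      continuous_im.continuousAt.comp (hgc.add (continuousAt_logZeroProd s))
    have h0 : (g 0 + logZeroProd s 0).im = 0 := by
      have : logZeroProd s 0 = 0 := by
        refine Multiset.sum_eq_zero fun x hx => ?_
        obtain ⟨β, -, rfl⟩ := Multiset.mem_map.1 hx
        simp
      simp [hg0, this]
    have h2 : ∀ᶠ z in 𝓝 (0 : ℂ), -Real.pi < (g z + logZeroProd s z).im :=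
      h1.eventually (lt_mem_nhds (h0.ge.trans_lt' (neg_lt_zero.2 Real.pi_pos)))
    have h3 : ∀ᶠ z in 𝓝 (0 : ℂ), (g z + logZeroProd s z).im < Real.pi :=
      h1.eventually (gt_mem_nhds (h0.trans_lt Real.pi_pos))
    filter_upwards [h2, h3, exp_logZeroProd s, Metric.ball_mem_nhds 0 hR] with z h2 h3 h4 h5
    rw [← log_exp h2 h3.le, exp_add, h4, hgk z h5, hfk, mul_comm]
  have hO : (fun z => g z - ∑ j ∈ Finset.range (2 * p + 2), (c - d) j * z ^ j)
      =O[𝓝[≠] 0] fun z => z ^ (2 * p + 2) := by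
    refine ((hc.sub (logZeroProd_sub_isBigO s p)).congr' ?_ EventuallyEq.rfl).mono
      nhdsWithin_le_nhds
    filter_upwards [hev] with z hz
    rw [hz, hd]
    simp only [Pi.sub_apply, sub_mul, Finset.sum_sub_distrib]
    ring
  have := norm_sub_polynomial_le (half_pos hR) (hg.mono hsub) hbd hO (z := z) (by simpa using hz)
  simp only [Pi.sub_apply, sub_mul, Finset.sum_sub_distrib, ← hd] at this
  refine this.trans_eq ?_
  congr 3
  field_simp
  norm_num

lemma HasImagZeros.exists_tendsto_log_norm {f : ℂ → ℂ} (hf : HasImagZeros f) {C : ℝ} {m p : ℕ}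
    (hC : 0 ≤ C) (hgrowth : ∀ z, ‖f z‖ ≤ Real.exp (C * (1 + ‖z‖) ^ m)) (hp : m < 2 * p + 2) :
    ∃ (s : ℕ → Multiset ℝ) (c : ℕ → ℂ), Monotone s ∧ (∀ N, ∀ β ∈ s N, 0 < β) ∧
      ∀ z, f z ≠ 0 → Tendsto (fun N => (∑ j ∈ Finset.range (2 * p + 2), c j * z ^ j).re
        + remSum (s N) p (z ^ 2)) atTop (𝓝 (Real.log ‖f z‖)) := by
  obtain ⟨s, k, hs, hpos, hk, hfk, hne, hbd⟩ := hf.exists_exhaustion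
  have hL : AnalyticAt ℂ (fun z => log (f z)) 0 :=
    (hf.differentiable.analyticAt 0).clog (by simp [hf.apply_zero])
  obtain ⟨c, hc⟩ := exists_polynomial_isBigO hL (2 * p + 2)
  refine ⟨s, c, hs, hpos, fun z hz => ?_⟩
  have hlog : ∀ N : ℕ, 1 ≤ N → ∃ g : ℂ → ℂ, DifferentiableOn ℂ g (Metric.ball 0 N) ∧ g 0 = 0 ∧
      ∀ z ∈ Metric.ball (0 : ℂ) N, exp (g z) = k N z := fun N hN =>
    exists_log_of_ne_zero_on_ball (by positivity) (hk N).differentiable.differentiableOn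
      (hk N).apply_zero fun z hz => hne N z (by simpa using (Metric.mem_ball.1 hz).le)
  rw [tendsto_iff_norm_sub_tendsto_zero]
  have hlim : Tendsto (fun N : ℕ => (4 : ℝ) ^ (2 * p + 2) * (2 * (C * 3 ^ m + 1))
      * ‖z‖ ^ (2 * p + 2) * (N : ℝ)⁻¹) atTop (𝓝 0) := by
    simpa using tendsto_inv_atTop_nhds_zero_nat.const_mul
      ((4 : ℝ) ^ (2 * p + 2) * (2 * (C * 3 ^ m + 1)) * ‖z‖ ^ (2 * p + 2))
  refine squeeze_zero' (Eventually.of_forall fun _ => norm_nonneg _) ?_ hlim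
  obtain ⟨N₀, hN₀⟩ := exists_nat_gt (2 * ‖z‖)
  filter_upwards [eventually_ge_atTop (max 1 N₀)] with N hN
  have hN1 : 1 ≤ N := (le_max_left _ _).trans hN
  have hN1' : (1 : ℝ) ≤ N := by exact_mod_cast hN1
  have hzN : ‖z‖ < (N : ℝ) / 2 := by
    have : (N₀ : ℝ) ≤ N := by exact_mod_cast (le_max_right _ _).trans hN
    linarith
  obtain ⟨g, hg, hg0, hgk⟩ := hlog N hN1
  have hre : ∀ w ∈ Metric.ball (0 : ℂ) (N : ℝ), (g w).re ≤ (C * 3 ^ m + 1) * (N : ℝ) ^ m := by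
    intro w hw
    have hw' : ‖w‖ < N := by simpa using hw
    have h1 := hbd N (Real.exp (C * (1 + 2 * N) ^ m)) hN1
      (fun z hz => (hgrowth z).trans_eq (by rw [hz])) w (by linarith)
    rw [← hgk w hw, norm_exp, Real.exp_le_exp] at h1
    have h2 : (1 + 2 * (N : ℝ)) ^ m ≤ (3 * N) ^ m := by gcongr; linarith
    rw [mul_pow] at h2
    nlinarith [mul_le_mul_of_nonneg_left h2 hC, pow_nonneg (by linarith : (0 : ℝ) ≤ N) m]
  have htail := norm_tail_le (hfk N) hc (by linarith : (0 : ℝ) < N) (by positivity) hg hg0 hgk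
    hre hzN
  have hmem : z ∈ Metric.ball (0 : ℂ) (N : ℝ) := by
    rw [mem_ball_zero_iff]; linarith
  have hlogf : Real.log ‖f z‖ = remSum (s N) p (z ^ 2) + (logTaylorSum (s N) p z).re
      + (g z).re := by
    rw [hfk N] at hz ⊢
    rw [norm_mul, Real.log_mul (norm_ne_zero_iff.2 (left_ne_zero_of_mul hz))
      (norm_ne_zero_iff.2 (right_ne_zero_of_mul hz)), log_norm_zeroProd p (left_ne_zero_of_mul hz),
      ← hgk z hmem, norm_exp, Real.log_exp]
  rw [hlogf, Real.norm_eq_abs, abs_sub_comm]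
  have hid : remSum (s N) p (z ^ 2) + (logTaylorSum (s N) p z).re + (g z).re
      - ((∑ j ∈ Finset.range (2 * p + 2), c j * z ^ j).re + remSum (s N) p (z ^ 2))
      = (g z - (∑ j ∈ Finset.range (2 * p + 2), c j * z ^ j - logTaylorSum (s N) p z)).re := by
    simp only [sub_re]; ring
  rw [hid]
  refine (abs_re_le_norm _).trans (htail.trans ?_)
  have h3 : (N : ℝ) ^ m * N ≤ (N : ℝ) ^ (2 * p + 2) := by
    rw [← pow_succ]; exact pow_le_pow_right₀ hN1' (by omega)
  have h4 : (N : ℝ) ^ m / (N : ℝ) ^ (2 * p + 2) ≤ (N : ℝ)⁻¹ := by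
    rw [div_le_iff₀ (by positivity), inv_mul_eq_div, le_div_iff₀ (by positivity)]
    exact h3
  calc (4 / (N : ℝ)) ^ (2 * p + 2) * (2 * ((C * 3 ^ m + 1) * (N : ℝ) ^ m)) * ‖z‖ ^ (2 * p + 2)
      = (4 : ℝ) ^ (2 * p + 2) * (2 * (C * 3 ^ m + 1)) * ‖z‖ ^ (2 * p + 2)
        * ((N : ℝ) ^ m / (N : ℝ) ^ (2 * p + 2)) := by rw [div_pow]; ring
    _ ≤ _ := by gcongr

lemma logRem_conj (p : ℕ) (w : ℂ) : logRem p (conj w) = logRem p w := by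
  have h1 : ‖1 + conj w‖ = ‖1 + w‖ := by
    rw [← norm_conj (1 + w), map_add, map_one]
  have h2 : logTaylor (p + 1) (conj w) = conj (logTaylor (p + 1) w) := by
    simp [logTaylor, map_sum]
  rw [logRem, logRem, h1, h2, conj_re]

lemma remSum_conj (s : Multiset ℝ) (p : ℕ) (w : ℂ) : remSum s p (conj w) = remSum s p w := by
  have : ∀ β : ℝ, logRem p (conj w / (β : ℂ)) = logRem p (w / (β : ℂ)) := fun β => by
    rw [← logRem_conj p (w / (β : ℂ)), map_div₀, conj_ofReal]
  simp only [remSum, this]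

lemma sum_range_two_mul (a : ℕ → ℝ) (n : ℕ) :
    ∑ j ∈ Finset.range (2 * n), a j = ∑ k ∈ Finset.range n, (a (2 * k) + a (2 * k + 1)) := by
  induction n with
  | zero => simp
  | succ n ih => rw [mul_add_one, Finset.sum_range_succ, Finset.sum_range_succ, ih,
      Finset.sum_range_succ, add_assoc]

lemma exists_eq_mul_of_odd_of_le_quadratic {Q : Polynomial ℝ} (hodd : ∀ x, Q.eval (-x) = -Q.eval x)
    {a b : ℝ} (hQ : ∀ x, |Q.eval x| ≤ a + b * x ^ 2) : ∃ β, ∀ x, Q.eval x = β * x := by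
  have hdeg : Q.degree ≤ 2 := by
    by_contra! h
    have h1 := Polynomial.abs_div_tendsto_atTop_atTop_of_degree_gt Q (Polynomial.X ^ 2)
      (by simpa using h) (by simp)
    have h2 := (h1.eventually (eventually_gt_atTop (|a| + |b|))).and (eventually_ge_atTop 1)
    obtain ⟨x, h3, h4⟩ := h2.exists
    have h5 := hQ x
    have hx : 1 ≤ x ^ 2 := one_le_pow₀ h4
    rw [Polynomial.eval_pow, Polynomial.eval_X, abs_div, abs_of_nonneg (by positivity : 0 ≤ x ^ 2),
      lt_div_iff₀ (by positivity)] at h3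
    nlinarith [le_abs_self a, le_abs_self b, abs_nonneg a,
      mul_le_mul_of_nonneg_left hx (abs_nonneg a)]
  refine ⟨Q.coeff 1, fun x => ?_⟩
  have hev : ∀ y, Q.eval y = Q.coeff 0 + Q.coeff 1 * y + Q.coeff 2 * y ^ 2 := fun y => by
    rw [Polynomial.eval_eq_sum_range' (n := 3)
      (Nat.lt_succ_of_le (Polynomial.natDegree_le_of_degree_le hdeg))]
    simp [Finset.sum_range_succ]
  have h1 := hodd x
  rw [hev, hev] at h1
  rw [hev]
  linarith

lemma HasImagZeros.exists_real_tendsto_log_norm {f : ℂ → ℂ} (hf : HasImagZeros f) {C : ℝ}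
    {m p : ℕ} (hC : 0 ≤ C) (hgrowth : ∀ z, ‖f z‖ ≤ Real.exp (C * (1 + ‖z‖) ^ m))
    (hp : m < 2 * p + 2) :
    ∃ (s : ℕ → Multiset ℝ) (c : ℕ → ℝ), Monotone s ∧ (∀ N, ∀ β ∈ s N, 0 < β) ∧
      ∀ z, f z ≠ 0 → Tendsto (fun N => ∑ j ∈ Finset.range (2 * p + 2), c j * (z ^ j).re
        + remSum (s N) p (z ^ 2)) atTop (𝓝 (Real.log ‖f z‖)) := by
  obtain ⟨s, c, hs, hpos, h⟩ := hf.exists_tendsto_log_norm hC hgrowth hp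
  refine ⟨s, fun j => (c j).re, hs, hpos, fun z hz => ?_⟩
  have hz' : f (conj z) ≠ 0 := by
    rw [hf.apply_conj]; exact (map_ne_zero _).2 hz
  have h1 := ((h z hz).add (h _ hz')).const_mul (1 / 2)
  rw [hf.apply_conj, norm_conj] at h1
  have e : 1 / 2 * (Real.log ‖f z‖ + Real.log ‖f z‖) = Real.log ‖f z‖ := by ring
  rw [e] at h1
  refine h1.congr fun N => ?_
  rw [← map_pow, remSum_conj, re_sum, re_sum]
  have : ∀ a b d : ℝ, 1 / 2 * (a + d + (b + d)) = 1 / 2 * (a + b) + d := fun a b d => by ring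
  rw [this, ← Finset.sum_add_distrib, Finset.mul_sum]
  congr 1
  refine Finset.sum_congr rfl fun j _ => ?_
  rw [← map_pow, mul_re, mul_re, conj_re, conj_im]
  ring

lemma sq_cpow_half (w : ℂ) : (w ^ ((2 : ℂ)⁻¹)) ^ 2 = w := by
  simp [← cpow_nat_mul]

lemma HasImagZeros.exists_quadratic_bound {f : ℂ → ℂ} (hf : HasImagZeros f) {C μ : ℝ}
    {m : ℕ} (hC : 0 ≤ C) (hgrowth : ∀ z, ‖f z‖ ≤ Real.exp (C * (1 + ‖z‖) ^ m))
    (hridge : ∀ z : ℂ, ‖f z‖ ≤ ‖f (z.re : ℂ)‖)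
    (hlow : ∀ x : ℝ, Real.exp (μ * x) ≤ ‖f (x : ℂ)‖) :
    ∃ A B β : ℝ, (∀ x : ℝ, Real.log ‖f (x : ℂ)‖ + Real.log ‖f (-x : ℂ)‖ ≤ A + B * x ^ 2) ∧
      ∀ x : ℝ, Real.log ‖f (x : ℂ)‖ - Real.log ‖f (-x : ℂ)‖ = β * x := by
  set q : ℕ := 2 * m
  have hq : Even q := even_two_mul m
  obtain ⟨s, c, hs, hpos, hlim⟩ :=
    hf.exists_real_tendsto_log_norm hC hgrowth (p := q + 2) (by omega)
  have hfr : ∀ x : ℝ, 0 < ‖f (x : ℂ)‖ := fun x => (Real.exp_pos _).trans_le (hlow x)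
  have hlowlog : ∀ x : ℝ, μ * x ≤ Real.log ‖f (x : ℂ)‖ := fun x =>
    (Real.le_log_iff_exp_le (hfr x)).2 (hlow x)
  have hlowlog' : ∀ x : ℝ, -(μ * x) ≤ Real.log ‖f (-x : ℂ)‖ := fun x => by
    simpa using hlowlog (-x)
  set V : ℂ → ℝ := fun v => 1 / 2 * (Real.log ‖f v‖ + Real.log ‖f (-v)‖) with hV
  set U : ℂ → ℝ := fun w => V (w ^ ((2 : ℂ)⁻¹)) with hU
  have hUV : ∀ v w, v ^ 2 = w → U w = V v := by
    intro v w hvw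
    have h1 : (w ^ ((2 : ℂ)⁻¹)) ^ 2 = v ^ 2 := by rw [sq_cpow_half, hvw]
    rcases sq_eq_sq_iff_eq_or_eq_neg.1 h1 with h | h
    · simp only [hU, h]
    · simp only [hU, hV, h, neg_neg]; ring
  have hVx : ∀ x : ℝ, 0 ≤ V x := fun x => by
    have := hlowlog x
    have := hlowlog' x
    simp only [hV]
    linarith
  have hsqrt : ∀ r : ℝ, 0 < r → ((√r : ℝ) : ℂ) ^ 2 = r := fun r hr => by
    rw [← ofReal_pow, Real.sq_sqrt hr.le]
  have hbound := linear_bound_of_ridge (U := U) (s := s) (α := fun k => c (2 * k))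
    (e := fun _ => 0) (q := q) hs hpos ?_ ?_ hq (fun _ => le_rfl) ?_
  · have hquad : ∀ x : ℝ, Real.log ‖f (x : ℂ)‖ + Real.log ‖f (-x : ℂ)‖
        ≤ 2 * |c 0| + 2 * c 2 * x ^ 2 := by
      intro x
      rcases eq_or_ne x 0 with rfl | hx
      · simp [hf.apply_zero]
      · have h1 := hbound (x ^ 2) (by positivity)
        rw [hUV x _ (by push_cast; rfl)] at h1
        simp only [hV, mul_zero, mul_one] at h1
        linarith [le_abs_self (c 0)]
    set Q : Polynomial ℝ := ∑ j ∈ Finset.range (2 * (q + 2) + 2),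
      Polynomial.C (c j * (1 - (-1) ^ j)) * Polynomial.X ^ j with hQ
    have hQev : ∀ x : ℝ, Q.eval x = Real.log ‖f (x : ℂ)‖ - Real.log ‖f (-x : ℂ)‖ := by
      intro x
      have hne : ∀ y : ℝ, f y ≠ 0 := fun y => norm_pos_iff.1 (hfr y)
      have h1 := (hlim x (hne x)).sub (hlim (-x) (by simpa using hne (-x)))
      refine tendsto_nhds_unique (tendsto_const_nhds.congr fun N => ?_) h1
      rw [neg_sq, add_sub_add_right_eq_sub, ← Finset.sum_sub_distrib, hQ,
        Polynomial.eval_finsetSum]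
      refine Finset.sum_congr rfl fun j _ => ?_
      have : ((-(x : ℂ)) ^ j).re = (-1) ^ j * x ^ j := by
        rw [← ofReal_neg, ofReal_pow_re, neg_pow]
      rw [this, ofReal_pow_re]
      simp
      ring
    have hR : ∀ x : ℝ, (Q - Polynomial.C (2 * μ) * Polynomial.X).eval x
        = Real.log ‖f (x : ℂ)‖ - Real.log ‖f (-x : ℂ)‖ - 2 * μ * x := fun x => by
      simp [hQev]
    obtain ⟨β, hβ⟩ := exists_eq_mul_of_odd_of_le_quadratic
      (Q := Q - Polynomial.C (2 * μ) * Polynomial.X) (a := 2 * |c 0|) (b := 2 * c 2)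
      (fun x => by rw [hR, hR]; push_cast; rw [neg_neg]; ring)
      (fun x => by
        rw [hR, abs_le]
        have := hquad x
        have := hlowlog x
        have := hlowlog' x
        constructor <;> linarith)
    refine ⟨_, _, β + 2 * μ, hquad, fun x => ?_⟩
    have := hβ x
    rw [hR] at this
    linarith
  · intro r hr
    rw [hUV _ _ (hsqrt r hr)]
    exact hVx _
  · intro r θ hr hθ0 hθ
    have hcos : 0 < Real.cos θ := Real.cos_pos_of_mem_Ioo ⟨by linarith, hθ⟩
    have hr' : 0 < √r := Real.sqrt_pos.2 hr
    have e1 : (((√r : ℝ) : ℂ) * exp (θ * I)) ^ 2 = r * exp (2 * θ * I) := by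
      rw [mul_pow, hsqrt r hr, ← exp_nat_mul]
      congr 2
      push_cast
      ring
    have e2 : (((√r * Real.cos θ : ℝ) : ℂ)) ^ 2 = ((Real.cos θ ^ 2 * r : ℝ) : ℂ) := by
      rw [← ofReal_pow, mul_pow, Real.sq_sqrt hr.le, mul_comm]
    rw [hUV _ _ e1, hUV _ _ e2]
    have hre : (((√r : ℝ) : ℂ) * exp (θ * I)).re = √r * Real.cos θ := by
      rw [re_ofReal_mul, exp_ofReal_mul_I_re]
    have hmono : ∀ v : ℂ, v.re ≠ 0 → Real.log ‖f v‖ ≤ Real.log ‖f (v.re : ℂ)‖ := fun v hv =>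
      Real.log_le_log (norm_pos_iff.2 (hf.ne_zero v hv)) (hridge v)
    have hre0 : (((√r : ℝ) : ℂ) * exp (θ * I)).re ≠ 0 := by rw [hre]; positivity
    have h1 := hmono _ hre0
    have h2 := hmono (-(((√r : ℝ) : ℂ) * exp (θ * I))) (by rw [neg_re]; exact neg_ne_zero.2 hre0)
    rw [neg_re, hre, ofReal_neg] at h2
    rw [hre] at h1
    simp only [hV]
    linarith
  · intro w hw
    set v := w ^ ((2 : ℂ)⁻¹) with hv
    have hvw : v ^ 2 = w := sq_cpow_half w
    have hvre : v.re ≠ 0 := by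
      intro h
      rw [mem_slitPlane_iff, ← hvw, sq, mul_re, mul_im, h] at hw
      rcases hw with hw | hw
      · nlinarith [mul_self_nonneg v.im]
      · simp at hw
    have h1 := ((hlim v (hf.ne_zero v hvre)).add
      (hlim (-v) (hf.ne_zero (-v) (by simpa using hvre)))).const_mul (1 / 2)
    refine h1.congr fun N => ?_
    rw [neg_sq, hvw]
    have e : ∀ a b d : ℝ, 1 / 2 * (a + d + (b + d)) = 1 / 2 * (a + b) + d := fun a b d => by ring
    rw [e, ← Finset.sum_add_distrib, show 2 * (q + 2) + 2 = 2 * (q + 3) by ring, sum_range_two_mul,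
      Finset.mul_sum, ← add_assoc, zero_mul, add_zero]
    congr 1
    rw [Finset.sum_range_succ]
    have e3 : ∀ k, 1 / 2 * (c (2 * k) * (v ^ (2 * k)).re + c (2 * k) * ((-v) ^ (2 * k)).re
        + (c (2 * k + 1) * (v ^ (2 * k + 1)).re + c (2 * k + 1) * ((-v) ^ (2 * k + 1)).re))
        = c (2 * k) * (w ^ k).re := by
      intro k
      rw [(even_two_mul k).neg_pow, (odd_two_mul_add_one k).neg_pow, pow_mul, hvw, neg_re]
      ring
    simp only [e3]

lemma mul_le_mul_rpow_add {a b r y : ℝ} (ha : 1 < a) (hb : 0 < b) (hr : 0 ≤ r) (hy : 0 ≤ y) :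
    r * y ≤ b * y ^ a + r * (r / b) ^ (a - 1)⁻¹ := by
  have ha' : 0 < a - 1 := sub_pos.2 ha
  have hrb : 0 ≤ r / b := div_nonneg hr hb.le
  rcases le_or_gt y ((r / b) ^ (a - 1)⁻¹) with h | h
  · have h1 : 0 ≤ b * y ^ a := mul_nonneg hb.le (Real.rpow_nonneg hy a)
    linarith [mul_le_mul_of_nonneg_left h hr]
  · have hy0 : 0 < y := (Real.rpow_nonneg hrb _).trans_lt h
    have h1 : r / b ≤ y ^ (a - 1) := by
      have := Real.rpow_le_rpow (Real.rpow_nonneg hrb _) h.le ha'.le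
      rwa [Real.rpow_inv_rpow hrb ha'.ne'] at this
    have h2 : y ^ a = y ^ (a - 1) * y := by
      rw [← Real.rpow_add_one hy0.ne', sub_add_cancel]
    have h3 : r ≤ b * y ^ (a - 1) := by
      rw [div_le_iff₀ hb] at h1
      linarith
    have h4 : 0 ≤ r * (r / b) ^ (a - 1)⁻¹ := mul_nonneg hr (Real.rpow_nonneg hrb _)
    rw [h2]
    nlinarith [mul_le_mul_of_nonneg_right h3 hy]

section Moments

variable {Ω : Type*} [MeasurableSpace Ω] {P : Measure Ω} {Y : Ω → ℝ} {a b : ℝ}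

open ProbabilityTheory

lemma exp_mul_le_of_rpow (ha : 1 < a) (hb : 0 < b) (t y : ℝ) :
    Real.exp (t * y) ≤ Real.exp (|t| * (|t| / b) ^ (a - 1)⁻¹) * Real.exp (b * |y| ^ a) := by
  rw [← Real.exp_add]
  refine Real.exp_le_exp.2 ?_
  have h := mul_le_mul_rpow_add ha hb (abs_nonneg t) (abs_nonneg y)
  have h2 := le_abs_self (t * y)
  rw [abs_mul] at h2
  linarith

lemma integrable_exp_mul_of_rpow (hY : Measurable Y) (ha : 1 < a) (hb : 0 < b)
    (hint : Integrable (fun ω => Real.exp (b * |Y ω| ^ a)) P) (t : ℝ) :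
    Integrable (fun ω => Real.exp (t * Y ω)) P := by
  refine (hint.const_mul (Real.exp (|t| * (|t| / b) ^ (a - 1)⁻¹))).mono' (by fun_prop)
    (Eventually.of_forall fun ω => ?_)
  rw [Real.norm_of_nonneg (Real.exp_pos _).le]
  exact exp_mul_le_of_rpow ha hb t (Y ω)

lemma exists_norm_complexMGF_le [IsProbabilityMeasure P] (hY : Measurable Y) (ha : 1 < a)
    (hb : 0 < b) (hint : Integrable (fun ω => Real.exp (b * |Y ω| ^ a)) P) :
    ∃ (C : ℝ) (m : ℕ), 0 ≤ C ∧
      ∀ z : ℂ, ‖complexMGF Y P z‖ ≤ Real.exp (C * (1 + ‖z‖) ^ m) := by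
  set κ := (a - 1)⁻¹ with hκ
  have hκ0 : 0 < κ := inv_pos.2 (sub_pos.2 ha)
  set E := ∫ ω, Real.exp (b * |Y ω| ^ a) ∂P with hE
  have hE1 : 1 ≤ E := by
    have := integral_mono (integrable_const (1 : ℝ)) hint fun ω =>
      Real.one_le_exp (mul_nonneg hb.le (Real.rpow_nonneg (abs_nonneg (Y ω)) a))
    simpa using this
  have hE0 : 0 < E := one_pos.trans_le hE1
  have hlog : 0 ≤ Real.log E := Real.log_nonneg hE1
  have hbκ : 0 ≤ (b ^ κ)⁻¹ := inv_nonneg.2 (Real.rpow_nonneg hb.le κ)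
  refine ⟨Real.log E + (b ^ κ)⁻¹, ⌈κ⌉₊ + 1, add_nonneg hlog hbκ, fun z => ?_⟩
  have h1 : mgf Y P z.re ≤ Real.exp (|z.re| * (|z.re| / b) ^ κ) * E := by
    rw [mgf, hE, ← integral_const_mul]
    exact integral_mono (integrable_exp_mul_of_rpow hY ha hb hint _) (hint.const_mul _)
      fun ω => exp_mul_le_of_rpow ha hb z.re (Y ω)
  refine (norm_complexMGF_le_mgf.trans h1).trans ?_
  nth_rewrite 1 [← Real.exp_log hE0]
  rw [← Real.exp_add]
  refine Real.exp_le_exp.2 ?_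
  have hz : 0 ≤ ‖z‖ := norm_nonneg z
  have hone : 1 ≤ 1 + ‖z‖ := by linarith
  have h2 : (1 : ℝ) ≤ (1 + ‖z‖) ^ (⌈κ⌉₊ + 1) := one_le_pow₀ hone
  have h3 : |z.re| * (|z.re| / b) ^ κ ≤ (b ^ κ)⁻¹ * (1 + ‖z‖) ^ (⌈κ⌉₊ + 1) := by
    have hle : |z.re| ≤ 1 + ‖z‖ := (abs_re_le_norm z).trans (by linarith)
    have h4 : |z.re| ^ κ ≤ (1 + ‖z‖) ^ ⌈κ⌉₊ := by
      rw [← Real.rpow_natCast]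
      exact (Real.rpow_le_rpow (abs_nonneg _) hle hκ0.le).trans
        (Real.rpow_le_rpow_of_exponent_le hone (Nat.le_ceil κ))
    rw [Real.div_rpow (abs_nonneg _) hb.le, div_eq_mul_inv]
    calc |z.re| * (|z.re| ^ κ * (b ^ κ)⁻¹) = (b ^ κ)⁻¹ * (|z.re| ^ κ * |z.re|) := by ring
      _ ≤ (b ^ κ)⁻¹ * ((1 + ‖z‖) ^ ⌈κ⌉₊ * (1 + ‖z‖)) := by gcongr
      _ = _ := by rw [pow_succ]
  nlinarith [mul_le_mul_of_nonneg_left h2 hlog]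

lemma integrableExpSet_eq_univ (h : ∀ t : ℝ, Integrable (fun ω => Real.exp (t * Y ω)) P) :
    integrableExpSet Y P = Set.univ :=
  Set.eq_univ_of_forall h

lemma hasImagZeros_complexMGF [IsProbabilityMeasure P]
    (h : ∀ t : ℝ, Integrable (fun ω => Real.exp (t * Y ω)) P)
    (hne : ∀ z : ℂ, z.re ≠ 0 → complexMGF Y P z ≠ 0) : HasImagZeros (complexMGF Y P) where
  differentiable := by
    have := differentiableOn_complexMGF (X := Y) (μ := P)
    rw [integrableExpSet_eq_univ h] at this
    simpa [differentiableOn_univ] using this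
  apply_zero := by simp [complexMGF]
  apply_conj z := by
    rw [complexMGF, complexMGF, ← integral_conj]
    simp [← exp_conj]
  ne_zero := hne

lemma integrable_of_integrable_exp_mul (h : ∀ t : ℝ, Integrable (fun ω => Real.exp (t * Y ω)) P) :
    Integrable Y P :=
  integrable_of_mem_interior_integrableExpSet (by simp [integrableExpSet_eq_univ h])

lemma exp_integral_mul_le_mgf [IsProbabilityMeasure P]
    (h : ∀ t : ℝ, Integrable (fun ω => Real.exp (t * Y ω)) P) (x : ℝ) :
    Real.exp ((∫ ω, Y ω ∂P) * x) ≤ mgf Y P x := by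
  set μ := ∫ ω, Y ω ∂P with hμ
  have hY := integrable_of_integrable_exp_mul h
  have hpt : ∀ ω, Real.exp (μ * x) * (1 + (x * Y ω - μ * x)) ≤ Real.exp (x * Y ω) := fun ω => by
    have h1 := Real.add_one_le_exp (x * Y ω - μ * x)
    calc Real.exp (μ * x) * (1 + (x * Y ω - μ * x))
        ≤ Real.exp (μ * x) * Real.exp (x * Y ω - μ * x) := by
          gcongr
          linarith
      _ = Real.exp (x * Y ω) := by rw [← Real.exp_add]; ring_nf
  have hi : Integrable (fun ω => x * Y ω - μ * x) P :=
    (hY.const_mul x).sub (integrable_const _)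
  have h2 := integral_mono (((integrable_const (1 : ℝ)).add hi).const_mul (Real.exp (μ * x)))
    (h x) hpt
  have h3 : ∫ ω, Real.exp (μ * x) * (1 + (x * Y ω - μ * x)) ∂P = Real.exp (μ * x) := by
    rw [integral_const_mul, integral_add (integrable_const _) hi,
      integral_sub (hY.const_mul x) (integrable_const _), integral_const_mul]
    simp only [integral_const, probReal_univ, one_smul, ← hμ]
    ring
  rw [mgf]
  exact h3.symm.le.trans h2

lemma map_neg_eq_map_of_mgf_even [IsProbabilityMeasure P] (hY : Measurable Y)
    (h : ∀ t : ℝ, Integrable (fun ω => Real.exp (t * Y ω)) P)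
    (heven : ∀ t, mgf Y P (-t) = mgf Y P t) : P.map (fun ω => -(Y ω)) = P.map Y := by
  have hmgf : mgf Y P = mgf (-Y) P := funext fun t => by rw [mgf_neg, heven]
  have h1 := eqOn_complexMGF_of_mgf hmgf
  refine (Measure.ext_of_complexMGF_eq hY.aemeasurable hY.neg.aemeasurable ?_).symm
  funext z
  exact h1 (by simp [integrableExpSet_eq_univ h])

lemma lintegral_exp_linear_sub_sq {κ : ℝ} (hκ : 0 < κ) (x : ℝ) :
    ∫⁻ t : ℝ, ENNReal.ofReal (Real.exp (t * x - κ * t ^ 2)) =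
      ENNReal.ofReal (Real.exp ((4 * κ)⁻¹ * x ^ 2)) *
        ∫⁻ t : ℝ, ENNReal.ofReal (Real.exp (-κ * t ^ 2)) := by
  rw [← lintegral_add_right_eq_self _ (x / (2 * κ)), ← lintegral_const_mul _ (by fun_prop)]
  refine lintegral_congr fun t => ?_
  rw [← ENNReal.ofReal_mul (Real.exp_pos _).le, ← Real.exp_add]
  congr 2
  field_simp
  ring

lemma integrable_exp_sq_of_mgf_le [SFinite P] (hY : Measurable Y)
    (h : ∀ t : ℝ, Integrable (fun ω => Real.exp (t * Y ω)) P) {A D : ℝ} (hD : 0 < D)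
    (hle : ∀ t, mgf Y P t ≤ Real.exp (A + D * t ^ 2)) :
    Integrable (fun ω => Real.exp ((4 * (2 * D))⁻¹ * Y ω ^ 2)) P := by
  have hκ : 0 < 2 * D := by linarith
  have hgauss : ∀ {c : ℝ}, 0 < c → ∫⁻ t : ℝ, ENNReal.ofReal (Real.exp (-c * t ^ 2)) =
      ENNReal.ofReal (√(Real.pi / c)) := fun {c} hc => by
    rw [← ofReal_integral_eq_lintegral_ofReal (integrable_exp_neg_mul_sq hc)
      (Eventually.of_forall fun t => (Real.exp_pos _).le), integral_gaussian]
  have hswap : ∫⁻ ω, ∫⁻ t : ℝ, ENNReal.ofReal (Real.exp (t * Y ω - 2 * D * t ^ 2)) ∂volume ∂P =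
      ∫⁻ t : ℝ, ∫⁻ ω, ENNReal.ofReal (Real.exp (t * Y ω - 2 * D * t ^ 2)) ∂P :=
    lintegral_lintegral_swap (by fun_prop)
  have hinner : ∀ t : ℝ, ∫⁻ ω, ENNReal.ofReal (Real.exp (t * Y ω - 2 * D * t ^ 2)) ∂P ≤
      ENNReal.ofReal (Real.exp A) * ENNReal.ofReal (Real.exp (-D * t ^ 2)) := fun t => by
    have h1 : ∀ ω, Real.exp (t * Y ω - 2 * D * t ^ 2) =
        Real.exp (-(2 * D * t ^ 2)) * Real.exp (t * Y ω) := fun ω => by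
      rw [← Real.exp_add]; ring_nf
    simp only [h1]
    rw [← ofReal_integral_eq_lintegral_ofReal ((h t).const_mul _)
      (Eventually.of_forall fun ω => by positivity), integral_const_mul,
      ← ENNReal.ofReal_mul (Real.exp_pos _).le, ← Real.exp_add]
    refine ENNReal.ofReal_le_ofReal ?_
    calc _ ≤ Real.exp (-(2 * D * t ^ 2)) * Real.exp (A + D * t ^ 2) := by
          gcongr
          exact hle t
      _ = _ := by rw [← Real.exp_add]; ring_nf
  have hfin : (∫⁻ ω, ENNReal.ofReal (Real.exp ((4 * (2 * D))⁻¹ * Y ω ^ 2)) ∂P) *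
      ENNReal.ofReal (√(Real.pi / (2 * D))) < ⊤ := by
    rw [← lintegral_mul_const _ (by fun_prop), ← hgauss hκ]
    simp only [← lintegral_exp_linear_sub_sq hκ]
    rw [hswap]
    refine (lintegral_mono hinner).trans_lt ?_
    rw [lintegral_const_mul _ (by fun_prop), hgauss hD]
    exact ENNReal.mul_lt_top ENNReal.ofReal_lt_top ENNReal.ofReal_lt_top
  refine ⟨by fun_prop, ?_⟩
  rw [hasFiniteIntegral_iff_ofReal (Eventually.of_forall fun ω => (Real.exp_pos _).le)]
  refine ENNReal.lt_top_of_mul_ne_top_left hfin.ne ?_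
  rw [ne_eq, ENNReal.ofReal_eq_zero, not_le]
  have := Real.pi_pos
  positivity

lemma integral_eq_zero_of_map_neg_eq (hY : Measurable Y)
    (hsymm : P.map (fun ω => -(Y ω)) = P.map Y) : ∫ ω, Y ω ∂P = 0 := by
  have h1 : ∫ x, x ∂(P.map fun ω => -(Y ω)) = ∫ x, x ∂(P.map Y) := by rw [hsymm]
  rw [integral_map (by fun_prop) (by fun_prop), integral_map hY.aemeasurable (by fun_prop),
    integral_neg] at h1
  linarith

end Moments

end EntireFunctions

/-- Goldberg–Ostrovskii consequence: if `E[exp(b |Y|^a)] < ∞` for some `b > 0`, `a > 1`,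
and the entire function `z ↦ E[exp(z Y)]` has only pure imaginary zeros, then `Y - E[Y]`
is of Lee–Yang type (in particular it is symmetric and has sub-Gaussian tails). -/
theorem centered_isLeeYang_of_pure_imaginary_zeros
    {Ω : Type*} [MeasurableSpace Ω] (P : Measure Ω) [IsProbabilityMeasure P]
    (Y : Ω → ℝ) (hY : Measurable Y)
    (a b : ℝ) (ha : 1 < a) (hb : 0 < b)
    (hint : Integrable (fun ω => Real.exp (b * |Y ω| ^ a)) P)
    (hPIZ : ∀ z : ℂ, z.re ≠ 0 → (∫ ω, Complex.exp (z * (Y ω : ℂ)) ∂P) ≠ 0) :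
    IsLeeYangRV P (fun ω => Y ω - ∫ ω', Y ω' ∂P) := by
  have hmom := integrable_exp_mul_of_rpow hY ha hb hint
  have hpos : ∀ x, 0 < ProbabilityTheory.mgf Y P x := fun x => ProbabilityTheory.mgf_pos (hmom x)
  have hnorm : ∀ x : ℝ, ‖ProbabilityTheory.complexMGF Y P x‖ = ProbabilityTheory.mgf Y P x :=
    fun x => by
      rw [ProbabilityTheory.complexMGF_ofReal, Complex.norm_real, Real.norm_of_nonneg (hpos x).le]
  have hnorm_neg : ∀ x : ℝ,
      ‖ProbabilityTheory.complexMGF Y P (-x)‖ = ProbabilityTheory.mgf Y P (-x) := fun x => by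
    rw [← hnorm, Complex.ofReal_neg]
  obtain ⟨C, m, hC, hgrowth⟩ := exists_norm_complexMGF_le hY ha hb hint
  obtain ⟨A, B, β, hadd, hsub⟩ :=
    (hasImagZeros_complexMGF hmom hPIZ).exists_quadratic_bound hC hgrowth
      (fun z => by rw [hnorm]; exact ProbabilityTheory.norm_complexMGF_le_mgf)
      (fun x => by rw [hnorm]; exact exp_integral_mul_le_mgf hmom x)
  simp only [hnorm, hnorm_neg] at hadd hsub
  have hmgf : ∀ c x : ℝ, ProbabilityTheory.mgf (fun ω => Y ω - c) P x =
      Real.exp (Real.log (ProbabilityTheory.mgf Y P x) - x * c) := fun c x => by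
    simp only [sub_eq_add_neg]
    rw [ProbabilityTheory.mgf_add_const, Real.exp_add, Real.exp_log (hpos x), mul_neg]
  have hmomc : ∀ c t : ℝ, Integrable (fun ω => Real.exp (t * (Y ω - c))) P := fun c t => by
    simp only [mul_sub, Real.exp_sub]
    exact (hmom t).div_const _
  have hsymm : P.map (fun ω => -(Y ω - β / 2)) = P.map (fun ω => Y ω - β / 2) := by
    refine map_neg_eq_map_of_mgf_even (hY.sub_const _) (hmomc _) fun t => ?_
    rw [hmgf, hmgf]
    congr 1
    linarith [hsub t]
  have hmean : ∫ ω, Y ω ∂P = β / 2 := by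
    have h0 := integral_eq_zero_of_map_neg_eq (hY.sub_const _) hsymm
    rw [integral_sub (integrable_of_integrable_exp_mul hmom) (integrable_const _)] at h0
    simp only [integral_const, probReal_univ, one_smul] at h0
    linarith
  rw [hmean]
  refine ⟨hsymm, ⟨(4 * (2 * (|B| + 1)))⁻¹, by positivity, ?_⟩, fun z hz => ?_⟩
  · refine integrable_exp_sq_of_mgf_le (A := A / 2) (hY.sub_const _) (hmomc _)
      (by positivity) fun t => ?_
    rw [hmgf]
    refine Real.exp_le_exp.2 ?_
    have h1 : B * t ^ 2 ≤ |B| * t ^ 2 := by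
      gcongr
      exact le_abs_self B
    nlinarith [hadd t, hsub t, sq_nonneg t, mul_nonneg (abs_nonneg B) (sq_nonneg t)]
  · have h1 : ∀ ω, Complex.exp (z * ((Y ω - β / 2 : ℝ) : ℂ)) =
        Complex.exp (-(z * (β / 2))) * Complex.exp (z * (Y ω : ℂ)) := fun ω => by
      rw [← Complex.exp_add]
      push_cast
      ring_nf
    simp only [h1]
    rw [integral_const_mul]
    exact mul_ne_zero (Complex.exp_ne_zero _) (hPIZ z hz)
end

section
/- Let X be a real random variable of Lee–Yang type. Then for every z ∈ ℂ, |E[exp(z X)]| ≤ exp( (1/2) · E[X²] · |z|² ). -/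
open MeasureTheory

section EntireFunctions

open Complex Metric Set Filter Topology

theorem Differentiable.exists_eq_pow_mul {f : ℂ → ℂ} (hf : Differentiable ℂ f)
    (hne : ∃ z, f z ≠ 0) (a : ℂ) :
    ∃ (n : ℕ) (g : ℂ → ℂ), Differentiable ℂ g ∧ g a ≠ 0 ∧ ∀ z, f z = (z - a) ^ n * g z := by
  obtain ⟨w, hw⟩ := hne
  obtain ⟨p, hp⟩ := hf.analyticAt a
  have hp0 : p ≠ 0 := fun h => hw <| by
    have hfa : AnalyticOnNhd ℂ f univ := fun z _ => hf.analyticAt z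
    exact hfa.eqOn_zero_of_preconnected_of_eventuallyEq_zero isPreconnected_univ (mem_univ a)
      (hp.locally_zero_iff.mpr h) (mem_univ w)
  refine ⟨p.order, _, ?_, hp.iterate_dslope_fslope_ne_zero hp0, hp.eq_pow_order_mul_iterate_dslope⟩
  generalize p.order = n
  induction n with
  | zero => exact hf
  | succ n ih =>
    rw [Function.iterate_succ_apply']
    rw [← differentiableOn_univ] at ih ⊢
    exact (Complex.differentiableOn_dslope univ_mem).mpr ih

theorem Differentiable.exists_eq_prod_mul {f : ℂ → ℂ} (hf : Differentiable ℂ f)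
    (hf0 : f 0 ≠ 0) (T : Finset ℂ) (hT : 0 ∉ T) :
    ∃ (m : ℂ → ℕ) (h : ℂ → ℂ), Differentiable ℂ h ∧ (∀ a ∈ T, h a ≠ 0) ∧
      ∀ z, f z = (∏ a ∈ T, (1 - z / a) ^ m a) * h z := by
  classical
  induction T using Finset.induction_on with
  | empty => exact ⟨0, f, hf, by simp, by simp⟩
  | insert a T ha ih =>
    obtain ⟨m, h, hh, hne, heq⟩ := ih (fun h => hT (Finset.mem_insert_of_mem h))
    have ha0 : a ≠ 0 := fun h => hT (by simp [h])
    have hh0 : h 0 ≠ 0 := fun h0 => hf0 (by rw [heq, h0, mul_zero])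
    obtain ⟨n, g, hg, hga, hgeq⟩ := hh.exists_eq_pow_mul ⟨0, hh0⟩ a
    refine ⟨Function.update m a n, fun z => (-a) ^ n * g z, hg.const_mul _, ?_, fun z => ?_⟩
    · intro b hb
      have hgb : g b ≠ 0 := by
        rcases Finset.mem_insert.mp hb with rfl | hb
        · exact hga
        · exact fun h0 => hne b hb (by rw [hgeq, h0, mul_zero])
      exact mul_ne_zero (pow_ne_zero _ (neg_ne_zero.mpr ha0)) hgb
    · rw [Finset.prod_insert ha, heq, hgeq]
      have hprod : ∏ b ∈ T, (1 - z / b) ^ Function.update m a n b = ∏ b ∈ T, (1 - z / b) ^ m b :=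
        Finset.prod_congr rfl fun b hb => by
          rw [Function.update_of_ne (by rintro rfl; exact ha hb)]
      have hz : (z - a) ^ n = (1 - z / a) ^ n * (-a) ^ n := by
        rw [← mul_pow]; congr 1; field_simp; ring
      rw [hprod, Function.update_self, hz]
      ring

theorem Differentiable.finite_zeros_closedBall {f : ℂ → ℂ} (hf : Differentiable ℂ f)
    (hne : ∃ z, f z ≠ 0) (R : ℝ) : {z | f z = 0 ∧ z ∈ closedBall 0 R}.Finite := by
  by_contra hinf
  obtain ⟨w, hw⟩ := hne
  obtain ⟨a, -, ha⟩ := Set.Infinite.exists_accPt_of_subset_isCompact hinf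
    (isCompact_closedBall (0 : ℂ) R) (fun z hz => hz.2)
  have hfa : AnalyticOnNhd ℂ f univ := fun z _ => hf.analyticAt z
  refine hw (hfa.eqOn_zero_of_preconnected_of_frequently_eq_zero isPreconnected_univ (mem_univ a)
    ?_ (mem_univ w))
  exact (accPt_iff_frequently_nhdsNE.mp ha).mono fun z hz => hz.1

theorem exists_exp_eq_of_ball {h : ℂ → ℂ} {R : ℝ} (hR : 0 < R)
    (hh : DifferentiableOn ℂ h (ball 0 R)) (hne : ∀ z ∈ ball (0 : ℂ) R, h z ≠ 0) (h0 : h 0 = 1) :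
    ∃ H : ℂ → ℂ, DifferentiableOn ℂ H (ball 0 R) ∧ H 0 = 0 ∧
      ∀ z ∈ ball (0 : ℂ) R, h z = exp (H z) := by
  have hd : DifferentiableOn ℂ (fun z => deriv h z / h z) (ball 0 R) :=
    (hh.deriv isOpen_ball).div hh hne
  obtain ⟨H, hH0, hH⟩ := hd.isExactOn_ball.with_val_at 0 0
  refine ⟨H, fun z hz => (hH z hz).differentiableAt.differentiableWithinAt, hH0, fun z hz => ?_⟩
  have hconst : h z * exp (-H z) = h 0 * exp (-H 0) := by
    refine (convex_ball (0 : ℂ) R).is_const_of_fderivWithin_eq_zero (𝕜 := ℂ)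
      (f := fun z => h z * exp (-H z)) ?_ ?_ hz (mem_ball_self hR)
    · exact hh.mul (DifferentiableOn.cexp
        fun z hz => (hH z hz).differentiableAt.differentiableWithinAt.neg)
    · intro w hw
      have h1 := (hh.differentiableAt (isOpen_ball.mem_nhds hw)).hasDerivAt.mul (hH w hw).neg.cexp
      have h2 : HasDerivAt (fun z => h z * exp (-H z)) 0 w := by
        convert! h1 using 1
        have := hne w hw
        simp only [Pi.neg_apply]
        field_simp
        ring
      rw [fderivWithin_of_isOpen isOpen_ball hw]
      simpa using h2.hasFDerivAt.fderiv
  rw [h0, hH0, neg_zero, exp_zero, mul_one, exp_neg] at hconst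
  exact (mul_inv_eq_one₀ (exp_ne_zero _)).mp hconst

theorem exists_sq_approx_log_norm {h : ℂ → ℂ} {R B : ℝ} (hR : 0 < R) (hB : 0 < B)
    (hh : DifferentiableOn ℂ h (ball 0 R)) (hne : ∀ z ∈ ball (0 : ℂ) R, h z ≠ 0) (h0 : h 0 = 1)
    (hbd : ∀ z ∈ ball (0 : ℂ) R, ‖h z‖ ≤ Real.exp B) :
    ∃ c : ℝ, ∀ x : ℝ, |x| < R / 2 →
      |Real.log (‖h x‖ * ‖h (-x)‖) - c * x ^ 2| ≤ 64 * B / R ^ 3 * |x| ^ 3 := by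
  obtain ⟨H, hHd, hH0, hH⟩ := exists_exp_eq_of_ball hR hh hne h0
  have hre : MapsTo H (ball 0 R) {z | z.re ≤ B} := fun z hz => by
    have := hbd z hz
    rwa [hH z hz, norm_exp, Real.exp_le_exp] at this
  set r := R / 2 with hr
  have hr0 : 0 < r := by positivity
  have hsub : ball (0 : ℂ) r ⊆ ball 0 R := ball_subset_ball (by linarith)
  have hneg : ∀ z ∈ ball (0 : ℂ) r, -z ∈ ball (0 : ℂ) r := fun z hz => by simpa using hz
  have hHb : ∀ z ∈ ball (0 : ℂ) r, ‖H z‖ ≤ 2 * B := fun z hz => by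
    refine (borelCaratheodory_zero hB hHd hre hR (hsub hz) hH0).trans ?_
    have hz' : ‖z‖ < R / 2 := mem_ball_zero_iff.mp hz
    rw [div_le_iff₀ (by linarith)]
    nlinarith
  set K : ℂ → ℂ := fun z => H z + H (-z) with hK
  have hKd : DifferentiableOn ℂ K (ball 0 r) :=
    (hHd.mono hsub).add ((hHd.mono hsub).comp differentiableOn_id.neg hneg)
  have hK0 : K 0 = 0 := by simp [hK, hH0]
  have hKb : MapsTo K (ball 0 r) (closedBall (K 0) (4 * B)) := fun z hz => by
    rw [hK0, mem_closedBall_zero_iff]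
    linarith [norm_add_le (H z) (H (-z)), hHb z hz, hHb (-z) (hneg z hz)]
  have hnhds : ball (0 : ℂ) r ∈ 𝓝 0 := ball_mem_nhds _ hr0
  set N := dslope K 0 with hN
  have hNd : DifferentiableOn ℂ N (ball 0 r) := (Complex.differentiableOn_dslope hnhds).mpr hKd
  have hN0 : N 0 = 0 := by
    have hH' := ((hHd.mono hsub).differentiableAt hnhds).hasDerivAt
    have hH'' : HasDerivAt H (deriv H 0) (-0) := by rwa [neg_zero]
    have := hH'.add (hH''.comp (0 : ℂ) (hasDerivAt_neg (0 : ℂ)))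
    rw [hN, dslope_same]
    refine HasDerivAt.deriv (f' := 0) ?_
    convert! this using 1
    ring
  have hNb : MapsTo N (ball 0 r) (closedBall (N 0) (4 * B / r)) := fun z hz => by
    rw [hN0, mem_closedBall_zero_iff]
    exact norm_dslope_le_div_of_mapsTo_ball hKd hKb hz
  set M := dslope N 0 with hM
  have hMd : DifferentiableOn ℂ M (ball 0 r) := (Complex.differentiableOn_dslope hnhds).mpr hNd
  have hMn : ∀ z ∈ ball (0 : ℂ) r, ‖M z‖ ≤ 4 * B / r / r := fun z hz =>
    norm_dslope_le_div_of_mapsTo_ball hNd hNb hz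
  have hMb : MapsTo M (ball 0 r) (closedBall (M 0) (8 * B / r ^ 2)) := fun z hz => by
    rw [mem_closedBall, dist_eq_norm]
    have h1 := hMn z hz
    have h2 := hMn 0 (mem_ball_self hr0)
    have h3 : 8 * B / r ^ 2 = 4 * B / r / r + 4 * B / r / r := by field_simp; ring
    linarith [norm_sub_le (M z) (M 0)]
  have hKM : ∀ z, K z = z ^ 2 * M z := fun z => by
    have h1 := sub_smul_dslope_of_zero hK0 z
    have h2 := sub_smul_dslope_of_zero hN0 z
    simp only [sub_zero, smul_eq_mul] at h1 h2
    rw [← h1, ← hN, ← h2]; ring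
  refine ⟨(M 0).re, fun x hx => ?_⟩
  have hxr : (x : ℂ) ∈ ball (0 : ℂ) r := by simpa using hx
  have hlog : Real.log (‖h x‖ * ‖h (-x)‖) = (K x).re := by
    rw [hH _ (hsub hxr), hH _ (hsub (hneg _ hxr)), norm_exp, norm_exp, ← Real.exp_add, Real.log_exp]
    simp [hK]
  have hMx := dist_le_div_mul_dist_of_mapsTo_ball hMd hMb hxr
  rw [dist_eq_norm, dist_zero_right, norm_real, Real.norm_eq_abs] at hMx
  have hKx : (K x).re - (M 0).re * x ^ 2 = x ^ 2 * (M x - M 0).re := by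
    have hxx : (x : ℂ) ^ 2 = ((x ^ 2 : ℝ) : ℂ) := by push_cast; rfl
    rw [hKM, hxx, re_ofReal_mul, sub_re]; ring
  rw [hlog, hKx, abs_mul, abs_of_nonneg (sq_nonneg x)]
  calc x ^ 2 * |(M x - M 0).re| ≤ x ^ 2 * (8 * B / r ^ 2 / r * |x|) := by
        gcongr; exact (abs_re_le_norm _).trans hMx
    _ = 64 * B / R ^ 3 * |x| ^ 3 := by
        rw [hr, ← sq_abs x]; field_simp; ring

theorem HasDerivAt.nonneg_of_eventually_nonneg_right {g : ℝ → ℝ} {g' : ℝ} (hg : HasDerivAt g g' 0)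
    (h0 : g 0 = 0) (hnn : ∀ᶠ s in 𝓝[>] 0, 0 ≤ g s) : 0 ≤ g' := by
  have h := hg.tendsto_slope.mono_left (nhdsGT_le_nhdsNE 0)
  refine ge_of_tendsto h ?_
  filter_upwards [hnn, self_mem_nhdsWithin] with s hs hs0
  rw [slope_def_field, h0, sub_zero, sub_zero]
  exact div_nonneg hs (le_of_lt hs0)

theorem norm_one_sub_div_mul_norm_one_add_div {a : ℂ} (ha : a.re = 0) (x : ℝ) :
    ‖1 - (x : ℂ) / a‖ * ‖1 - (-x : ℂ) / a‖ = 1 + x ^ 2 / ‖a‖ ^ 2 := by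
  have hsq : a ^ 2 = ((-‖a‖ ^ 2 : ℝ) : ℂ) := by
    have haI : a = a.im * I := Complex.ext (by simp [ha]) (by simp)
    have hnorm : ‖a‖ ^ 2 = a.im ^ 2 := by rw [Complex.sq_norm, normSq_apply, ha]; ring
    rw [hnorm]
    conv_lhs => rw [haI, mul_pow, I_sq]
    push_cast
    ring
  have h : (1 - (x : ℂ) / a) * (1 - (-x : ℂ) / a) = ((1 + x ^ 2 / ‖a‖ ^ 2 : ℝ) : ℂ) := by
    have : (1 - (x : ℂ) / a) * (1 - (-x : ℂ) / a) = 1 - x ^ 2 / a ^ 2 := by ring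
    rw [this, hsq]
    push_cast
    ring
  rw [← norm_mul, h, norm_real, Real.norm_of_nonneg (by positivity)]

theorem exists_log_norm_mul_eq_sum_add {f : ℂ → ℂ} (hf : Differentiable ℂ f) (h0 : f 0 = 1)
    (hz : ∀ z : ℂ, z.re ≠ 0 → f z ≠ 0) {R B : ℝ} (hR : 0 < R) (hB : 0 < B)
    (hgr : ∀ z : ℂ, ‖z‖ = 2 * R → ‖f z‖ ≤ Real.exp B) :
    ∃ (T : Finset ℂ) (m : ℂ → ℕ) (c : ℝ), ∀ x : ℝ, |x| < R / 2 →
      |Real.log (‖f x‖ * ‖f (-x)‖) - (∑ a ∈ T, m a * Real.log (1 + x ^ 2 / ‖a‖ ^ 2) + c * x ^ 2)|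
        ≤ 64 * B / R ^ 3 * |x| ^ 3 := by
  have hne0 : f 0 ≠ 0 := by simp [h0]
  have hfin := hf.finite_zeros_closedBall ⟨0, hne0⟩ R
  set T := hfin.toFinset with hT
  have hTmem : ∀ a, a ∈ T ↔ f a = 0 ∧ ‖a‖ ≤ R := fun a => by simp [hT]
  have hT0 : (0 : ℂ) ∉ T := fun h => hne0 ((hTmem 0).mp h).1
  obtain ⟨m, h, hh, hTne, heq⟩ := hf.exists_eq_prod_mul hne0 T hT0
  have hone : h 0 = 1 := by simpa [h0] using (heq 0).symm
  have hne : ∀ z ∈ ball (0 : ℂ) R, h z ≠ 0 := fun z hzR hz0 => by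
    refine hTne z ((hTmem z).mpr ⟨by rw [heq, hz0, mul_zero], ?_⟩) hz0
    exact (mem_ball_zero_iff.mp hzR).le
  have hsphere : ∀ z ∈ frontier (ball (0 : ℂ) (2 * R)), ‖h z‖ ≤ Real.exp B := fun z hzf => by
    rw [frontier_ball _ (by positivity), mem_sphere_zero_iff_norm] at hzf
    refine le_trans ?_ (hgr z hzf)
    rw [heq, norm_mul, norm_prod]
    refine le_mul_of_one_le_left (norm_nonneg _) (Finset.prod_induction _ (1 ≤ ·)
      (fun _ _ => one_le_mul_of_one_le_of_one_le) le_rfl fun a ha => ?_)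
    rw [norm_pow]
    refine one_le_pow₀ ?_
    have ha0 : 0 < ‖a‖ := norm_pos_iff.mpr fun h => hT0 (h ▸ ha)
    have h2 : 2 ≤ ‖z / a‖ := by
      rw [norm_div, hzf, le_div_iff₀ ha0]
      linarith [((hTmem a).mp ha).2]
    have h3 := norm_sub_norm_le (z / a) 1
    rw [norm_one, norm_sub_rev] at h3
    linarith
  have hbd : ∀ z ∈ ball (0 : ℂ) R, ‖h z‖ ≤ Real.exp B := fun z hzR =>
    norm_le_of_forall_mem_frontier_norm_le isBounded_ball hh.diffContOnCl hsphere
      (subset_closure (ball_subset_ball (by linarith) hzR))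
  obtain ⟨c, hc⟩ := exists_sq_approx_log_norm hR hB hh.differentiableOn hne hone hbd
  refine ⟨T, m, c, fun x hx => ?_⟩
  have hlog : Real.log (‖f x‖ * ‖f (-x)‖) =
      ∑ a ∈ T, m a * Real.log (1 + x ^ 2 / ‖a‖ ^ 2) + Real.log (‖h x‖ * ‖h (-x)‖) := by
    have hxR : (x : ℂ) ∈ ball (0 : ℂ) R := by
      rw [mem_ball_zero_iff, norm_real, Real.norm_eq_abs]; linarith
    have hxR' : -(x : ℂ) ∈ ball (0 : ℂ) R := by simpa using hxR
    have hprod : ‖f x‖ * ‖f (-x)‖ =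
        (∏ a ∈ T, (1 + x ^ 2 / ‖a‖ ^ 2) ^ m a) * (‖h x‖ * ‖h (-x)‖) := by
      rw [heq x, heq (-x), norm_mul, norm_mul, mul_mul_mul_comm, norm_prod, norm_prod,
        ← Finset.prod_mul_distrib]
      congr 1
      refine Finset.prod_congr rfl fun a ha => ?_
      have hare : a.re = 0 := by
        by_contra h
        exact hz a h ((hTmem a).mp ha).1
      rw [norm_pow, norm_pow, ← mul_pow, norm_one_sub_div_mul_norm_one_add_div hare]
    have hpos : ∀ a ∈ T, (1 + x ^ 2 / ‖a‖ ^ 2) ^ m a ≠ 0 := fun a _ => by positivity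
    rw [hprod, Real.log_mul (Finset.prod_ne_zero_iff.mpr hpos)
      (mul_ne_zero (norm_ne_zero_iff.mpr (hne _ hxR)) (norm_ne_zero_iff.mpr (hne _ hxR'))),
      Real.log_prod hpos]
    simp_rw [Real.log_pow]
  rw [hlog, add_sub_add_left_eq_sub]
  exact hc x hx

theorem log_norm_mul_le_mul_sq {f : ℂ → ℂ} (hf : Differentiable ℂ f) (h0 : f 0 = 1)
    (hz : ∀ z : ℂ, z.re ≠ 0 → f z ≠ 0) {A : ℝ} (hA : 0 < A)
    (hgr : ∀ z : ℂ, ‖f z‖ ≤ Real.exp (A * (1 + ‖z‖ ^ 2)))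
    {ψ : ℝ → ℝ} {v : ℝ} (hψ : HasDerivAt ψ v 0) (hψ0 : ψ 0 = 0)
    (hle : ∀ᶠ s : ℝ in 𝓝[>] 0, Real.log (‖f (√s : ℝ)‖ * ‖f (-(√s : ℝ))‖) ≤ ψ s) (x : ℝ) :
    Real.log (‖f x‖ * ‖f (-x)‖) ≤ v * x ^ 2 := by
  have key : ∀ᶠ R : ℝ in atTop,
      Real.log (‖f x‖ * ‖f (-x)‖) ≤ v * x ^ 2 + 320 * A * |x| ^ 3 * R⁻¹ := by
    filter_upwards [eventually_ge_atTop 1, eventually_gt_atTop (2 * |x|)] with R hR1 hRx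
    have hR : 0 < R := by linarith
    set B := A * (1 + 4 * R ^ 2) with hB
    have hB0 : 0 < B := by positivity
    obtain ⟨T, m, c, hc⟩ := exists_log_norm_mul_eq_sum_add hf h0 hz hR hB0 fun z hzn => by
      refine (hgr z).trans_eq ?_
      rw [hB, hzn]; ring_nf
    set D := 64 * B / R ^ 3 with hD
    have hcoef : c + ∑ a ∈ T, m a * (1 / ‖a‖ ^ 2) ≤ v := by
      have hlogd : ∀ a ∈ T, HasDerivAt (fun s : ℝ => m a * Real.log (1 + s / ‖a‖ ^ 2))
          (m a * (1 / ‖a‖ ^ 2)) 0 := fun a _ => by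
        have h1 := (((hasDerivAt_id (0 : ℝ)).div_const (‖a‖ ^ 2)).const_add 1).log (by simp)
        convert! h1.const_mul (m a : ℝ) using 1
        simp
      have hrpow : HasDerivAt (fun s : ℝ => D * s ^ (3 / 2 : ℝ)) 0 0 := by
        have h1 := (Real.hasDerivAt_rpow_const (x := 0) (p := 3 / 2)
          (Or.inr (by norm_num))).const_mul D
        convert! h1 using 1
        rw [Real.zero_rpow (by norm_num)]; simp
      have hd := ((hψ.sub (HasDerivAt.fun_sum hlogd)).sub
        ((hasDerivAt_id (0 : ℝ)).const_mul c)).add hrpow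
      have := hd.nonneg_of_eventually_nonneg_right ?_ ?_
      · linarith
      · simp [hψ0]
      · have hsmall : ∀ᶠ s : ℝ in 𝓝[>] 0, s < (R / 2) ^ 2 :=
          nhdsWithin_le_nhds (eventually_lt_nhds (by positivity))
        filter_upwards [hsmall, self_mem_nhdsWithin, hle] with s hs hs0 h4
        have hs0 : 0 < s := hs0
        have hsq : √s ^ 2 = s := Real.sq_sqrt hs0.le
        have habs : |√s| = √s := abs_of_nonneg (Real.sqrt_nonneg s)
        have h1 := hc (√s) (by rw [habs]; exact (Real.sqrt_lt' (by positivity)).mpr hs)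
        have h2 : √s ^ 3 = s ^ (3 / 2 : ℝ) := by
          rw [Real.sqrt_eq_rpow, ← Real.rpow_natCast, ← Real.rpow_mul hs0.le]; norm_num
        rw [hsq, habs, h2] at h1
        have h3 := (abs_le.mp h1).1
        simp only [Pi.sub_apply, Pi.add_apply, id]
        linarith
    have hsum : ∑ a ∈ T, m a * Real.log (1 + x ^ 2 / ‖a‖ ^ 2) ≤
        (∑ a ∈ T, m a * (1 / ‖a‖ ^ 2)) * x ^ 2 := by
      rw [Finset.sum_mul]
      refine Finset.sum_le_sum fun a _ => ?_
      rw [mul_assoc, one_div_mul_eq_div]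
      gcongr
      linarith [Real.log_le_sub_one_of_pos (show 0 < 1 + x ^ 2 / ‖a‖ ^ 2 by positivity)]
    have hDle : D ≤ 320 * A * R⁻¹ := by
      rw [hD, hB, ← div_eq_mul_inv, div_le_div_iff₀ (by positivity) hR]
      have : 0 ≤ A * R * (R ^ 2 - 1) := by
        have : 0 ≤ R ^ 2 - 1 := by nlinarith
        positivity
      nlinarith
    have h1 := (abs_le.mp (hc x (by linarith))).2
    have h2 := mul_le_mul_of_nonneg_right hcoef (sq_nonneg x)
    have h3 := mul_le_mul_of_nonneg_right hDle (pow_nonneg (abs_nonneg x) 3)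
    linarith
  have hlim : Tendsto (fun R : ℝ => v * x ^ 2 + 320 * A * |x| ^ 3 * R⁻¹) atTop (𝓝 (v * x ^ 2)) := by
    simpa using (tendsto_inv_atTop_zero.const_mul (320 * A * |x| ^ 3)).const_add (v * x ^ 2)
  exact ge_of_tendsto hlim key

end EntireFunctions

section MomentGeneratingFunction

open ProbabilityTheory Filter Topology

variable {Ω : Type*} [MeasurableSpace Ω] {P : Measure Ω} {X : Ω → ℝ}

theorem integrable_exp_mul_of_integrable_exp_mul_sq (hX : Measurable X) {b : ℝ} (hb : 0 < b)
    (hint : Integrable (fun ω => Real.exp (b * X ω ^ 2)) P) (t : ℝ) :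
    Integrable (fun ω => Real.exp (t * X ω)) P ∧
      mgf X P t ≤ (∫ ω, Real.exp (b * X ω ^ 2) ∂P) * Real.exp (t ^ 2 / (4 * b)) := by
  have hle : ∀ ω, Real.exp (t * X ω) ≤ Real.exp (b * X ω ^ 2) * Real.exp (t ^ 2 / (4 * b)) := by
    intro ω
    rw [← Real.exp_add, Real.exp_le_exp, ← sub_nonneg]
    have : b * X ω ^ 2 + t ^ 2 / (4 * b) - t * X ω = (2 * b * X ω - t) ^ 2 / (4 * b) := by
      field_simp; ring
    rw [this]
    positivity
  have hdom := hint.mul_const (Real.exp (t ^ 2 / (4 * b)))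
  have hI : Integrable (fun ω => Real.exp (t * X ω)) P :=
    hdom.mono' (by fun_prop) (ae_of_all _ fun ω => by
      rw [Real.norm_of_nonneg (Real.exp_nonneg _)]; exact hle ω)
  refine ⟨hI, ?_⟩
  rw [← integral_mul_const]
  exact integral_mono hI hdom hle

theorem zero_mem_interior_integrableExpSet_sq [IsFiniteMeasure P] {b : ℝ} (hb : 0 < b)
    (hX : Measurable X) (hint : Integrable (fun ω => Real.exp (b * X ω ^ 2)) P) :
    0 ∈ interior (integrableExpSet (fun ω => X ω ^ 2) P) := by
  rw [mem_interior_iff_mem_nhds]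
  filter_upwards [eventually_lt_nhds hb] with t ht
  refine hint.mono' (by fun_prop) (ae_of_all _ fun ω => ?_)
  rw [Real.norm_of_nonneg (Real.exp_nonneg _), Real.exp_le_exp]
  exact mul_le_mul_of_nonneg_right ht.le (sq_nonneg _)

theorem mgf_le_mgf_sq (heven : mgf X P = fun t => mgf X P (-t))
    (hint : ∀ t, Integrable (fun ω => Real.exp (t * X ω)) P) (t : ℝ)
    (hsq : t ^ 2 / 2 ∈ integrableExpSet (fun ω => X ω ^ 2) P) :
    mgf X P t ≤ mgf (fun ω => X ω ^ 2) P (t ^ 2 / 2) := by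
  have h1 : mgf X P t = ∫ ω, (Real.exp (t * X ω) + Real.exp (-t * X ω)) / 2 ∂P := by
    rw [integral_div, integral_add (hint t) (hint (-t))]
    have := congrFun heven t
    simp only [mgf] at this ⊢
    linarith
  rw [h1]
  refine integral_mono (((hint t).add (hint (-t))).div_const 2) hsq fun ω => ?_
  have h2 := Real.cosh_le_exp_half_sq (t * X ω)
  rw [Real.cosh_eq] at h2
  convert! h2 using 2 <;> ring_nf

end MomentGeneratingFunction

open ProbabilityTheory Filter Topology in
/-- For a Lee–Yang type random variable `X`, the moment generating function satisfies
`|E[exp(z X)]| ≤ exp((1/2) E[X²] |z|²)` for all `z ∈ ℂ`. -/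
theorem leeYang_mgf_gaussian_bound
    {Ω : Type*} [MeasurableSpace Ω] (P : Measure Ω) [IsProbabilityMeasure P]
    (X : Ω → ℝ) (hX : Measurable X) (hLY : IsLeeYangRV P X) :
    ∀ z : ℂ, ‖∫ ω, Complex.exp (z * (X ω : ℂ)) ∂P‖
      ≤ Real.exp ((1 / 2) * (∫ ω, (X ω) ^ 2 ∂P) * ‖z‖ ^ 2) := by
  intro z
  obtain ⟨hsymm, ⟨b, hb, hint⟩, hne⟩ := hLY
  have hexp := fun t => (integrable_exp_mul_of_integrable_exp_mul_sq hX hb hint t).1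
  have heven : mgf X P = fun t => mgf X P (-t) := by
    funext t
    rw [← mgf_neg, ← mgf_id_map hX.aemeasurable, ← hsymm, ← mgf_id_map hX.neg.aemeasurable]
    rfl
  have hpos : ∀ t, 0 < mgf X P t := fun t => mgf_pos (hexp t)
  have huniv : integrableExpSet X P = Set.univ := Set.eq_univ_of_forall hexp
  have hdiff : Differentiable ℂ (complexMGF X P) := fun w =>
    (hasDerivAt_complexMGF (by simp [huniv])).differentiableAt
  have hnorm : ∀ t : ℝ, ‖complexMGF X P t‖ = mgf X P t := fun t => by
    rw [complexMGF_ofReal, Complex.norm_real, Real.norm_of_nonneg mgf_nonneg]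
  have hlog : ∀ t : ℝ, Real.log (‖complexMGF X P t‖ * ‖complexMGF X P (-t)‖) =
      2 * Real.log (mgf X P t) := fun t => by
    rw [← Complex.ofReal_neg, hnorm, hnorm, ← congrFun heven t,
      Real.log_mul (hpos t).ne' (hpos t).ne']
    ring
  set C := ∫ ω, Real.exp (b * X ω ^ 2) ∂P with hC
  have hC0 : 0 ≤ C := integral_nonneg fun ω => (Real.exp_pos _).le
  have hgrowth : ∀ w : ℂ, ‖complexMGF X P w‖ ≤
      Real.exp ((C + 1 / (4 * b)) * (1 + ‖w‖ ^ 2)) := fun w => by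
    have hre : w.re ^ 2 ≤ ‖w‖ ^ 2 := sq_le_sq' (by
      linarith [neg_abs_le w.re, Complex.abs_re_le_norm w]) (Complex.re_le_norm w)
    refine (norm_complexMGF_le_mgf.trans
      (integrable_exp_mul_of_integrable_exp_mul_sq hX hb hint w.re).2).trans ?_
    have hC1 : C ≤ Real.exp C := by linarith [Real.add_one_le_exp C]
    refine (mul_le_mul_of_nonneg_right hC1 (Real.exp_nonneg _)).trans ?_
    rw [← Real.exp_add, Real.exp_le_exp]
    have h1 : w.re ^ 2 / (4 * b) ≤ ‖w‖ ^ 2 / (4 * b) := by gcongr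
    have h2 : 0 ≤ C * ‖w‖ ^ 2 := by positivity
    have h3 : 0 ≤ 1 / (4 * b) := by positivity
    have h4 : 1 / (4 * b) * ‖w‖ ^ 2 = ‖w‖ ^ 2 / (4 * b) := by ring
    nlinarith
  have hmem := zero_mem_interior_integrableExpSet_sq hb hX hint
  have hψ : HasDerivAt (fun s => 2 * cgf (fun ω => X ω ^ 2) P (s / 2)) (∫ ω, X ω ^ 2 ∂P) 0 := by
    have h1 : HasDerivAt (cgf (fun ω => X ω ^ 2) P) (∫ ω, X ω ^ 2 ∂P) ((0 : ℝ) / 2) := by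
      rw [zero_div]
      have := (analyticAt_cgf hmem).differentiableAt.hasDerivAt
      rwa [deriv_cgf_zero hmem, probReal_univ, div_one] at this
    convert! (h1.comp (0 : ℝ) ((hasDerivAt_id (0 : ℝ)).div_const 2)).const_mul 2 using 1
    ring
  have hle : ∀ᶠ s : ℝ in 𝓝[>] 0,
      Real.log (‖complexMGF X P (√s : ℝ)‖ * ‖complexMGF X P (-(√s : ℝ))‖) ≤
        2 * cgf (fun ω => X ω ^ 2) P (s / 2) := by
    have hcont : Tendsto (fun s : ℝ => s / 2) (𝓝[>] 0) (𝓝 0) := by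
      have : Tendsto (fun s : ℝ => s / 2) (𝓝 0) (𝓝 (0 / 2)) := tendsto_id.div_const 2
      rw [zero_div] at this
      exact this.mono_left nhdsWithin_le_nhds
    filter_upwards [hcont.eventually (mem_interior_iff_mem_nhds.mp hmem), self_mem_nhdsWithin]
      with s hs hs0
    have hsq : √s ^ 2 = s := Real.sq_sqrt (le_of_lt hs0)
    have h1 := mgf_le_mgf_sq heven hexp (√s) (by rw [hsq]; exact hs)
    rw [hsq] at h1
    rw [hlog]
    exact mul_le_mul_of_nonneg_left (Real.log_le_log (hpos _) h1) zero_le_two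
  have hmain := log_norm_mul_le_mul_sq hdiff (by simp [complexMGF]) hne
    (A := C + 1 / (4 * b)) (by positivity) hgrowth hψ (by simp) hle z.re
  rw [hlog] at hmain
  have hmgf : mgf X P z.re ≤ Real.exp ((1 / 2) * (∫ ω, X ω ^ 2 ∂P) * z.re ^ 2) := by
    rw [← Real.log_le_iff_le_exp (hpos _)]
    linarith
  refine (norm_complexMGF_le_mgf.trans hmgf).trans (Real.exp_le_exp.mpr ?_)
  have hv : 0 ≤ ∫ ω, X ω ^ 2 ∂P := integral_nonneg fun ω => sq_nonneg _
  refine mul_le_mul_of_nonneg_left ?_ (by positivity)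
  rw [← sq_abs z.re]
  exact pow_le_pow_left₀ (abs_nonneg _) (Complex.abs_re_le_norm z) 2
end

section
/- Let X be a real random variable of Lee–Yang type with E[X²] > 0. Then for every t ≥ 0, P(X ≥ t) ≤ exp( − t² / (2 E[X²]) ). In particular, E[exp(b′ X²)] < ∞ for every b′ with 0 < b′ < 1/(2 E[X²]). -/
open MeasureTheory

/-- A nonvanishing holomorphic function on a disk has a holomorphic logarithm. -/
lemma exists_log_of_differentiableOn_ball {G : ℂ → ℂ} {R : ℝ} (hR : 0 < R)
    (hG : DifferentiableOn ℂ G (Metric.ball 0 R)) (hG0 : ∀ z ∈ Metric.ball (0 : ℂ) R, G z ≠ 0)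
    (h1 : G 0 = 1) :
    ∃ L : ℂ → ℂ, DifferentiableOn ℂ L (Metric.ball 0 R) ∧ L 0 = 0 ∧
      ∀ z ∈ Metric.ball (0 : ℂ) R, G z = Complex.exp (L z) := by
  have hd : DifferentiableOn ℂ (fun z => deriv G z / G z) (Metric.ball 0 R) :=
    (hG.deriv Metric.isOpen_ball).div hG hG0
  obtain ⟨L₁, hL₁⟩ := hd.isExactOn_ball
  have hL : ∀ z ∈ Metric.ball (0 : ℂ) R,
      HasDerivAt (fun z => L₁ z - L₁ 0) (deriv G z / G z) z := fun z hz =>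
    (hL₁ z hz).sub_const _
  refine ⟨fun z => L₁ z - L₁ 0, fun z hz => (hL z hz).differentiableAt.differentiableWithinAt,
    by simp, fun z hz => ?_⟩
  have hder : ∀ w ∈ Metric.ball (0 : ℂ) R,
      HasDerivAt (fun z => G z * Complex.exp (-(L₁ z - L₁ 0))) 0 w := fun w hw => by
    have hGw := (hG.differentiableAt (Metric.isOpen_ball.mem_nhds hw)).hasDerivAt
    refine (hGw.fun_mul ((hL w hw).fun_neg.cexp)).congr_deriv ?_
    linear_combination -Complex.exp (-(L₁ w - L₁ 0)) * div_mul_cancel₀ (deriv G w) (hG0 w hw)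
  have hconst := Metric.isOpen_ball.is_const_of_deriv_eq_zero
    (convex_ball (0 : ℂ) R).isPreconnected
    (fun w hw => (hder w hw).differentiableAt.differentiableWithinAt)
    (fun w hw => (hder w hw).deriv) hz (Metric.mem_ball_self hR)
  simp only [sub_self, neg_zero, Complex.exp_zero, mul_one, h1] at hconst
  rw [Complex.exp_neg] at hconst
  field_simp at hconst
  exact hconst

/-- Explicit second order Taylor estimate for a bounded holomorphic function on a disk. -/
lemma norm_sub_taylor_two_le_of_differentiableOn_ball {L : ℂ → ℂ} {r M : ℝ}
    (hL : DifferentiableOn ℂ L (Metric.ball 0 r)) (h0 : L 0 = 0)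
    (hM : ∀ z ∈ Metric.ball (0 : ℂ) r, ‖L z‖ ≤ M) {z : ℂ} (hz : z ∈ Metric.ball (0 : ℂ) r) :
    ‖L z - deriv L 0 * z - deriv (deriv L) 0 / 2 * z ^ 2‖ ≤ 4 * M * ‖z‖ ^ 3 / r ^ 3 := by
  have hr : 0 < r := Metric.nonempty_ball.mp ⟨z, hz⟩
  have hmem : Metric.ball (0 : ℂ) r ∈ nhds 0 := Metric.ball_mem_nhds 0 hr
  set g := dslope L 0 with hg
  set k := dslope g 0 with hk
  have hgd : DifferentiableOn ℂ g (Metric.ball 0 r) :=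
    (Complex.differentiableOn_dslope hmem).2 hL
  have hkd : DifferentiableOn ℂ k (Metric.ball 0 r) :=
    (Complex.differentiableOn_dslope hmem).2 hgd
  have hgb : ∀ w ∈ Metric.ball (0 : ℂ) r, ‖g w‖ ≤ M / r := fun w hw =>
    Complex.norm_dslope_le_div_of_mapsTo_ball hL
      (fun x hx => by simpa [h0] using hM x hx) hw
  have hkb : ∀ w ∈ Metric.ball (0 : ℂ) r, ‖k w‖ ≤ 2 * (M / r) / r := fun w hw =>
    Complex.norm_dslope_le_div_of_mapsTo_ball hgd
      (fun x hx => by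
        rw [mem_closedBall_iff_norm]
        linarith [norm_sub_le (g x) (g 0), hgb x hx, hgb 0 (Metric.mem_ball_self hr)]) hw
  have hkl : ‖k z - k 0‖ ≤ 2 * (2 * (M / r) / r) / r * ‖z‖ := by
    have := Complex.dist_le_div_mul_dist_of_mapsTo_ball hkd (R₂ := 2 * (2 * (M / r) / r))
      (fun x hx => by
        rw [mem_closedBall_iff_norm]
        linarith [norm_sub_le (k x) (k 0), hkb x hx, hkb 0 (Metric.mem_ball_self hr)]) hz
    simpa [dist_eq_norm] using this
  have hLg : ∀ w, L w = w * g w := fun w => by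
    have := sub_smul_dslope L 0 w
    simp [h0] at this
    exact this.symm
  have hgk : ∀ w, g w = deriv L 0 + w * k w := fun w => by
    have := sub_smul_dslope g 0 w
    have h2 : g 0 = deriv L 0 := dslope_same L 0
    rw [← h2, hk]
    simp at this
    rw [this]
    ring
  have hk0 : k 0 = deriv (deriv L) 0 / 2 := by
    have h1 : k 0 = deriv g 0 := dslope_same g 0
    have hgdd : DifferentiableOn ℂ (deriv g) (Metric.ball 0 r) := hgd.deriv Metric.isOpen_ball
    have heq : deriv L =ᶠ[nhds 0] fun w => g w + w * deriv g w := by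
      filter_upwards [hmem] with w hw
      have hLfun : L = fun w => w * g w := funext hLg
      have := (hasDerivAt_id' w).fun_mul
        (hgd.differentiableAt (Metric.isOpen_ball.mem_nhds hw)).hasDerivAt
      rw [hLfun]
      simpa using this.deriv
    have h3 := ((hgd.differentiableAt hmem).hasDerivAt).fun_add
      ((hasDerivAt_id' (0 : ℂ)).fun_mul (hgdd.differentiableAt hmem).hasDerivAt)
    have h4 : deriv (deriv L) 0 = deriv g 0 + deriv g 0 := by
      rw [heq.deriv_eq]
      simpa using h3.deriv
    rw [h4, h1]
    ring
  have hrep : L z - deriv L 0 * z - deriv (deriv L) 0 / 2 * z ^ 2 = z ^ 2 * (k z - k 0) := by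
    rw [hLg z, hgk z, ← hk0]
    ring
  rw [hrep, norm_mul, norm_pow]
  calc ‖z‖ ^ 2 * ‖k z - k 0‖ ≤ ‖z‖ ^ 2 * (2 * (2 * (M / r) / r) / r * ‖z‖) := by gcongr
    _ = 4 * M * ‖z‖ ^ 3 / r ^ 3 := by field_simp; ring

/-- Dividing out finitely many zeros from an entire function keeps the maximum on a larger
circle under control. -/
lemma two_pow_mul_norm_le_of_eq_mul_prod {f G : ℂ → ℂ} {R B : ℝ} (hR : 0 < R)
    (hG : Differentiable ℂ G) (hB : ∀ z, ‖z‖ = 3 * R → ‖f z‖ ≤ B) {n : ℕ} {a : Fin n → ℂ}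
    (ha0 : ∀ i, a i ≠ 0) (haR : ∀ i, ‖a i‖ ≤ R) (hfG : ∀ z, f z = G z * ∏ i, (1 - z / a i))
    {z : ℂ} (hz : ‖z‖ ≤ 3 * R) : 2 ^ n * ‖G z‖ ≤ B := by
  have hfr : ∀ w ∈ frontier (Metric.ball (0 : ℂ) (3 * R)), ‖G w‖ ≤ B / 2 ^ n := by
    intro w hw
    rw [frontier_ball _ (by positivity), mem_sphere_zero_iff_norm] at hw
    have hprod : (2 : ℝ) ^ n ≤ ‖∏ i, (1 - w / a i)‖ := by
      rw [norm_prod]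
      calc (2 : ℝ) ^ n = ∏ _i : Fin n, (2 : ℝ) := by simp
        _ ≤ ∏ i, ‖1 - w / a i‖ := by
          refine Finset.prod_le_prod (fun _ _ => by norm_num) fun i _ => ?_
          have h1 : 3 ≤ ‖w / a i‖ := by
            rw [norm_div, hw, le_div_iff₀ (norm_pos_iff.2 (ha0 i))]
            linarith [haR i]
          have h2 := norm_sub_norm_le (w / a i) 1
          rw [norm_sub_rev] at h2
          simp only [norm_one] at h2
          linarith
    rw [le_div_iff₀ (by positivity)]
    calc ‖G w‖ * 2 ^ n ≤ ‖G w‖ * ‖∏ i, (1 - w / a i)‖ := by gcongr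
      _ = ‖f w‖ := by rw [hfG, norm_mul]
      _ ≤ B := hB w hw
  have := Complex.norm_le_of_forall_mem_frontier_norm_le Metric.isBounded_ball
    hG.diffContOnCl hfr (z := z) (by
      rw [closure_ball _ (by positivity)]
      simpa using hz)
  rw [le_div_iff₀ (by positivity)] at this
  linarith

/-- The zeros of an entire function in a disk can be divided out. -/
lemma exists_eq_mul_prod_of_differentiable {f : ℂ → ℂ} (hf : Differentiable ℂ f)
    (h0 : f 0 = 1) {R : ℝ} (hR : 0 < R) :
    ∃ (n : ℕ) (a : Fin n → ℂ) (G : ℂ → ℂ), Differentiable ℂ G ∧ (∀ i, a i ≠ 0) ∧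
      (∀ i, ‖a i‖ ≤ R) ∧ (∀ z, f z = G z * ∏ i, (1 - z / a i)) ∧ ∀ z, ‖z‖ ≤ R → G z ≠ 0 := by
  obtain ⟨B, hB⟩ := (isCompact_sphere (0 : ℂ) (3 * R)).exists_bound_of_continuousOn
    hf.continuous.continuousOn
  replace hB : ∀ z : ℂ, ‖z‖ = 3 * R → ‖f z‖ ≤ B := fun z hz => hB z (by simpa using hz)
  by_contra! hcon
  have hall : ∀ n : ℕ, ∃ (a : Fin n → ℂ) (G : ℂ → ℂ), Differentiable ℂ G ∧ (∀ i, a i ≠ 0) ∧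
      (∀ i, ‖a i‖ ≤ R) ∧ ∀ z, f z = G z * ∏ i, (1 - z / a i) := by
    intro n
    induction n with
    | zero => exact ⟨Fin.elim0, f, hf, fun i => i.elim0, fun i => i.elim0, by simp⟩
    | succ n ih =>
      obtain ⟨a, G, hG, ha0, haR, hfG⟩ := ih
      obtain ⟨c, hcR, hc⟩ := hcon n a G hG ha0 haR hfG
      have hc0 : c ≠ 0 := by
        rintro rfl
        have := hfG 0
        simp [hc, h0] at this
      have hd : Differentiable ℂ (dslope G c) := by
        rw [← differentiableOn_univ] at hG ⊢
        exact (Complex.differentiableOn_dslope Filter.univ_mem).2 hG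
      refine ⟨Fin.cons c a, fun z => -c * dslope G c z, hd.const_mul _, ?_, ?_, fun z => ?_⟩
      · exact fun i => by cases i using Fin.cases <;> simp [hc0, ha0]
      · exact fun i => by cases i using Fin.cases <;> simp [hcR, haR]
      · have h1 := sub_smul_dslope G c z
        rw [hc, sub_zero, smul_eq_mul] at h1
        rw [hfG z, Fin.prod_univ_succ, ← h1]
        simp only [Fin.cons_zero, Fin.cons_succ]
        field_simp
        ring
  obtain ⟨n, hn⟩ := pow_unbounded_of_one_lt B (one_lt_two (α := ℝ))
  obtain ⟨a, G, hG, ha0, haR, hfG⟩ := hall n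
  have hG0 : G 0 = 1 := by simpa [h0] using (hfG 0).symm
  have := two_pow_mul_norm_le_of_eq_mul_prod hR hG hB ha0 haR hfG (z := 0)
    (by simpa using hR.le)
  simp [hG0] at this
  linarith

/-- First and second derivative at the origin of a finite product times an exponential. -/
lemma deriv_zero_of_eq_exp_mul_prod {f L : ℂ → ℂ} (hf : Differentiable ℂ f) (h0 : f 0 = 1)
    {R : ℝ} (hR : 0 < R) (hL : DifferentiableOn ℂ L (Metric.ball 0 R)) {n : ℕ} {a : Fin n → ℂ}
    (ha0 : ∀ i, a i ≠ 0)
    (hfL : ∀ z ∈ Metric.ball (0 : ℂ) R, f z = Complex.exp (L z) * ∏ i, (1 - z / a i)) :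
    deriv L 0 = deriv f 0 + ∑ i, (a i)⁻¹ ∧
      deriv (deriv L) 0 = deriv (deriv f) 0 - deriv f 0 ^ 2 + ∑ i, ((a i)⁻¹) ^ 2 := by
  have hmem : Metric.ball (0 : ℂ) R ∈ nhds 0 := Metric.ball_mem_nhds 0 hR
  have hfne : ∀ᶠ z in nhds (0 : ℂ), f z ≠ 0 :=
    hf.continuous.continuousAt.eventually_ne (by simp [h0])
  have hder : ∀ᶠ z in nhds (0 : ℂ), deriv f z = (deriv L z + ∑ i, (z - a i)⁻¹) * f z := by
    filter_upwards [hmem, hfne] with z hz hz0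
    have hprod : ∏ i, (1 - z / a i) ≠ 0 := fun h => hz0 (by rw [hfL z hz, h, mul_zero])
    have hfac : ∀ i ∈ Finset.univ, 1 - z / a i ≠ 0 := fun i hi => Finset.prod_ne_zero_iff.1 hprod i hi
    have hLz := hL.differentiableAt (Metric.isOpen_ball.mem_nhds hz)
    have hlog : logDeriv f z = deriv L z + ∑ i, (z - a i)⁻¹ := by
      have heq : f =ᶠ[nhds z] fun w => Complex.exp (L w) * ∏ i, (1 - w / a i) := by
        filter_upwards [Metric.isOpen_ball.mem_nhds hz] with w hw using hfL w hw
      have h1 : logDeriv f z = logDeriv (fun w => Complex.exp (L w) * ∏ i, (1 - w / a i)) z := by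
        simp only [logDeriv_apply, heq.deriv_eq, heq.eq_of_nhds]
      rw [h1, logDeriv_mul (f := fun w => Complex.exp (L w))
          (g := fun w => ∏ i, (1 - w / a i)) z (Complex.exp_ne_zero _) hprod hLz.cexp (by fun_prop),
        logDeriv_prod hfac (fun i _ => by fun_prop)]
      congr 1
      · rw [logDeriv_apply, hLz.hasDerivAt.cexp.deriv]
        field_simp [Complex.exp_ne_zero]
      · refine Finset.sum_congr rfl fun i hi => ?_
        have h2 : HasDerivAt (fun w => 1 - w / a i) (-(1 / a i)) z :=
          ((hasDerivAt_id z).div_const _).const_sub 1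
        rw [logDeriv_apply, h2.deriv]
        have h3 := hfac i hi
        have h4 : z - a i ≠ 0 := fun h => h3 (by rw [sub_eq_zero.1 h, div_self (ha0 i), sub_self])
        have h5 : a i - z ≠ 0 := fun h => h4 (by rw [← neg_sub, h, neg_zero])
        have := ha0 i
        field_simp
        ring
    rw [← hlog, logDeriv_apply, div_mul_cancel₀ _ hz0]
  have hinv : ∑ i, (0 - a i)⁻¹ = -∑ i, (a i)⁻¹ := by
    simp [inv_neg]
  have hfirst : deriv f 0 = deriv L 0 - ∑ i, (a i)⁻¹ := by
    have := hder.self_of_nhds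
    rw [h0, hinv] at this
    linear_combination this
  refine ⟨by rw [hfirst]; ring, ?_⟩
  have hL' := ((hL.deriv Metric.isOpen_ball).differentiableAt hmem).hasDerivAt
  have hsum : HasDerivAt (fun z => ∑ i, (z - a i)⁻¹) (∑ i, -((a i)⁻¹) ^ 2) 0 := by
    refine HasDerivAt.fun_sum fun i _ => ?_
    have := ((hasDerivAt_id (0 : ℂ)).sub_const (a i)).fun_inv (by simpa using ha0 i)
    refine this.congr_deriv ?_
    simp [field]
  have hsecond := Filter.EventuallyEq.deriv_eq hder
  rw [((hL'.fun_add hsum).fun_mul (hf 0).hasDerivAt).deriv, h0, hinv, hfirst,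
    Finset.sum_neg_distrib] at hsecond
  rw [hsecond, hfirst]
  ring

/-- A linear factor with purely imaginary root is dominated by a Gaussian on the real line. -/
lemma norm_one_sub_div_le_exp_of_re_eq_zero {a : ℂ} (ha0 : a ≠ 0) (ha : a.re = 0) (s : ℝ) :
    ‖1 - (s : ℂ) / a‖ ≤ Real.exp (-((a⁻¹) ^ 2).re / 2 * s ^ 2) := by
  obtain ⟨y, rfl⟩ : ∃ y : ℝ, a = y * Complex.I := ⟨a.im, by apply Complex.ext <;> simp [ha]⟩
  have hy : y ≠ 0 := by rintro rfl; simp at ha0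
  have h1 : 1 - (s : ℂ) / (y * Complex.I) = 1 + (s / y : ℝ) * Complex.I := by
    push_cast
    rw [div_mul_eq_div_div, Complex.div_I]
    ring
  have h2 : (((y * Complex.I : ℂ)⁻¹) ^ 2).re = -(1 / y ^ 2) := by
    have : ((y * Complex.I : ℂ)⁻¹) ^ 2 = ((-(1 / y ^ 2) : ℝ) : ℂ) := by
      rw [inv_pow, mul_pow, Complex.I_sq]
      push_cast
      field_simp
    rw [this, Complex.ofReal_re]
  have h3 : ‖1 + ((s / y : ℝ) : ℂ) * Complex.I‖ ^ 2 = 1 + (s / y) ^ 2 := by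
    rw [Complex.sq_norm, Complex.normSq_apply]
    simp
    ring
  rw [h1, h2, ← sq_le_sq₀ (norm_nonneg _) (Real.exp_pos _).le, h3, ← Real.exp_nat_mul]
  calc 1 + (s / y) ^ 2 ≤ Real.exp ((s / y) ^ 2) := by linarith [Real.add_one_le_exp ((s / y) ^ 2)]
    _ = _ := by
      congr 1
      push_cast
      field_simp

/-- An entire function of growth at most `exp (O(‖z‖ ^ 2))` whose zeros are all purely imaginary is
dominated on the real line by the exponential of the second order Taylor polynomial of its
logarithm. -/
theorem norm_le_exp_of_zeros_re_eq_zero {f : ℂ → ℂ} (hf : Differentiable ℂ f) (h0 : f 0 = 1)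
    {K C : ℝ} (hK : 0 ≤ K) (hC : 0 < C) (hgrowth : ∀ z, ‖f z‖ ≤ Real.exp (K + C * ‖z‖ ^ 2))
    (hzero : ∀ z, f z = 0 → z.re = 0) (s : ℝ) :
    ‖f s‖ ≤ Real.exp ((deriv f 0).re * s + (deriv (deriv f) 0 - deriv f 0 ^ 2).re / 2 * s ^ 2) := by
  set Q := (deriv f 0).re * s + (deriv (deriv f) 0 - deriv f 0 ^ 2).re / 2 * s ^ 2 with hQ
  have hbound : ∀ᶠ R : ℝ in Filter.atTop,
      ‖f s‖ ≤ Real.exp (Q + 64 * |s| ^ 3 * (K * (R⁻¹) ^ 3 + 9 * C * R⁻¹)) := by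
    filter_upwards [Filter.eventually_gt_atTop (2 * |s|), Filter.eventually_gt_atTop 0] with R hRs hR
    obtain ⟨n, a, G, hG, ha0, haR, hfG, hGne⟩ := exists_eq_mul_prod_of_differentiable hf h0 hR
    have hare : ∀ i, (a i).re = 0 := fun i => hzero _ (by
      rw [hfG, Finset.prod_eq_zero (Finset.mem_univ i) (by rw [div_self (ha0 i), sub_self]),
        mul_zero])
    set M := K + C * (3 * R) ^ 2 with hM
    have hMpos : 0 < M := by positivity
    have hGb : ∀ z ∈ Metric.ball (0 : ℂ) R, ‖G z‖ ≤ Real.exp M := fun z hz => by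
      have hz' : ‖z‖ < R := by simpa using hz
      have h1 := two_pow_mul_norm_le_of_eq_mul_prod hR hG
        (fun w hw => by simpa only [hw] using hgrowth w) ha0 haR hfG (z := z) (by linarith)
      exact (le_mul_of_one_le_left (norm_nonneg _) (one_le_pow₀ one_le_two)).trans h1
    obtain ⟨L, hL, hL0, hGL⟩ := exists_log_of_differentiableOn_ball hR hG.differentiableOn
      (fun z hz => hGne z (by simpa using (Metric.mem_ball.1 hz).le))
      (by simpa [h0] using (hfG 0).symm)
    have hLre : Set.MapsTo L (Metric.ball 0 R) {z | z.re ≤ M} := fun z hz => by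
      have := hGb z hz
      rwa [hGL z hz, Complex.norm_exp, Real.exp_le_exp] at this
    have hsub : Metric.ball (0 : ℂ) (R / 2) ⊆ Metric.ball 0 R := Metric.ball_subset_ball (by linarith)
    have hLb : ∀ z ∈ Metric.ball (0 : ℂ) (R / 2), ‖L z‖ ≤ 2 * M := fun z hz => by
      have hz' : ‖z‖ < R / 2 := by simpa using hz
      refine (Complex.borelCaratheodory_zero hMpos hL hLre hR (hsub hz) hL0).trans ?_
      rw [div_le_iff₀ (by linarith)]
      gcongr
      linarith
    have hsR : (s : ℂ) ∈ Metric.ball (0 : ℂ) (R / 2) := by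
      simp only [mem_ball_zero_iff, Complex.norm_real, Real.norm_eq_abs]
      linarith
    have htaylor := norm_sub_taylor_two_le_of_differentiableOn_ball (hL.mono hsub) hL0 hLb hsR
    obtain ⟨hd1, hd2⟩ := deriv_zero_of_eq_exp_mul_prod hf h0 hR hL ha0
      (fun z hz => by rw [hfG z, hGL z hz])
    have hinvre : (∑ i, (a i)⁻¹).re = 0 := by
      rw [Complex.re_sum]
      exact Finset.sum_eq_zero fun i _ => by simp [Complex.inv_re, hare i]
    have hLs : (L s).re ≤ Q + (∑ i, ((a i)⁻¹) ^ 2).re / 2 * s ^ 2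
        + 64 * |s| ^ 3 * (K * (R⁻¹) ^ 3 + 9 * C * R⁻¹) := by
      have h1 := (Complex.re_le_norm _).trans htaylor
      have h2 : (deriv L 0 * s).re = (deriv f 0).re * s := by
        rw [Complex.re_mul_ofReal, hd1, Complex.add_re, hinvre, add_zero]
      have h3 : (deriv (deriv L) 0 / 2 * (s : ℂ) ^ 2).re =
          (deriv (deriv f) 0 - deriv f 0 ^ 2).re / 2 * s ^ 2
            + (∑ i, ((a i)⁻¹) ^ 2).re / 2 * s ^ 2 := by
        rw [← Complex.ofReal_pow, Complex.re_mul_ofReal, hd2, Complex.div_ofNat_re, Complex.add_re]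
        ring
      have h4 : 4 * (2 * M) * ‖(s : ℂ)‖ ^ 3 / (R / 2) ^ 3
          = 64 * |s| ^ 3 * (K * (R⁻¹) ^ 3 + 9 * C * R⁻¹) := by
        rw [Complex.norm_real, Real.norm_eq_abs, hM]
        field_simp
        ring
      rw [h4, Complex.sub_re, Complex.sub_re, h2, h3] at h1
      linarith
    calc ‖f s‖ = Real.exp (L s).re * ∏ i, ‖1 - (s : ℂ) / a i‖ := by
          rw [hfG, hGL s (hsub hsR), norm_mul, norm_prod, Complex.norm_exp]
      _ ≤ Real.exp (L s).re * ∏ i, Real.exp (-(((a i)⁻¹) ^ 2).re / 2 * s ^ 2) := by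
          gcongr with i
          exact norm_one_sub_div_le_exp_of_re_eq_zero (ha0 i) (hare i) s
      _ = Real.exp ((L s).re - (∑ i, ((a i)⁻¹) ^ 2).re / 2 * s ^ 2) := by
          rw [← Real.exp_sum, ← Real.exp_add, Complex.re_sum, ← Finset.sum_mul, ← Finset.sum_div,
            Finset.sum_neg_distrib]
          congr 1
          ring
      _ ≤ _ := Real.exp_le_exp.2 (by linarith)
  refine ge_of_tendsto ?_ hbound
  have hinv : Filter.Tendsto (fun R : ℝ => R⁻¹) Filter.atTop (nhds 0) := tendsto_inv_atTop_zero
  have := (((hinv.pow 3).const_mul K).add (hinv.const_mul (9 * C))).const_mul (64 * |s| ^ 3)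
    |>.const_add Q
  simpa [Function.comp_def] using (Real.continuous_exp.tendsto _).comp this

/-- A random variable whose moment generating function is bounded by that of a centered Gaussian
has finite quadratic exponential moments up to the Gaussian threshold. -/
lemma ProbabilityTheory.HasSubgaussianMGF.integrable_exp_mul_sq {Ω : Type*} [MeasurableSpace Ω]
    {P : Measure Ω} [SFinite P] {X : Ω → ℝ} {c : NNReal} (h : HasSubgaussianMGF X c P)
    (hX : Measurable X) {b : ℝ} (hb : 0 < b) (hbc : 2 * b * c < 1) :
    Integrable (fun ω => Real.exp (b * X ω ^ 2)) P := by
  refine ⟨by fun_prop, ?_⟩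
  set w : NNReal := ⟨2 * b, by positivity⟩ with hw
  have hwb : (w : ℝ) = 2 * b := rfl
  have hw0 : w ≠ 0 := fun h0 => by
    have : (w : ℝ) = 0 := by rw [h0]; rfl
    linarith
  have hinner : ∀ x : ℝ, ENNReal.ofReal (Real.exp (b * x ^ 2)) =
      ∫⁻ s, ENNReal.ofReal (Real.exp (s * x)) ∂(gaussianReal 0 w) := fun x => by
    have h1 := congrFun (mgf_id_gaussianReal (μ := 0) (v := w)) x
    simp only [mgf, id] at h1
    simp_rw [mul_comm _ x]
    rw [← ofReal_integral_eq_lintegral_ofReal (integrable_exp_mul_gaussianReal x)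
      (ae_of_all _ fun _ => (Real.exp_pos _).le), h1, hwb]
    congr 2
    ring
  have hgauss : Integrable (fun s : ℝ => Real.exp (c * s ^ 2 / 2)) (gaussianReal 0 w) := by
    rw [gaussianReal_of_var_ne_zero 0 hw0, integrable_withDensity_iff_integrable_smul'
      (measurable_gaussianPDF 0 w) (ae_of_all _ fun _ => gaussianPDF_lt_top)]
    have hpos : 0 < 1 / (4 * b) - c / 2 := by
      rw [sub_pos, div_lt_div_iff₀ (by norm_num) (by positivity)]
      linarith
    refine ((integrable_exp_neg_mul_sq hpos).const_mul ((√(2 * Real.pi * w))⁻¹)).congr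
      (ae_of_all _ fun s => ?_)
    simp only
    rw [toReal_gaussianPDF, gaussianPDFReal, smul_eq_mul, mul_assoc _ (Real.exp _), ← Real.exp_add, hwb]
    congr 2
    field_simp
    ring
  rw [hasFiniteIntegral_iff_ofReal (ae_of_all _ fun _ => (Real.exp_pos _).le)]
  calc ∫⁻ ω, ENNReal.ofReal (Real.exp (b * X ω ^ 2)) ∂P
      = ∫⁻ ω, ∫⁻ s, ENNReal.ofReal (Real.exp (s * X ω)) ∂(gaussianReal 0 w) ∂P := by
        simp_rw [hinner]
    _ = ∫⁻ s, ∫⁻ ω, ENNReal.ofReal (Real.exp (s * X ω)) ∂P ∂(gaussianReal 0 w) :=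
        lintegral_lintegral_swap (by fun_prop)
    _ ≤ ∫⁻ s, ENNReal.ofReal (Real.exp (c * s ^ 2 / 2)) ∂(gaussianReal 0 w) := by
        refine lintegral_mono fun s => ?_
        rw [← ofReal_integral_eq_lintegral_ofReal (h.integrable_exp_mul s)
          (ae_of_all _ fun _ => (Real.exp_pos _).le)]
        exact ENNReal.ofReal_le_ofReal (h.mgf_le s)
    _ < ⊤ := hgauss.lintegral_lt_top

lemma Real.mul_le_sq_div_add_mul_sq {b : ℝ} (hb : 0 < b) (s x : ℝ) :
    s * x ≤ s ^ 2 / (4 * b) + b * x ^ 2 := by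
  have : s ^ 2 / (4 * b) + b * x ^ 2 - s * x = (s - 2 * b * x) ^ 2 / (4 * b) := by
    field_simp
    ring
  have h2 : 0 ≤ (s - 2 * b * x) ^ 2 / (4 * b) := by positivity
  linarith

open ProbabilityTheory in
/-- A Lee–Yang type random variable is sub-Gaussian with its own variance as parameter. -/
theorem IsLeeYangRV.hasSubgaussianMGF {Ω : Type*} [MeasurableSpace Ω] {P : Measure Ω}
    [IsProbabilityMeasure P] {X : Ω → ℝ} (hX : Measurable X) (hLY : IsLeeYangRV P X) :
    HasSubgaussianMGF X (∫ ω, (X ω) ^ 2 ∂P).toNNReal P := by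
  obtain ⟨hsymm, ⟨b, hb, hbint⟩, hne⟩ := hLY
  have hint : ∀ t : ℝ, Integrable (fun ω => Real.exp (t * X ω)) P := fun t => by
    refine (hbint.const_mul (Real.exp (t ^ 2 / (4 * b)))).mono' (by fun_prop)
      (ae_of_all _ fun ω => ?_)
    rw [Real.norm_eq_abs, Real.abs_exp, ← Real.exp_add]
    exact Real.exp_le_exp.2 (Real.mul_le_sq_div_add_mul_sq hb _ _)
  have huniv : integrableExpSet X P = Set.univ := Set.eq_univ_of_forall hint
  have hz : ∀ z : ℂ, z.re ∈ interior (integrableExpSet X P) := by simp [huniv]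
  have hmean : ∫ ω, X ω ∂P = 0 := by
    have h1 : ∫ x, x ∂(P.map fun ω => -(X ω)) = ∫ x, x ∂(P.map X) := by rw [hsymm]
    rw [integral_map (by fun_prop) (by fun_prop), integral_map (by fun_prop) (by fun_prop),
      integral_neg] at h1
    linarith
  have hd : Differentiable ℂ (complexMGF X P) := fun z =>
    (hasDerivAt_complexMGF (hz z)).differentiableAt
  have hd1 : deriv (complexMGF X P) 0 = 0 := by
    rw [(hasDerivAt_complexMGF (hz 0)).deriv]
    simp [integral_complex_ofReal, hmean]
  have hd2 : deriv (deriv (complexMGF X P)) 0 = ((∫ ω, (X ω) ^ 2 ∂P : ℝ) : ℂ) := by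
    have h1 := iteratedDeriv_complexMGF (hz 0) 2
    rw [iteratedDeriv_succ, iteratedDeriv_one] at h1
    rw [h1, ← integral_complex_ofReal]
    simp
  have hone : 1 ≤ ∫ ω, Real.exp (b * X ω ^ 2) ∂P := by
    have : ∫ _ω, (1 : ℝ) ∂P ≤ ∫ ω, Real.exp (b * X ω ^ 2) ∂P :=
      integral_mono (integrable_const _) hbint fun ω => Real.one_le_exp (by positivity)
    simpa using this
  have hgrowth : ∀ z, ‖complexMGF X P z‖ ≤
      Real.exp (Real.log (∫ ω, Real.exp (b * X ω ^ 2) ∂P) + 1 / (4 * b) * ‖z‖ ^ 2) := fun z => by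
    rw [Real.exp_add, Real.exp_log (by linarith), mul_comm, ← integral_const_mul]
    refine norm_complexMGF_le_mgf.trans
      (integral_mono (hint _) (hbint.const_mul _) fun ω => ?_)
    simp only
    rw [← Real.exp_add, Real.exp_le_exp]
    refine (Real.mul_le_sq_div_add_mul_sq hb _ _).trans ?_
    have h1 : z.re ^ 2 ≤ ‖z‖ ^ 2 := sq_le_sq.2 (by
      rw [abs_norm]
      exact Complex.abs_re_le_norm z)
    rw [one_div_mul_eq_div]
    gcongr
  refine ⟨hint, fun t => ?_⟩
  have hmain := norm_le_exp_of_zeros_re_eq_zero hd (by simp [complexMGF]) (Real.log_nonneg hone)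
    (by positivity) hgrowth (fun z h => by_contra fun hre => hne z hre h) t
  rw [complexMGF_ofReal, hd1, hd2, Complex.norm_real, Real.norm_of_nonneg mgf_nonneg] at hmain
  refine hmain.trans_eq ?_
  rw [Real.coe_toNNReal _ (integral_nonneg fun ω => sq_nonneg _)]
  congr 1
  simp
  ring

/-- Gaussian tail domination for Lee–Yang type random variables: if `X ∈ 𝓛` with
`E[X²] > 0`, then `P(X ≥ t) ≤ exp(-t²/(2 E[X²]))` for every `t ≥ 0`; in particular
`E[exp(b' X²)] < ∞` for every `0 < b' < 1/(2 E[X²])`. -/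
theorem leeYang_gaussian_tail
    {Ω : Type*} [MeasurableSpace Ω] (P : Measure Ω) [IsProbabilityMeasure P]
    (X : Ω → ℝ) (hX : Measurable X) (hLY : IsLeeYangRV P X)
    (hvar : 0 < ∫ ω, (X ω) ^ 2 ∂P) :
    (∀ t : ℝ, 0 ≤ t →
      P {ω | t ≤ X ω} ≤ ENNReal.ofReal (Real.exp (-(t ^ 2) / (2 * ∫ ω, (X ω) ^ 2 ∂P)))) ∧
    (∀ b' : ℝ, 0 < b' → b' < 1 / (2 * ∫ ω, (X ω) ^ 2 ∂P) →
      Integrable (fun ω => Real.exp (b' * (X ω) ^ 2)) P) := by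
  have hsub := hLY.hasSubgaussianMGF hX
  have hcoe := Real.coe_toNNReal _ hvar.le
  refine ⟨fun t ht => ?_, fun b' hb' hlt => ?_⟩
  · have := hsub.measure_ge_le ht
    rw [hcoe] at this
    rw [← ofReal_measureReal]
    exact ENNReal.ofReal_le_ofReal this
  · refine hsub.integrable_exp_mul_sq hX hb' ?_
    rw [hcoe]
    rw [lt_div_iff₀ (by positivity)] at hlt
    linarith
end

section
/- Let X be a real random variable of Lee–Yang type, and let t > 0 be such that E[exp(i s X)] ≠ 0 for every s ∈ [0, t]. Then E[cos(t X)] ≤ exp( − (1/2) · E[X²] · t² ). -/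
open MeasureTheory

open Complex Metric Filter Asymptotics Topology in
/-- Cauchy-type bound for the remainder of the second-order Taylor polynomial at the origin. -/
lemma norm_sub_taylor_two_le {L : ℂ → ℂ} {r B : ℝ} (hr : 0 < r)
    (hL : DiffContOnCl ℂ L (ball 0 r)) (hL0 : L 0 = 0)
    (hB : ∀ z ∈ closedBall (0 : ℂ) r, ‖L z‖ ≤ B) {z : ℂ} (hz : z ∈ ball (0 : ℂ) r) :
    ‖L z - (deriv L 0 * z + deriv (deriv L) 0 / 2 * z ^ 2)‖ ≤ 3 * B * (‖z‖ / r) ^ 3 := by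
  have hd1 : ‖deriv L 0‖ ≤ B / r :=
    norm_deriv_le_of_forall_mem_sphere_norm_le hr hL fun z hz => hB z (sphere_subset_closedBall hz)
  have hd2 : ‖deriv (deriv L) 0‖ ≤ 2 * B / r ^ 2 := by
    have := norm_iteratedDeriv_le_of_forall_mem_sphere_norm_le 2 hr hL
      fun z hz => hB z (sphere_subset_closedBall hz)
    simpa [iteratedDeriv_succ, iteratedDeriv_one] using this
  set T : ℂ → ℂ := fun z => L z - (deriv L 0 * z + deriv (deriv L) 0 / 2 * z ^ 2) with hT
  have hT0 : T 0 = 0 := by simp [hT, hL0]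
  have hTd : DifferentiableOn ℂ T (ball 0 r) :=
    hL.differentiableOn.sub (by fun_prop)
  have hmaps : Set.MapsTo T (ball 0 r) (closedBall (T 0) (3 * B)) := by
    intro w hw
    have hw' : ‖w‖ ≤ r := (mem_ball_zero_iff.1 hw).le
    rw [hT0, mem_closedBall_zero_iff]
    have h1 : ‖deriv L 0 * w‖ ≤ B := by
      rw [norm_mul]
      calc _ ≤ B / r * r := by gcongr; exact (norm_nonneg _).trans hd1
        _ = B := by field_simp
    have h2 : ‖deriv (deriv L) 0 / 2 * w ^ 2‖ ≤ B := by
      rw [norm_mul, norm_div, norm_pow, Complex.norm_ofNat]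
      calc _ ≤ 2 * B / r ^ 2 / 2 * r ^ 2 := by
            gcongr
            exact div_nonneg ((norm_nonneg _).trans hd2) zero_le_two
        _ = B := by field_simp
    calc ‖T w‖ ≤ ‖L w‖ + (‖deriv L 0 * w‖ + ‖deriv (deriv L) 0 / 2 * w ^ 2‖) :=
          (norm_sub_le _ _).trans (by gcongr; exact norm_add_le _ _)
      _ ≤ B + (B + B) := by
          gcongr
          exact hB w (ball_subset_closedBall hw)
      _ = 3 * B := by ring
  have ho : (fun w => T w - T 0) =o[𝓝 0] fun w : ℂ => ‖w - 0‖ ^ 2 := by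
    have han : AnalyticAt ℂ L 0 := hL.differentiableOn.analyticAt (ball_mem_nhds 0 hr)
    have h := han.hasFPowerSeriesAt.isBigO_sub_partialSum_pow 3
    have h' : T =O[𝓝 0] fun w : ℂ => ‖w‖ ^ 3 := by
      refine h.congr_left fun w => ?_
      simp [hT, FormalMultilinearSeries.partialSum, Finset.sum_range_succ, iteratedDeriv_succ, hL0]
      ring
    simp only [hT0, sub_zero]
    refine h'.trans_isLittleO ?_
    exact (isLittleO_pow_pow (𝕜 := ℝ) (by norm_num : 2 < 3)).comp_tendsto
      (by simpa using (continuous_norm (E := ℂ)).tendsto 0)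
  have := dist_le_mul_div_pow_of_mapsTo_ball_of_isLittleO hTd hmaps ho hz
  simpa [hT0] using this

open Complex Metric Filter Topology in
/-- A zero-free holomorphic function on a disc, normalized at the center, has a logarithm. -/
lemma exists_log_on_ball {F : ℂ → ℂ} {R : ℝ} (hR : 0 < R) (hF : DifferentiableOn ℂ F (ball 0 R))
    (hF0 : F 0 = 1) (hnz : ∀ z ∈ ball (0 : ℂ) R, F z ≠ 0) :
    ∃ L : ℂ → ℂ, L 0 = 0 ∧ DifferentiableOn ℂ L (ball 0 R) ∧
      deriv (deriv L) 0 = deriv (logDeriv F) 0 ∧ ∀ z ∈ ball (0 : ℂ) R, exp (L z) = F z := by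
  have hlog : DifferentiableOn ℂ (logDeriv F) (ball 0 R) := (hF.deriv isOpen_ball).div hF hnz
  obtain ⟨L, hL0, hL⟩ := hlog.isExactOn_ball.with_val_at 0 0
  refine ⟨L, hL0, fun z hz => (hL z hz).differentiableAt.differentiableWithinAt, ?_, fun z hz => ?_⟩
  · refine EventuallyEq.deriv_eq ?_
    filter_upwards [ball_mem_nhds 0 hR] with z hz using (hL z hz).deriv
  · have hder : ∀ w ∈ ball (0 : ℂ) R, HasDerivAt (fun w => F w * exp (-L w)) 0 w := by
      intro w hw
      have h := ((hF.differentiableAt (isOpen_ball.mem_nhds hw)).hasDerivAt).mul (hL w hw).neg.cexp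
      convert! h using 1
      have := hnz w hw
      simp only [logDeriv_apply]
      field_simp
      ring
    have hconst := isOpen_ball.is_const_of_deriv_eq_zero (convex_ball (0 : ℂ) R).isPreconnected
      (fun w hw => (hder w hw).differentiableAt.differentiableWithinAt)
      (fun w hw => (hder w hw).deriv) hz (mem_ball_self hR)
    simp only [hF0, hL0, neg_zero, exp_zero, mul_one, exp_neg] at hconst
    field_simp at hconst
    exact hconst.symm

open Complex Metric Filter Topology in
/-- Second-order expansion of `log ‖F (it) F (-it)‖` for a zero-free function of bounded size. -/
lemma norm_mul_le_of_zero_free {F : ℂ → ℂ} {R A t : ℝ} (hF : DifferentiableOn ℂ F (ball 0 R))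
    (hF0 : F 0 = 1) (hnz : ∀ z ∈ ball (0 : ℂ) R, F z ≠ 0) (hA : 0 < A)
    (hbd : ∀ z ∈ ball (0 : ℂ) R, ‖F z‖ ≤ Real.exp A) (ht : 0 < t) (htR : t < R / 2) :
    ‖F (t * I) * F (-(t * I))‖
      ≤ Real.exp (-t ^ 2 * (deriv (logDeriv F) 0).re + 96 * A * t ^ 3 / R ^ 3) := by
  have hR : 0 < R := by linarith
  obtain ⟨L, hL0, hL, hL2, hexp⟩ := exists_log_on_ball hR hF hF0 hnz
  have hre : Set.MapsTo L (ball 0 R) {z | z.re ≤ A} := by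
    intro z hz
    have := hbd z hz
    rwa [← hexp z hz, norm_exp, Real.exp_le_exp] at this
  have hsub : closedBall (0 : ℂ) (R / 2) ⊆ ball 0 R := closedBall_subset_ball (by linarith)
  have hB : ∀ z ∈ closedBall (0 : ℂ) (R / 2), ‖L z‖ ≤ 2 * A := by
    intro z hz
    have hz' : ‖z‖ ≤ R / 2 := mem_closedBall_zero_iff.1 hz
    refine (borelCaratheodory_zero hA hL hre hR (hsub hz) hL0).trans ?_
    rw [div_le_iff₀ (by linarith)]
    nlinarith
  have hD : DiffContOnCl ℂ L (ball 0 (R / 2)) := hL.diffContOnCl_ball hsub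
  have hT : ∀ z : ℂ, ‖z‖ = t →
      ‖L z - (deriv L 0 * z + deriv (deriv L) 0 / 2 * z ^ 2)‖ ≤ 48 * A * t ^ 3 / R ^ 3 := by
    intro z hz
    have h := norm_sub_taylor_two_le (by linarith) hD hL0 hB (z := z)
      (by rw [mem_ball_zero_iff, hz]; exact htR)
    rw [hz] at h
    convert h using 1
    field_simp
    ring
  have h1 := (re_le_norm _).trans (hT (t * I) (by simp [ht.le]))
  have h2 := (re_le_norm _).trans (hT (-(t * I)) (by simp [ht.le]))
  have hmem : ∀ z : ℂ, ‖z‖ = t → z ∈ ball (0 : ℂ) R := fun z hz => by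
    rw [mem_ball_zero_iff, hz]; linarith
  rw [← hexp _ (hmem (t * I) (by simp [ht.le])), ← hexp _ (hmem (-(t * I)) (by simp [ht.le])),
    ← exp_add, norm_exp, Real.exp_le_exp, ← hL2]
  have h3 : ((L (t * I) - (deriv L 0 * (t * I) + deriv (deriv L) 0 / 2 * (t * I) ^ 2))
      + (L (-(t * I)) - (deriv L 0 * (-(t * I)) + deriv (deriv L) 0 / 2 * (-(t * I)) ^ 2)))
      = L (t * I) + L (-(t * I)) + ((t ^ 2 : ℝ) : ℂ) * deriv (deriv L) 0 := by
    push_cast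
    linear_combination (-(deriv (deriv L) 0) * t ^ 2) * I_sq
  have h4 := congrArg Complex.re h3
  rw [add_re, add_re _ (((t ^ 2 : ℝ) : ℂ) * _), re_ofReal_mul] at h4
  have h5 : 96 * A * t ^ 3 / R ^ 3 = 48 * A * t ^ 3 / R ^ 3 + 48 * A * t ^ 3 / R ^ 3 := by ring
  linarith

open Complex Metric Filter Topology in
/-- For an entire function whose zeros are purely imaginary and larger than `t` in modulus,
`‖F (it) F (-it)‖` is bounded by its second-order expansion, up to an error controlled by the
size of `F` on a large circle. -/
lemma norm_mul_le_of_imaginary_zeros {R t : ℝ} (ht : 0 < t) (htR : t < R / 2) (n : ℕ) :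
    ∀ {F : ℂ → ℂ} {A : ℝ}, Differentiable ℂ F → F 0 = 1 →
      (∀ z, F z = 0 → z.re = 0 ∧ t < |z.im|) →
      (∀ z ∈ sphere (0 : ℂ) (3 * R), ‖F z‖ ≤ Real.exp A) → A < n * Real.log 2 →
      ‖F (t * I) * F (-(t * I))‖
        ≤ Real.exp (-t ^ 2 * (deriv (logDeriv F) 0).re + 96 * (A + 1) * t ^ 3 / R ^ 3) := by
  have hR : 0 < R := by linarith
  induction n with
  | zero =>
    intro F A hF hF0 _ hbd hA
    have h := norm_le_of_forall_mem_frontier_norm_le isBounded_ball hF.diffContOnCl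
      (fun z hz => hbd z (frontier_ball_subset_sphere hz))
      (subset_closure (mem_ball_self (by positivity : 0 < 3 * R)))
    rw [hF0, norm_one, Real.one_le_exp_iff] at h
    simp at hA
    linarith
  | succ n ih =>
    intro F A hF hF0 hz hbd hA
    have hmax : ∀ z ∈ ball (0 : ℂ) (3 * R), ‖F z‖ ≤ Real.exp A := fun z hz =>
      norm_le_of_forall_mem_frontier_norm_le isBounded_ball hF.diffContOnCl
        (fun z hz => hbd z (frontier_ball_subset_sphere hz)) (subset_closure hz)
    have hA0 : 0 ≤ A := by
      have h := hmax 0 (mem_ball_self (by positivity))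
      rwa [hF0, norm_one, Real.one_le_exp_iff] at h
    by_cases hzero : ∃ a ∈ ball (0 : ℂ) R, F a = 0
    · obtain ⟨a, haR, ha⟩ := hzero
      obtain ⟨y, rfl⟩ : ∃ y : ℝ, a = y * I :=
        ⟨a.im, by apply Complex.ext <;> simp [(hz a ha).1]⟩
      have hty : t < |y| := by simpa using (hz _ ha).2
      have hyR : |y| < R := by simpa using haR
      have hy : y ≠ 0 := abs_pos.1 (ht.trans hty)
      have hyC : (y : ℂ) ≠ 0 := by exact_mod_cast hy
      set a : ℂ := y * I with ha_def
      have ha0 : a ≠ 0 := mul_ne_zero hyC I_ne_zero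
      set h : ℂ → ℂ := fun z => -a * dslope F a z with hh
      have hfac : ∀ z, F z = (1 - z / a) * h z := by
        intro z
        have := sub_smul_dslope F a z
        rw [ha, sub_zero, smul_eq_mul] at this
        rw [← this, hh]
        field_simp
        ring
      have hhd : Differentiable ℂ h := by
        have : Differentiable ℂ (dslope F a) := by
          rw [← differentiableOn_univ] at hF ⊢
          exact (differentiableOn_dslope univ_mem).2 hF
        exact this.const_mul _
      have hh0 : h 0 = 1 := by simpa [hF0] using (hfac 0).symm
      have hhbd : ∀ z ∈ sphere (0 : ℂ) (3 * R), ‖h z‖ ≤ Real.exp (A - Real.log 2) := by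
        intro z hz'
        have hzR : ‖z‖ = 3 * R := mem_sphere_zero_iff_norm.1 hz'
        have hna : ‖a‖ = |y| := by simp [ha_def]
        have h2 : 2 ≤ ‖1 - z / a‖ := by
          have h3 : 3 ≤ ‖z / a‖ := by
            rw [norm_div, hzR, hna, le_div_iff₀ (ht.trans hty)]
            linarith
          have := norm_sub_norm_le (z / a) 1
          rw [norm_sub_rev, norm_one] at this
          linarith
        have h4 := hbd z hz'
        rw [hfac, norm_mul] at h4
        rw [Real.exp_sub, Real.exp_log two_pos, le_div_iff₀ two_pos]
        nlinarith [norm_nonneg (h z)]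
      have hhz : ∀ z, h z = 0 → z.re = 0 ∧ t < |z.im| :=
        fun z hz0 => hz z (by rw [hfac, hz0, mul_zero])
      have key := ih hhd hh0 hhz hhbd (by push_cast at hA; linarith)
      have hD : deriv (logDeriv F) 0 = deriv (logDeriv h) 0 + ((1 / y ^ 2 : ℝ) : ℂ) := by
        have hPd : DifferentiableAt ℂ (fun z : ℂ => 1 - z / a) 0 := by fun_prop
        have he : logDeriv F =ᶠ[𝓝 0] fun z => logDeriv h z + -1 / a / (1 - z / a) := by
          have hP : ∀ᶠ z : ℂ in 𝓝 0, 1 - z / a ≠ 0 :=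
            hPd.continuousAt.eventually_ne (by simp)
          have hh' : ∀ᶠ z : ℂ in 𝓝 0, h z ≠ 0 :=
            hhd.continuous.continuousAt.eventually_ne (by simp [hh0])
          filter_upwards [hP, hh'] with z hz1 hz2
          have hd : HasDerivAt (fun z : ℂ => 1 - z / a) (-1 / a) z := by
            convert! ((hasDerivAt_id z).div_const a).const_sub 1 using 1
            ring
          rw [funext hfac, logDeriv_mul z hz1 hz2 hd.differentiableAt (hhd z), add_comm]
          congr 1
          rw [logDeriv_apply, hd.deriv]
        rw [he.deriv_eq]
        have h1 : HasDerivAt (logDeriv h) (deriv (logDeriv h) 0) 0 := by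
          refine DifferentiableAt.hasDerivAt ?_
          exact ((hhd.analyticAt 0).deriv.div (hhd.analyticAt 0) (by simp [hh0])).differentiableAt
        have h2 : HasDerivAt (fun z : ℂ => -1 / a / (1 - z / a)) (-1 / a ^ 2) 0 := by
          have hd : HasDerivAt (fun z : ℂ => 1 - z / a) (-1 / a) 0 := by
            convert! ((hasDerivAt_id (0 : ℂ)).div_const a).const_sub 1 using 1
            ring
          convert! (hasDerivAt_const (0 : ℂ) (-1 / a)).div hd (by simp) using 1
          field_simp
          simp
        rw [(h1.fun_add h2).deriv, ha_def, mul_pow, I_sq]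
        push_cast
        congr 1
        field_simp
      have hprod : ‖F (t * I) * F (-(t * I))‖
          = (1 - t ^ 2 / y ^ 2) * ‖h (t * I) * h (-(t * I))‖ := by
        rw [hfac (t * I), hfac (-(t * I))]
        have : (1 - t * I / a) * h (t * I) * ((1 - -(t * I) / a) * h (-(t * I)))
            = ((1 - t ^ 2 / y ^ 2 : ℝ) : ℂ) * (h (t * I) * h (-(t * I))) := by
          push_cast
          rw [ha_def]
          field_simp
          ring
        rw [this, norm_mul, norm_real, Real.norm_of_nonneg]
        rw [sub_nonneg, div_le_one (by positivity)]
        exact sq_le_sq.2 (by rw [abs_of_pos ht]; exact hty.le)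
      rw [hprod, hD, add_re, ofReal_re]
      calc (1 - t ^ 2 / y ^ 2) * ‖h (t * I) * h (-(t * I))‖
          ≤ Real.exp (-(t ^ 2 / y ^ 2)) * Real.exp (-t ^ 2 * (deriv (logDeriv h) 0).re
              + 96 * (A - Real.log 2 + 1) * t ^ 3 / R ^ 3) := by
            gcongr
            exact Real.one_sub_le_exp_neg _
        _ ≤ _ := by
            rw [← Real.exp_add, Real.exp_le_exp]
            have : 96 * (A - Real.log 2 + 1) * t ^ 3 / R ^ 3 ≤ 96 * (A + 1) * t ^ 3 / R ^ 3 := by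
              gcongr
              linarith [Real.log_pos one_lt_two]
            have h5 : -t ^ 2 * ((deriv (logDeriv h) 0).re + 1 / y ^ 2)
              = -(t ^ 2 / y ^ 2) + -t ^ 2 * (deriv (logDeriv h) 0).re := by ring
            linarith
    · push Not at hzero
      refine norm_mul_le_of_zero_free hF.differentiableOn hF0 hzero (by linarith) ?_ ht htR
      intro z hz'
      refine (hmax z (ball_subset_ball (by linarith) hz')).trans ?_
      gcongr
      linarith

open Complex Metric Filter Topology in
/-- If an entire function of order at most two has only purely imaginary zeros, all larger than
`t` in modulus, then `‖F (it) F (-it)‖` is at most its second-order expansion. -/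
lemma norm_mul_le_of_order_two {F : ℂ → ℂ} {C c t : ℝ} (hF : Differentiable ℂ F) (hF0 : F 0 = 1)
    (hz : ∀ z, F z = 0 → z.re = 0 ∧ t < |z.im|) (hbd : ∀ z, ‖F z‖ ≤ Real.exp (C + c * ‖z‖ ^ 2))
    (ht : 0 < t) :
    ‖F (t * I) * F (-(t * I))‖ ≤ Real.exp (-t ^ 2 * (deriv (logDeriv F) 0).re) := by
  set D := (deriv (logDeriv F) 0).re
  have hev : ∀ᶠ R : ℝ in atTop, ‖F (t * I) * F (-(t * I))‖
      ≤ Real.exp (-t ^ 2 * D + 96 * ((C + c * (3 * R) ^ 2) + 1) * t ^ 3 / R ^ 3) := by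
    filter_upwards [eventually_gt_atTop (2 * t)] with R hR
    obtain ⟨n, hn⟩ := exists_nat_gt ((C + c * (3 * R) ^ 2) / Real.log 2)
    refine norm_mul_le_of_imaginary_zeros ht (by linarith) n hF hF0 hz (fun z hz' => ?_)
      ((div_lt_iff₀ (Real.log_pos one_lt_two)).1 hn)
    simpa [mem_sphere_zero_iff_norm.1 hz'] using hbd z
  refine ge_of_tendsto ?_ hev
  have h1 : Tendsto (fun R : ℝ => 96 * (C + 1) * t ^ 3 * (R⁻¹) ^ 3 + 864 * c * t ^ 3 * R⁻¹)
      atTop (𝓝 (96 * (C + 1) * t ^ 3 * 0 ^ 3 + 864 * c * t ^ 3 * 0)) :=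
    ((tendsto_inv_atTop_zero.pow 3).const_mul _).add (tendsto_inv_atTop_zero.const_mul _)
  have h2 : Tendsto (fun R : ℝ => -t ^ 2 * D + 96 * ((C + c * (3 * R) ^ 2) + 1) * t ^ 3 / R ^ 3)
      atTop (𝓝 (-t ^ 2 * D)) := by
    have := h1.const_add (-t ^ 2 * D)
    simp only [ne_eq, OfNat.ofNat_ne_zero, not_false_eq_true, zero_pow, mul_zero, add_zero] at this
    refine this.congr' ?_
    filter_upwards [eventually_gt_atTop 0] with R hR
    field_simp
    ring
  exact (Real.continuous_exp.tendsto _).comp h2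

open Complex ProbabilityTheory in
/-- A random variable with a finite Gaussian moment has moment generating function defined on
the whole real line. -/
lemma integrableExpSet_eq_univ_of_integrable_exp_sq {Ω : Type*} [MeasurableSpace Ω]
    {P : Measure Ω} {X : Ω → ℝ} (hX : Measurable X) {b : ℝ} (hb : 0 < b)
    (hint : Integrable (fun ω => Real.exp (b * (X ω) ^ 2)) P) :
    integrableExpSet X P = Set.univ := by
  refine Set.eq_univ_of_forall fun x => ?_
  refine (hint.const_mul (Real.exp (x ^ 2 / (4 * b)))).mono' (by fun_prop) (.of_forall fun ω => ?_)
  rw [Real.norm_of_nonneg (Real.exp_pos _).le, ← Real.exp_add, Real.exp_le_exp,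
    div_add' _ _ _ (by positivity), le_div_iff₀ (by positivity)]
  nlinarith [sq_nonneg (x - 2 * b * X ω)]

open Complex ProbabilityTheory in
/-- A random variable with a finite Gaussian moment has complex moment generating function of
order at most two. -/
lemma norm_complexMGF_le_exp_sq {Ω : Type*} [MeasurableSpace Ω]
    {P : Measure Ω} {X : Ω → ℝ} (hX : Measurable X) {b : ℝ} (hb : 0 < b)
    (hint : Integrable (fun ω => Real.exp (b * (X ω) ^ 2)) P) (z : ℂ) :
    ‖complexMGF X P z‖
      ≤ Real.exp ((∫ ω, Real.exp (b * (X ω) ^ 2) ∂P) + 1 / (4 * b) * ‖z‖ ^ 2) := by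
  set K := ∫ ω, Real.exp (b * (X ω) ^ 2) ∂P
  have hre : z.re ^ 2 ≤ ‖z‖ ^ 2 := sq_le_sq.2 (by simpa using abs_re_le_norm z)
  have hset : z.re ∈ integrableExpSet X P := by
    rw [integrableExpSet_eq_univ_of_integrable_exp_sq hX hb hint]; trivial
  calc ‖complexMGF X P z‖ ≤ mgf X P z.re := norm_complexMGF_le_mgf
    _ ≤ ∫ ω, Real.exp (1 / (4 * b) * ‖z‖ ^ 2) * Real.exp (b * (X ω) ^ 2) ∂P := by
        refine integral_mono hset (hint.const_mul _) fun ω => ?_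
        rw [← Real.exp_add, Real.exp_le_exp, one_div_mul_eq_div,
          div_add' _ _ _ (by positivity), le_div_iff₀ (by positivity)]
        nlinarith [sq_nonneg (z.re - 2 * b * X ω)]
    _ = Real.exp (1 / (4 * b) * ‖z‖ ^ 2) * K := integral_const_mul _ _
    _ ≤ Real.exp (1 / (4 * b) * ‖z‖ ^ 2) * Real.exp K := by
        gcongr
        linarith [Real.add_one_le_exp K]
    _ = _ := by rw [← Real.exp_add, add_comm]

open ProbabilityTheory in
/-- The complex moment generating function of a symmetric random variable is even. -/
lemma complexMGF_neg_of_map_neg_eq {Ω : Type*} [MeasurableSpace Ω] {P : Measure Ω} {X : Ω → ℝ}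
    (hX : Measurable X) (hsymm : P.map (fun ω => -(X ω)) = P.map X) (z : ℂ) :
    complexMGF X P (-z) = complexMGF X P z := by
  have h : complexMGF X P (-z) = complexMGF (fun ω => -(X ω)) P z := by simp [complexMGF]
  rw [h, ← complexMGF_id_map hX.fun_neg.aemeasurable, hsymm, complexMGF_id_map hX.aemeasurable]

open Complex ProbabilityTheory in
/-- If `X` is of Lee–Yang type and the characteristic function `E[exp(isX)]` does not
vanish for `s ∈ [0, t]`, then `E[cos(tX)] ≤ exp(-(1/2) E[X²] t²)`. -/
theorem leeYang_cos_bound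
    {Ω : Type*} [MeasurableSpace Ω] (P : Measure Ω) [IsProbabilityMeasure P]
    (X : Ω → ℝ) (hX : Measurable X) (hLY : IsLeeYangRV P X)
    (t : ℝ) (ht : 0 < t)
    (hnz : ∀ s ∈ Set.Icc (0 : ℝ) t,
      (∫ ω, Complex.exp (Complex.I * (s : ℂ) * (X ω : ℂ)) ∂P) ≠ 0) :
    (∫ ω, Real.cos (t * X ω) ∂P)
      ≤ Real.exp (-(1 / 2) * (∫ ω, (X ω) ^ 2 ∂P) * t ^ 2) := by
  obtain ⟨hsymm, ⟨b, hb, hint⟩, hLYz⟩ := hLY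
  set F : ℂ → ℂ := complexMGF X P with hFdef
  have hmem : ∀ x : ℝ, x ∈ interior (integrableExpSet X P) := by
    simp [integrableExpSet_eq_univ_of_integrable_exp_sq hX hb hint]
  have hF : Differentiable ℂ F := fun z => (hasDerivAt_complexMGF (hmem z.re)).differentiableAt
  have hF0 : F 0 = 1 := by simp [hFdef, complexMGF]
  have heven : ∀ z, F (-z) = F z := complexMGF_neg_of_map_neg_eq hX hsymm
  have hz : ∀ z, F z = 0 → z.re = 0 ∧ t < |z.im| := by
    intro z hz0
    have hre : z.re = 0 := by
      by_contra h
      exact hLYz z h hz0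
    refine ⟨hre, ?_⟩
    by_contra! him
    refine hnz |z.im| ⟨abs_nonneg _, him⟩ ?_
    change F (I * (|z.im| : ℝ)) = 0
    have hzI : z = I * z.im := by apply Complex.ext <;> simp [hre]
    rcases abs_choice z.im with h | h
    · rw [h, ← hzI, hz0]
    · rw [h, ofReal_neg, mul_neg, ← hzI, heven, hz0]
  have hD : deriv (logDeriv F) 0 = ((∫ ω, (X ω) ^ 2 ∂P : ℝ) : ℂ) := by
    have h1 : deriv F 0 = 0 := by
      have h := deriv_comp_neg F 0
      simp only [heven, neg_zero] at h
      exact self_eq_neg.1 h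
    have h2 : deriv (deriv F) 0 = ((∫ ω, (X ω) ^ 2 ∂P : ℝ) : ℂ) := by
      have h := iteratedDeriv_complexMGF (X := X) (μ := P) (z := 0) (hmem _) 2
      rw [iteratedDeriv_succ, iteratedDeriv_one] at h
      rw [h, ← integral_complex_ofReal]
      simp
    have h3 := ((hF.analyticAt 0).deriv.differentiableAt.hasDerivAt).div (hF 0).hasDerivAt
      (by simp [hF0])
    have h4 := h3.deriv
    rw [h1, h2, hF0] at h4
    simpa [logDeriv] using h4
  have hcos : F (t * I) = ((∫ ω, Real.cos (t * X ω) ∂P : ℝ) : ℂ) := by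
    have hi : ∀ z : ℂ, Integrable (fun ω => exp (z * X ω)) P := fun z =>
      integrable_cexp_mul_of_re_mem_interior_integrableExpSet (hmem z.re)
    have h : F (t * I) = (F (t * I) + F (-(t * I))) / 2 := by rw [heven]; ring
    rw [h, hFdef, complexMGF, complexMGF, ← integral_add (hi _) (hi _), ← integral_div,
      ← integral_complex_ofReal]
    congr 1 with ω
    rw [ofReal_cos, Complex.cos]
    push_cast
    congr 3 <;> ring
  have key := norm_mul_le_of_order_two hF hF0 hz (norm_complexMGF_le_exp_sq hX hb hint) ht
  rw [heven, hD, ofReal_re, norm_mul, hcos, norm_real, Real.norm_eq_abs] at key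
  refine (le_abs_self _).trans ((mul_self_le_mul_self_iff (abs_nonneg _) (Real.exp_pos _).le).2 ?_)
  rw [← Real.exp_add]
  refine key.trans_eq (congrArg Real.exp ?_)
  ring
end
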